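/- arXiv:2011.02163 — 5 statements merged into one kernel-verified Lean document; each statement's English description precedes it below -/
import Mathlib

section
/- Let f : ℂ → ℂ be a map, let U ⊆ ℂ, let α ∈ ℝ be irrational and set λ = e^{2πiα}. Suppose there is a bijective holomorphic map φ : 𝔻 → U from the open unit disc 𝔻 = {z ∈ ℂ : |z| < 1} onto U such that φ(λ·z) = f(φ(z)) for all z ∈ 𝔻 (the situation of a Siegel disc). Then h(f, K) = 0 for every compact subset K ⊆ U. -/
open Dynamics

/-- A subset has nonpositive entropy if, at every scale, some finite set shadows all orbits of
all lengths. -/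
lemma coverEntropy_nonpos_of_uniform_cover {X : Type*} [UniformSpace X] {T : X → X} {F : Set X}
    (h : ∀ V ∈ uniformity X, ∃ s : Finset X, ∀ n, IsDynCoverOf T F V n s) :
    coverEntropy T F ≤ 0 := by
  refine iSup₂_le fun V hV ↦ ?_
  obtain ⟨s, hs⟩ := h V hV
  rcases F.eq_empty_or_nonempty with rfl | hF
  · simp
  have hs0 : (s.card : ENNReal) ≠ 0 := by
    have hne : s.Nonempty := (hs 0).nonempty hF
    exact_mod_cast hne.card_ne_zero
  rw [← ExpGrowth.expGrowthSup_const hs0 (ENNReal.natCast_ne_top _)]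
  refine ExpGrowth.expGrowthSup_monotone fun n ↦ ?_
  simpa using ENat.toENNReal_mono (hs n).coverMincard_le_card

/-- Images of a compact set on which `T` is semiconjugate to a distance-preserving map have
nonpositive entropy. -/
lemma coverEntropy_image_nonpos_of_isometry {X Y : Type*} [PseudoMetricSpace X]
    [PseudoMetricSpace Y] {S : X → X} {T : Y → Y} {φ : X → Y} {C : Set X} (hC : IsCompact C)
    (hS : Isometry S) (hSC : Set.MapsTo S C C) (hφ : ContinuousOn φ C)
    (hconj : ∀ z ∈ C, φ (S z) = T (φ z)) : coverEntropy T (φ '' C) ≤ 0 := by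
  classical
  have iter (n : ℕ) : ∀ z ∈ C, T^[n] (φ z) = φ (S^[n] z) := by
    induction n with
    | zero => simp
    | succ n ih =>
      intro z hz
      rw [Function.iterate_succ_apply, Function.iterate_succ_apply, ← hconj z hz, ih _ (hSC hz)]
  have iso (n : ℕ) : Isometry S^[n] := by
    induction n with
    | zero => exact isometry_id
    | succ n ih => exact ih.comp hS
  refine coverEntropy_nonpos_of_uniform_cover fun V hV ↦ ?_
  obtain ⟨ε, hε, hεV⟩ := Metric.mem_uniformity_dist.1 hV
  obtain ⟨δ, hδ, hδε⟩ :=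
    Metric.uniformContinuousOn_iff.1 (hC.uniformContinuousOn_of_continuous hφ) ε hε
  obtain ⟨t, htC, htfin, hCt⟩ := hC.finite_cover_balls hδ
  refine ⟨htfin.toFinset.image φ, fun n ↦ ?_⟩
  rintro _ ⟨z, hz, rfl⟩
  obtain ⟨w, hw, hzw⟩ := Set.mem_iUnion₂.1 (hCt hz)
  refine ⟨φ w, by simpa using ⟨w, hw, rfl⟩, mem_dynEntourage.2 fun k _ ↦ hεV ?_⟩
  rw [iter k z hz, iter k w (htC hw)]
  refine hδε _ (hSC.iterate k hz) _ (hSC.iterate k (htC hw)) ?_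
  rwa [(iso k).dist_eq]

/-- An injective holomorphic map on an open preconnected set is open there. -/
lemma isOpen_image_of_injOn_differentiableOn {φ : ℂ → ℂ} {D s : Set ℂ} (hD : IsOpen D)
    (hDc : IsPreconnected D) (hφ : DifferentiableOn ℂ φ D) (hinj : Set.InjOn φ D)
    (hs : s ⊆ D) (hso : IsOpen s) : IsOpen (φ '' s) := by
  rcases (hφ.analyticOnNhd hD).is_constant_or_isOpen hDc with ⟨c, hc⟩ | h
  · have hsub : s.Subsingleton := fun x hx y hy ↦
      hinj (hs hx) (hs hy) ((hc x (hs hx)).trans (hc y (hs hy)).symm)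
    rcases s.eq_empty_or_nonempty with rfl | ⟨x, hx⟩
    · simp
    · rw [hsub.eq_singleton_of_mem hx] at hso
      exact absurd hso (not_isOpen_singleton x)
  · exact h s hs hso

/-- Compact subsets of the injective holomorphic image of the unit disc are covered by the image
of a smaller closed disc. -/
lemma exists_subset_image_closedBall {φ : ℂ → ℂ} {K : Set ℂ}
    (hφ : DifferentiableOn ℂ φ (Metric.ball 0 1)) (hinj : Set.InjOn φ (Metric.ball 0 1))
    (hK : IsCompact K) (hKφ : K ⊆ φ '' Metric.ball 0 1) :
    ∃ r < 1, K ⊆ φ '' Metric.closedBall 0 r := by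
  obtain ⟨r, hr⟩ := hK.elim_directed_cover (ι := Set.Iio (1 : ℝ))
    (fun r ↦ φ '' Metric.ball 0 r)
    (fun r ↦ isOpen_image_of_injOn_differentiableOn Metric.isOpen_ball
      (convex_ball _ _).isPreconnected hφ hinj (Metric.ball_subset_ball r.2.le) Metric.isOpen_ball)
    (fun x hx ↦ by
      obtain ⟨z, hz, rfl⟩ := hKφ hx
      obtain ⟨r, hzr, hr⟩ := exists_between (Metric.mem_ball.1 hz)
      exact Set.mem_iUnion.2 ⟨⟨r, hr⟩, z, hzr, rfl⟩)
    (Monotone.directed_le fun _ _ h ↦ Set.image_mono (Metric.ball_subset_ball h))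
  exact ⟨r, r.2, hr.trans (Set.image_mono Metric.ball_subset_closedBall)⟩

/-- If `f : ℂ → ℂ` is conjugate on a set `U` to the irrational rotation
`z ↦ e^{2πiα}·z` of the open unit disc via a bijective holomorphic map `φ : 𝔻 → U`
(the situation of a Siegel disc), then the Bowen topological entropy of `f` on every
nonempty compact subset of `U` is zero. -/
theorem entropy_zero_on_siegel_disc (f : ℂ → ℂ) (U : Set ℂ) (α : ℝ) (hα : Irrational α)
    (φ : ℂ → ℂ) (hφdiff : DifferentiableOn ℂ φ (Metric.ball (0 : ℂ) 1))
    (hφbij : Set.BijOn φ (Metric.ball (0 : ℂ) 1) U)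
    (hconj : ∀ z ∈ Metric.ball (0 : ℂ) 1,
      φ (Complex.exp (2 * Real.pi * Complex.I * (α : ℂ)) * z) = f (φ z)) :
    ∀ K : Set ℂ, K ⊆ U → IsCompact K → K.Nonempty → coverEntropy f K = 0 := by
  intro K hKU hK hKne
  obtain ⟨r, hr, hKr⟩ := exists_subset_image_closedBall hφdiff hφbij.injOn hK
    (hφbij.image_eq.symm ▸ hKU)
  have hsub : Metric.closedBall (0 : ℂ) r ⊆ Metric.ball 0 1 := Metric.closedBall_subset_ball hr
  have hnorm : ‖Complex.exp (2 * Real.pi * Complex.I * (α : ℂ))‖ = 1 := by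
    simp [Complex.norm_exp]
  have hrot : Isometry fun z : ℂ ↦ Complex.exp (2 * Real.pi * Complex.I * (α : ℂ)) * z :=
    Isometry.of_dist_eq fun z w ↦ by
      rw [dist_eq_norm, dist_eq_norm, ← mul_sub, norm_mul, hnorm, one_mul]
  refine le_antisymm ((coverEntropy_monotone f hKr).trans ?_) (coverEntropy_nonneg f hKne)
  refine coverEntropy_image_nonpos_of_isometry (isCompact_closedBall 0 r) hrot (fun z hz ↦ ?_)
    (hφdiff.continuousOn.mono hsub) fun z hz ↦ hconj z (hsub hz)
  rw [mem_closedBall_zero_iff] at hz ⊢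
  rwa [norm_mul, hnorm, one_mul]
end

section
/- Let k ≥ 1 and let g = (V, R) be a directed graph on a finite vertex set V with N := |V| ≥ 2k + 1 vertices, where R ⊆ V × V, such that every vertex v ∈ V has out-degree d⁺(g, v) := |{w ∈ V : (v, w) ∈ R}| ≥ N − k. Then there exist a vertex v ∈ V and pairwise distinct vertices v₁, …, v_{N−2k} ∈ V such that (v, v_j) ∈ R and (v_j, v) ∈ R for all j = 1, …, N − 2k. -/
/-- If `g = (V, R)` is a digraph on a finite vertex set `V` with `N := |V| ≥ 2k + 1`
vertices (`k ≥ 1`) such that every vertex has out-degree at least `N − k`, then there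
exist a vertex `v` and pairwise distinct vertices `v₁, …, v_{N−2k}` such that
`(v, v_j) ∈ R` and `(v_j, v) ∈ R` for all `j`. -/
theorem digraph_exists_two_loops {V : Type*} [Fintype V] (R : V → V → Prop)
    [DecidableRel R] (k : ℕ) (hk : 1 ≤ k) (hN : 2 * k + 1 ≤ Fintype.card V)
    (hdeg : ∀ v : V, Fintype.card V - k ≤ (Finset.univ.filter (fun w => R v w)).card) :
    ∃ v : V, ∃ vs : Fin (Fintype.card V - 2 * k) → V, Function.Injective vs ∧
      ∀ j, R v (vs j) ∧ R (vs j) v := by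
  classical
  have : Nonempty V := Fintype.card_pos_iff.mp (by omega)
  have hcount := Finset.sum_card_bipartiteAbove_eq_sum_card_bipartiteBelow
    (s := (Finset.univ : Finset V)) (t := (Finset.univ : Finset V)) R
  have hsum : ∑ _v : V, (Fintype.card V - k) ≤
      ∑ v : V, (Finset.univ.filter (fun w => R w v)).card :=
    (Finset.sum_le_sum fun v _ => hdeg v).trans hcount.le
  obtain ⟨v, -, hv⟩ := Finset.exists_le_of_sum_le Finset.univ_nonempty hsum
  have hcard : Fintype.card V - 2 * k ≤
      (Finset.univ.filter (fun w => R v w) ∩ Finset.univ.filter (fun w => R w v)).card := by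
    have hinter := Finset.card_union_add_card_inter
      (Finset.univ.filter (fun w => R v w)) (Finset.univ.filter (fun w => R w v))
    have hunion := Finset.card_le_univ
      (Finset.univ.filter (fun w => R v w) ∪ Finset.univ.filter (fun w => R w v))
    have hout := hdeg v
    omega
  obtain ⟨t, ht, htcard⟩ := Finset.exists_subset_card_eq hcard
  let e := (t.equivFinOfCardEq htcard).symm
  refine ⟨v, fun j => e j, Subtype.val_injective.comp e.injective, fun j => ?_⟩
  simpa using ht (e j).2
end

section
/- Let D ⊆ ℂ be a bounded domain, let f : D → ℂ be holomorphic, and let V ⊆ ℂ be open and bounded. Then for every connected component U of f⁻¹(V) whose closure is contained in D, the restriction f|_U : U → V is a proper map, i.e. for every compact set C ⊆ V the set U ∩ f⁻¹(C) is compact (equivalently, the restriction of f to U, viewed as a map from U to V, is proper). -/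
/-- A connected component of `S` is relatively closed in `S`. -/
theorem closure_connectedComponentIn_inter_subset {X : Type*} [TopologicalSpace X]
    {S : Set X} {z : X} (hz : z ∈ S) :
    closure (connectedComponentIn S z) ∩ S ⊆ connectedComponentIn S z := by
  refine IsPreconnected.subset_connectedComponentIn ?_
    ⟨subset_closure (mem_connectedComponentIn hz), hz⟩ Set.inter_subset_right
  exact isPreconnected_connectedComponentIn.subset_closure
    (Set.subset_inter subset_closure (connectedComponentIn_subset S z)) Set.inter_subset_left

/-- If `D ⊆ ℂ` is a bounded domain, `f` is holomorphic on `D` and `V ⊆ ℂ` is open and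
bounded, then for every connected component `U` of `f⁻¹(V)` (within `D`) whose closure is
contained in `D`, the restriction `f|_U : U → V` is proper: for every compact `C ⊆ V`,
the set `U ∩ f⁻¹(C)` is compact. -/
theorem restriction_proper_of_component (D : Set ℂ) (hDopen : IsOpen D)
    (hDconn : IsConnected D) (hDbdd : Bornology.IsBounded D)
    (f : ℂ → ℂ) (hf : DifferentiableOn ℂ f D)
    (V : Set ℂ) (hVopen : IsOpen V) (hVbdd : Bornology.IsBounded V)
    (U : Set ℂ) (z : ℂ) (hz : z ∈ D ∩ f ⁻¹' V)
    (hU : U = connectedComponentIn (D ∩ f ⁻¹' V) z)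
    (hUcl : closure U ⊆ D) :
    ∀ C : Set ℂ, C ⊆ V → IsCompact C → IsCompact (U ∩ f ⁻¹' C) := by
  intro C hCV hC
  have hUbdd : Bornology.IsBounded U := hDbdd.subset (subset_closure.trans hUcl)
  have hEq : U ∩ f ⁻¹' C = closure U ∩ f ⁻¹' C := by
    refine Set.Subset.antisymm (Set.inter_subset_inter_left _ subset_closure) ?_
    rintro x ⟨hxU, hxC⟩
    refine ⟨?_, hxC⟩
    have hxS : x ∈ D ∩ f ⁻¹' V := ⟨hUcl hxU, hCV hxC⟩
    subst hU
    exact closure_connectedComponentIn_inter_subset hz ⟨hxU, hxS⟩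
  rw [hEq]
  exact hUbdd.isCompact_closure.of_isClosed_subset
    ((hf.continuousOn.mono hUcl).preimage_isClosed_of_isClosed isClosed_closure hC.isClosed)
    Set.inter_subset_left
end

section
/- Let P : ℂ → ℂ be a polynomial of degree d ≥ 2, let U ⊆ ℂ be open, let f : ℂ → ℂ be a map, and let φ : ℂ → ℂ be a homeomorphism such that φ(f(z)) = P(φ(z)) for all z ∈ U and such that the filled Julia set K(P) is contained in φ(U). Set A := φ⁻¹(K(P)). Then A is a nonempty compact subset of U with f(A) ⊆ A, and h(f, A) = log d. -/
open Dynamics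

/-- The filled Julia set of a polynomial `p`: the set of points with bounded orbit. -/
def filledJulia (p : Polynomial ℂ) : Set ℂ :=
  {z : ℂ | Bornology.IsBounded (Set.range fun n : ℕ => (fun w => p.eval w)^[n] z)}

section

open Polynomial Filter Topology Set

theorem exists_escape_radius (p : ℂ[X]) (hp : 2 ≤ p.natDegree) :
    ∃ R : ℝ, 1 ≤ R ∧ ∀ z : ℂ, R < ‖z‖ → 2 * ‖z‖ ≤ ‖p.eval z‖ := by
  have hdiv : 0 < p.divX.degree := by
    rw [← natDegree_pos_iff_degree_pos, natDegree_divX_eq_natDegree_tsub_one]; omega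
  have ht := p.divX.tendsto_norm_atTop hdiv (l := Bornology.cobounded ℂ) (z := fun z => z)
    tendsto_norm_cobounded_atTop
  have := (ht.eventually_ge_atTop (2 + ‖p.coeff 0‖))
  rw [← comap_norm_atTop, eventually_comap] at this
  obtain ⟨R, hR⟩ := eventually_atTop.1 this
  refine ⟨max R 1, le_max_right _ _, fun z hz => ?_⟩
  have h1 := hR ‖z‖ ((le_max_left _ _).trans hz.le) z rfl
  have hz1 : 1 ≤ ‖z‖ := (le_max_right _ _).trans hz.le
  have he : p.eval z = p.divX.eval z * z + p.coeff 0 := by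
    conv_lhs => rw [← divX_mul_X_add p]
    simp
  have h2 : ‖p.divX.eval z * z‖ ≤ ‖p.eval z‖ + ‖p.coeff 0‖ := by
    have : p.divX.eval z * z = p.eval z - p.coeff 0 := by rw [he]; ring
    rw [this]; exact norm_sub_le _ _
  rw [norm_mul] at h2
  nlinarith [norm_nonneg (p.coeff 0)]

theorem mem_filledJulia_iff (p : ℂ[X]) (z : ℂ) : z ∈ filledJulia p ↔
    Bornology.IsBounded (range fun n : ℕ => (fun w => p.eval w)^[n] z) := Iff.rfl

theorem mapsTo_filledJulia (p : ℂ[X]) :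
    MapsTo (fun w => p.eval w) (filledJulia p) (filledJulia p) := by
  intro z hz
  rw [mem_filledJulia_iff] at hz ⊢
  refine Bornology.IsBounded.subset hz ?_
  rintro _ ⟨n, rfl⟩
  exact ⟨n + 1, rfl⟩

theorem mem_filledJulia_of_eval_mem (p : ℂ[X]) {z : ℂ} (hz : p.eval z ∈ filledJulia p) :
    z ∈ filledJulia p := by
  rw [mem_filledJulia_iff] at hz ⊢
  refine Bornology.IsBounded.subset (hz.union (Bornology.isBounded_singleton (x := z))) ?_
  rintro _ ⟨n, rfl⟩
  rcases n with _ | n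
  · right; rfl
  · left; exact ⟨n, rfl⟩

theorem filledJulia_eq_iInter (p : ℂ[X]) {R : ℝ} (hR1 : 1 ≤ R)
    (hR : ∀ z : ℂ, R < ‖z‖ → 2 * ‖z‖ ≤ ‖p.eval z‖) :
    filledJulia p = ⋂ n : ℕ, (fun w => p.eval w)^[n] ⁻¹' Metric.closedBall 0 R := by
  ext z
  simp only [mem_iInter, mem_preimage, mem_closedBall_zero_iff]
  constructor
  · intro hz n
    by_contra! hn
    have key : ∀ k : ℕ, R < ‖(fun w => p.eval w)^[k + n] z‖ ∧
        2 ^ k ≤ ‖(fun w => p.eval w)^[k + n] z‖ := by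
      intro k
      induction k with
      | zero => simpa using ⟨hn, hR1.trans hn.le⟩
      | succ k ih =>
        have := hR _ ih.1
        rw [Nat.succ_add, Function.iterate_succ_apply', pow_succ]
        constructor <;> linarith [ih.2]
    obtain ⟨C, hC⟩ := ((mem_filledJulia_iff p z).1 hz).exists_norm_le
    obtain ⟨k, hk⟩ := pow_unbounded_of_one_lt C (one_lt_two (α := ℝ))
    have := hC _ ⟨k + n, rfl⟩
    linarith [(key k).2]
  · intro h
    refine (Metric.isBounded_closedBall (x := (0 : ℂ)) (r := R)).subset ?_
    rintro _ ⟨n, rfl⟩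
    simpa using h n

theorem isCompact_filledJulia (p : ℂ[X]) (hp : 2 ≤ p.natDegree) : IsCompact (filledJulia p) := by
  obtain ⟨R, hR1, hR⟩ := exists_escape_radius p hp
  have h := filledJulia_eq_iInter p hR1 hR
  refine (isCompact_closedBall (0 : ℂ) R).of_isClosed_subset ?_ ?_
  · rw [h]
    exact isClosed_iInter fun n => Metric.isClosed_closedBall.preimage (p.continuous.iterate n)
  · rw [h]
    exact iInter_subset_of_subset 0 subset_rfl

theorem exists_fixed_point_not_critical (p : ℂ[X]) (hp : 2 ≤ p.natDegree) :
    ∃ x : ℂ, p.eval x = x ∧ p.derivative.eval x ≠ 0 := by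
  by_contra! h
  set q := p - X with hq
  have hqd : q.natDegree = p.natDegree := by
    rw [hq, natDegree_sub_eq_left_of_natDegree_lt]
    rw [natDegree_X]; omega
  have hq0 : q ≠ 0 := by
    intro h0; rw [h0] at hqd; simp at hqd; omega
  have hroot : ∀ z, q.IsRoot z → q.derivative.eval z = -1 := by
    intro z hz
    have : p.eval z = z := by
      simpa [hq, IsRoot, sub_eq_zero] using hz
    simp [hq, h z this]
  have hnodup : q.roots.Nodup := by
    rw [Multiset.nodup_iff_count_le_one]
    intro z
    rw [count_roots]
    by_contra! hz
    have h1 := (one_lt_rootMultiplicity_iff_isRoot hq0).1 hz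
    have := hroot z h1.1
    rw [h1.2] at this
    norm_num at this
  have hcard : q.roots.toFinset.card = q.natDegree := by
    rw [Multiset.toFinset_card_of_nodup hnodup]
    exact (IsAlgClosed.card_roots_eq_natDegree)
  have hz : q.derivative + 1 = 0 := by
    refine eq_zero_of_natDegree_lt_card_of_eval_eq_zero' _ q.roots.toFinset ?_ ?_
    · intro z hz
      have := hroot z (by simpa [hq0] using hz)
      simp [this]
    · rw [hcard]
      refine (natDegree_add_le _ _).trans_lt ?_
      rw [natDegree_one]
      have := natDegree_derivative_lt (p := q) (by omega)
      omega
  have : q.derivative.natDegree = q.natDegree - 1 := natDegree_derivative q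
  rw [eq_neg_of_add_eq_zero_left hz] at this
  simp at this
  omega

theorem fixed_point_mem_filledJulia (p : ℂ[X]) {x : ℂ} (hx : p.eval x = x) :
    x ∈ filledJulia p := by
  refine (Bornology.isBounded_singleton (x := x)).subset ?_
  rintro _ ⟨n, rfl⟩
  exact Function.iterate_fixed hx n

theorem coverEntropy_preimage_homeomorph {f g : ℂ → ℂ} (φ : ℂ ≃ₜ ℂ) {K : Set ℂ}
    (hK : IsCompact K) (hg : MapsTo g K K) (h : ∀ z ∈ φ ⁻¹' K, φ (f z) = g (φ z)) :
    coverEntropy f (φ ⁻¹' K) = coverEntropy g K := by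
  set A := φ ⁻¹' K with hA
  have hAc : IsCompact A := φ.isCompact_preimage.2 hK
  have hf : MapsTo f A A := fun z hz => by
    rw [hA, mem_preimage, h z hz]; exact hg hz
  rw [← coverEntropy_restrict hf, ← coverEntropy_restrict hg]
  have : CompactSpace A := isCompact_iff_compactSpace.1 hAc
  have : CompactSpace K := isCompact_iff_compactSpace.1 hK
  let ψ : A → K := fun z => ⟨φ z, z.2⟩
  let χ : K → A := fun z => ⟨φ.symm z, by simp [hA]⟩
  have hψ : Continuous ψ := by fun_prop
  have hχ : Continuous χ := by fun_prop
  have h1 : Function.LeftInverse χ ψ := fun z => by simp [χ, ψ]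
  have h2 : Function.RightInverse χ ψ := fun z => by simp [χ, ψ]
  have hs : Function.Semiconj ψ (hf.restrict f A A) (hg.restrict g K K) := fun z =>
    Subtype.ext (h z z.2)
  have hs' : Function.Semiconj χ (hg.restrict g K K) (hf.restrict f A A) :=
    hs.inverse_left h1 h2
  apply le_antisymm
  · have := coverEntropy_image_le_of_uniformContinuous hs'
      (CompactSpace.uniformContinuous_of_continuous hχ) univ
    rwa [image_univ_of_surjective h1.surjective] at this
  · have := coverEntropy_image_le_of_uniformContinuous hs
      (CompactSpace.uniformContinuous_of_continuous hψ) univ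
    rwa [image_univ_of_surjective h2.surjective] at this

open ExpGrowth in
theorem log_le_expGrowthSup_of_le {u : ℕ → ENNReal} {b c : ℝ} (hb : 0 < b) (hc : 0 < c)
    (h : ∀ n, ENNReal.ofReal (c * b ^ n) ≤ u n) : (Real.log b : EReal) ≤ expGrowthSup u := by
  have h1 : (fun _ => ENNReal.ofReal c) * (fun n => ENNReal.ofReal b ^ n) ≤ u := by
    intro n
    refine le_trans (le_of_eq ?_) (h n)
    rw [ENNReal.ofReal_mul hc.le, ENNReal.ofReal_pow hb.le]
    rfl
  refine le_trans ?_ (expGrowthSup_monotone h1)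
  refine le_trans (le_of_eq ?_) le_expGrowthSup_mul
  rw [expGrowthSup_const (by simpa using hc) ENNReal.ofReal_ne_top, expGrowthInf_pow,
    ENNReal.log_ofReal_of_pos hb, zero_add]

open ExpGrowth in
theorem expGrowthSup_le_log_of_le {u : ℕ → ENNReal} {b c : ℝ} (hb : 0 < b) (hc : 0 < c)
    (h : ∀ n, u n ≤ ENNReal.ofReal (c * b ^ n)) : expGrowthSup u ≤ (Real.log b : EReal) := by
  have h1 : u ≤ (fun _ => ENNReal.ofReal c) * (fun n => ENNReal.ofReal b ^ n) := by
    intro n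
    refine (h n).trans (le_of_eq ?_)
    rw [ENNReal.ofReal_mul hc.le, ENNReal.ofReal_pow hb.le]
    rfl
  refine (expGrowthSup_monotone h1).trans ?_
  have e1 : expGrowthSup (fun _ : ℕ => ENNReal.ofReal c) = 0 :=
    expGrowthSup_const (by simpa using hc) ENNReal.ofReal_ne_top
  refine (expGrowthSup_mul_le (by simp [e1]) (by simp [e1])).trans (le_of_eq ?_)
  rw [e1, expGrowthSup_pow, ENNReal.log_ofReal_of_pos hb, zero_add]

/-- Slow return to a nonperiodic point. -/
theorem eventually_return_of_not_periodic {F : ℂ → ℂ} (hF : Continuous F) {c : ℂ} {i : ℕ}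
    (hc : F^[i] c ≠ c) :
    ∀ᶠ β in 𝓝[>] (0 : ℝ), ∀ w, dist w c < β → β ≤ dist (F^[i] w) c := by
  have hcont : ContinuousAt (fun w => dist (F^[i] w) c) c :=
    ((hF.iterate i).dist continuous_const).continuousAt
  have hpos : 0 < dist (F^[i] c) c := dist_pos.2 hc
  obtain ⟨δ, hδ, h⟩ := Metric.eventually_nhds_iff.1
    (hcont.eventually (lt_mem_nhds (half_lt_self hpos)))
  have : ∀ᶠ β in 𝓝[>] (0 : ℝ), β < min δ (dist (F^[i] c) c / 2) :=
    eventually_nhdsWithin_of_eventually_nhds (gt_mem_nhds (by positivity))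
  filter_upwards [this] with β hβ w hw
  have := h (hw.trans (hβ.trans_le (min_le_left _ _)))
  exact (hβ.trans_le (min_le_right _ _)).le.trans this.le

/-- Near a superattracting periodic point no orbit ever lands on a different fixed point. -/
theorem eventually_iterate_ne_of_superattracting {F : ℂ → ℂ} {c x : ℂ} {m : ℕ}
    (hm : m ≠ 0) (hc : F^[m] c = c) (hd : HasDerivAt (F^[m]) 0 c) (hx : F x = x) (hxc : x ≠ c) :
    ∀ᶠ β in 𝓝[>] (0 : ℝ), ∀ w, dist w c < β → ∀ k, F^[k] w ≠ x := by
  have h0 := hd.isLittleO.def (show (0 : ℝ) < 1 / 2 by norm_num)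
  obtain ⟨δ, hδ, h⟩ := Metric.eventually_nhds_iff.1 h0
  have hδ' : ∀ᶠ β in 𝓝[>] (0 : ℝ), β < δ :=
    eventually_nhdsWithin_of_eventually_nhds (gt_mem_nhds hδ)
  filter_upwards [hδ'] with β hβ w hw k hk
  have key : ∀ j : ℕ, dist ((F^[m])^[j] w) c ≤ (1 / 2) ^ j * δ := by
    intro j
    induction j with
    | zero => simpa using (hw.trans hβ).le
    | succ j ih =>
      have hlt : dist ((F^[m])^[j] w) c < δ := by
        rcases j with _ | j
        · simpa using hw.trans hβ
        · refine ih.trans_lt ?_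
          have : ((1 : ℝ) / 2) ^ (j + 1) < 1 := pow_lt_one₀ (by norm_num) (by norm_num) (by simp)
          nlinarith
      have := h hlt
      simp only [hc, smul_zero, sub_zero] at this
      rw [Function.iterate_succ_apply', dist_eq_norm, pow_succ]
      rw [dist_eq_norm] at ih
      calc _ ≤ 1 / 2 * ‖(F^[m])^[j] w - c‖ := this
        _ ≤ 1 / 2 * ((1 / 2) ^ j * δ) := by gcongr
        _ = _ := by ring
  have hxj : ∀ j, k ≤ j → (F^[m])^[j] w = x := by
    intro j hj
    rw [← Function.iterate_mul]
    have : m * j = (m * j - k) + k := by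
      have := Nat.le_mul_of_pos_left j (Nat.pos_of_ne_zero hm); omega
    rw [this, Function.iterate_add_apply, hk]
    exact Function.iterate_fixed hx _
  have hlim : Tendsto (fun j : ℕ => (1 / 2 : ℝ) ^ j * δ) atTop (𝓝 (0 * δ)) :=
    (tendsto_pow_atTop_nhds_zero_of_lt_one (by norm_num) (by norm_num)).mul_const δ
  rw [zero_mul] at hlim
  have : dist x c ≤ 0 := ge_of_tendsto hlim (by
    filter_upwards [eventually_ge_atTop k] with j hj
    rw [← hxj j hj]; exact key j)
  exact hxc (dist_le_zero.1 this)

theorem hasDerivAt_iterate_zero (p : ℂ[X]) {c : ℂ} (hc : p.derivative.eval c = 0) {m : ℕ}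
    (hm : m ≠ 0) : HasDerivAt ((fun w => p.eval w)^[m]) 0 c := by
  obtain ⟨m, rfl⟩ := Nat.exists_eq_succ_of_ne_zero hm
  rw [Function.iterate_succ]
  have h2 := (p.differentiable.iterate m) (p.eval c)
  have := h2.hasDerivAt.comp c (p.hasDerivAt c)
  rwa [hc, mul_zero] at this

theorem eventually_slow_return (p : ℂ[X]) {x : ℂ} (hx : p.eval x = x)
    (hx' : p.derivative.eval x ≠ 0) {c : ℂ} (hc : p.derivative.eval c = 0) (T : ℕ) :
    ∀ᶠ β in 𝓝[>] (0 : ℝ), ∀ y, (∃ k, (fun w => p.eval w)^[k] y = x) → dist y c < β →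
      ∀ i ∈ Finset.Icc 1 T, β ≤ dist ((fun w => p.eval w)^[i] y) c := by
  by_cases h : ∃ m ∈ Finset.Icc 1 T, (fun w => p.eval w)^[m] c = c
  · obtain ⟨m, hm, hmc⟩ := h
    have hm0 : m ≠ 0 := by simp at hm; omega
    have := eventually_iterate_ne_of_superattracting (F := fun w => p.eval w) (x := x) hm0 hmc
      (hasDerivAt_iterate_zero p hc hm0) hx (by rintro rfl; exact hx' hc)
    filter_upwards [this] with β hβ y hy hyc
    obtain ⟨k, hk⟩ := hy
    exact absurd hk (hβ y hyc k)
  · push Not at h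
    have := (Finset.Icc 1 T).eventually_all.2 fun i hi =>
      eventually_return_of_not_periodic p.continuous (h i hi)
    filter_upwards [this] with β hβ y _ hyc i hi
    exact hβ i hi y hyc

theorem exists_nhds_injOn (p : ℂ[X]) {z : ℂ} (hz : p.derivative.eval z ≠ 0) :
    ∃ U : Set ℂ, IsOpen U ∧ z ∈ U ∧ InjOn (fun w => p.eval w) U := by
  have h := (p.hasStrictDerivAt z).hasStrictFDerivAt_equiv hz
  exact ⟨_, (h.toOpenPartialHomeomorph _).open_source, h.mem_toOpenPartialHomeomorph_source,
    (h.toOpenPartialHomeomorph _).injOn⟩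

theorem exists_uniform_injectivity (p : ℂ[X]) {S : Set ℂ} (hS : IsCompact S)
    (h : ∀ z ∈ S, p.derivative.eval z ≠ 0) :
    ∃ ε > 0, ∀ z ∈ S, ∀ z', z ≠ z' → p.eval z = p.eval z' → ε ≤ dist z z' := by
  choose! U hUo hU hinj using fun z hz => exists_nhds_injOn p (h z hz)
  obtain ⟨δ, hδ, hball⟩ := lebesgue_number_lemma_of_metric hS (c := fun z : S => U z)
    (fun z => hUo z z.2) (fun z hz => mem_iUnion.2 ⟨⟨z, hz⟩, hU z hz⟩)
  refine ⟨δ, hδ, fun z hz z' hne heq => ?_⟩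
  by_contra! hlt
  obtain ⟨i, hi⟩ := hball z hz
  exact hne (hinj i i.2 (hi (Metric.mem_ball_self hδ))
    (hi (by rwa [Metric.mem_ball, dist_comm])) heq)

open Classical in
/-- Growing a separated backward tree. -/
theorem exists_separated_tree {F : ℂ → ℂ} {B X : Set ℂ} {ε : ℝ} {d : ℕ} {x : ℂ} (hx : x ∈ X)
    (hX : ∀ y, F y ∈ X → y ∈ X)
    (hC : ∀ y ∈ X, ∃ C : Finset ℂ, (∀ z ∈ C, F z = y) ∧
      (∀ u ∈ C, ∀ v ∈ C, u ≠ v → ε ≤ dist u v) ∧ d ≤ ∑ z ∈ C, if z ∈ B then d else 1) (n : ℕ) :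
    ∃ S : Finset ℂ, (∀ y ∈ S, F^[n] y = x ∧ y ∈ X) ∧
      (∀ u ∈ S, ∀ v ∈ S, u ≠ v → ∃ k < n, ε ≤ dist (F^[k] u) (F^[k] v)) ∧
      d ^ n ≤ ∑ y ∈ S, d ^ ((Finset.range n).filter fun k => F^[k] y ∈ B).card := by
  induction n with
  | zero =>
    refine ⟨{x}, ?_, ?_, ?_⟩ <;> simp [hx]
  | succ n ih =>
    obtain ⟨S, hS, hsep, hsum⟩ := ih
    choose! C hCF hCsep hCsum using hC
    have hmem : ∀ y ∈ S.biUnion C, F y ∈ S ∧ y ∈ C (F y) := by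
      intro y hy
      obtain ⟨z, hz, hyz⟩ := Finset.mem_biUnion.1 hy
      rw [hCF z (hS z hz).2 y hyz]
      exact ⟨hz, hyz⟩
    refine ⟨S.biUnion C, ?_, ?_, ?_⟩
    · intro y hy
      have h1 := hS _ (hmem y hy).1
      exact ⟨h1.1, hX y h1.2⟩
    · intro u hu v hv huv
      by_cases he : F u = F v
      · refine ⟨0, by omega, ?_⟩
        have h1 := hmem u hu
        have h2 := hmem v hv
        exact hCsep (F u) (hS _ h1.1).2 u h1.2 v (he ▸ h2.2) huv
      · obtain ⟨k, hk, hd⟩ := hsep _ (hmem u hu).1 _ (hmem v hv).1 he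
        exact ⟨k + 1, by omega, hd⟩
    · have hbad : ∀ y, ((Finset.range (n + 1)).filter fun k => F^[k] y ∈ B).card =
          ((Finset.range n).filter fun k => F^[k] (F y) ∈ B).card + if y ∈ B then 1 else 0 := by
        intro y
        simp only [Finset.card_filter]
        rw [Finset.sum_range_succ']
        rfl
      rw [Finset.sum_biUnion]
      · rw [pow_succ]
        calc d ^ n * d ≤
            (∑ y ∈ S, d ^ ((Finset.range n).filter fun k => F^[k] y ∈ B).card) * d := by gcongr
          _ = ∑ y ∈ S, d ^ ((Finset.range n).filter fun k => F^[k] y ∈ B).card * d := by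
            rw [Finset.sum_mul]
          _ ≤ _ := by
            refine Finset.sum_le_sum fun y hy => ?_
            calc _ ≤ d ^ ((Finset.range n).filter fun k => F^[k] y ∈ B).card *
                ∑ z ∈ C y, (if z ∈ B then d else 1) := by gcongr; exact hCsum y (hS y hy).2
              _ = _ := by
                rw [Finset.mul_sum]
                refine Finset.sum_congr rfl fun z hz => ?_
                rw [hbad, hCF y (hS y hy).2 z hz, pow_add]
                split_ifs <;> simp
      · intro y hy y' hy' hne
        rw [Function.onFun, Finset.disjoint_left]
        intro z hz hz'
        exact hne ((hCF y (hS y hy).2 z hz).symm.trans (hCF y' (hS y' hy').2 z hz'))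

open Classical in
theorem card_visits_le {F : ℂ → ℂ} {X : Set ℂ} (hX : MapsTo F X X) {c : ℂ} {β : ℝ} {T : ℕ}
    (hT : 0 < T)
    (h : ∀ y ∈ X, dist y c < β → ∀ i ∈ Finset.Icc 1 T, β ≤ dist (F^[i] y) c) {y : ℂ} (hy : y ∈ X)
    (n : ℕ) : ((Finset.range n).filter fun k => dist (F^[k] y) c < β).card ≤ n / T + 1 := by
  rw [← Finset.card_range (n / T + 1)]
  refine Finset.card_le_card_of_injOn (fun k => k / T) ?_ ?_
  · intro k hk
    simp only [Finset.coe_filter, Finset.mem_range, mem_ofPred_eq] at hk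
    simp only [Finset.coe_range, mem_Iio]
    exact Nat.lt_succ_of_le (Nat.div_le_div_right hk.1.le)
  · have key : ∀ k l : ℕ, k < l → dist (F^[k] y) c < β → dist (F^[l] y) c < β → k / T ≠ l / T := by
      intro k l hkl hk hl heq
      have hlT : l - k ≤ T := by
        have h1 := Nat.div_add_mod k T
        have h2 := Nat.div_add_mod l T
        have h3 := Nat.mod_lt l hT
        rw [heq] at h1
        omega
      have := h _ (hX.iterate k hy) hk (l - k) (by simp; omega)
      rw [← Function.iterate_add_apply, Nat.sub_add_cancel hkl.le] at this
      linarith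
    intro k hk l hl heq
    simp only [Finset.coe_filter, mem_ofPred_eq] at hk hl
    rcases lt_trichotomy k l with hkl | hkl | hkl
    · exact absurd heq (key k l hkl hk.2 hl.2)
    · exact hkl
    · exact absurd heq.symm (key l k hkl hl.2 hk.2)

theorem exists_separated_preimages (p : ℂ[X]) {d : ℕ} (hd : 2 ≤ d) (hdeg : p.natDegree = d)
    {B S : Set ℂ} {ε : ℝ} (hB : ∀ z ∉ B, p.derivative.eval z ≠ 0)
    (hε : ∀ z ∈ S, z ∉ B → ∀ z', z ≠ z' → p.eval z = p.eval z' → ε ≤ dist z z') {y : ℂ}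
    (hy : ∀ z, p.eval z = y → z ∈ S) [DecidablePred (· ∈ B)] :
    ∃ C : Finset ℂ, (∀ z ∈ C, p.eval z = y) ∧
      (∀ u ∈ C, ∀ v ∈ C, u ≠ v → ε ≤ dist u v) ∧ d ≤ ∑ z ∈ C, if z ∈ B then d else 1 := by
  by_cases h : ∃ z ∈ B, p.eval z = y
  · obtain ⟨z, hz, hzy⟩ := h
    exact ⟨{z}, by simpa using hzy, by simp, by simp [hz]⟩
  · push Not at h
    set q := p - C y with hq
    have hqd : q.natDegree = d := by rw [hq, natDegree_sub_C, hdeg]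
    have hq0 : q ≠ 0 := by
      intro h0; rw [h0] at hqd; simp at hqd; omega
    have hmem : ∀ z, z ∈ q.roots.toFinset ↔ p.eval z = y := by
      intro z; rw [Multiset.mem_toFinset, mem_roots hq0]; simp [hq, sub_eq_zero]
    have hnB : ∀ z, p.eval z = y → z ∉ B := fun z hz hzB => h z hzB hz
    have hnodup : q.roots.Nodup := by
      rw [Multiset.nodup_iff_count_le_one]
      intro z
      rw [count_roots]
      by_contra! hz
      have h1 := (one_lt_rootMultiplicity_iff_isRoot hq0).1 hz
      refine hB z (hnB z ((hmem z).1 (by simpa [hq0] using h1.1))) ?_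
      simpa [hq] using h1.2
    refine ⟨q.roots.toFinset, fun z hz => (hmem z).1 hz, ?_, ?_⟩
    · intro u hu v hv huv
      rw [hmem] at hu hv
      exact hε u (hy u hu) (hnB u hu) v huv (hu.trans hv.symm)
    · rw [Finset.sum_congr rfl fun z hz => if_neg (hnB z ((hmem z).1 hz)), Finset.sum_const,
        Multiset.toFinset_card_of_nodup hnodup, IsAlgClosed.card_roots_eq_natDegree, hqd]
      simp

theorem rpow_bound_of_count {d n N m T : ℕ} (hd : 1 ≤ d) (h : d ^ n ≤ N * d ^ (m * (n / T + 1))) :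
    ((d : ℝ) ^ m)⁻¹ * ((d : ℝ) ^ (1 - (m : ℝ) / T)) ^ n ≤ N := by
  have hd1 : (1 : ℝ) ≤ d := by exact_mod_cast hd
  have hd0 : (0 : ℝ) < d := by linarith
  have h1 : (d : ℝ) ^ n ≤ N * (d : ℝ) ^ (m * (n / T + 1)) := by exact_mod_cast h
  have hnT : ((n / T : ℕ) : ℝ) ≤ n / T := Nat.cast_div_le
  rw [← Real.rpow_natCast, ← Real.rpow_natCast] at h1
  rw [← Real.rpow_natCast, ← Real.rpow_natCast, ← Real.rpow_mul hd0.le, ← Real.rpow_neg hd0.le,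
    ← Real.rpow_add hd0]
  have hpos : (0 : ℝ) < (d : ℝ) ^ ((m * (n / T + 1) : ℕ) : ℝ) := Real.rpow_pos_of_pos hd0 _
  have h2 : (d : ℝ) ^ ((n : ℝ) - (m * (n / T + 1) : ℕ)) ≤ N := by
    rw [Real.rpow_sub hd0, div_le_iff₀ hpos]
    exact h1
  refine le_trans (Real.rpow_le_rpow_of_exponent_le hd1 ?_) h2
  push_cast
  have h3 : (m : ℝ) * ((n / T : ℕ) : ℝ) ≤ m * (n / T) := by gcongr
  have e : (1 - (m : ℝ) / T) * n = n - m * (n / T) := by ring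
  rw [e]
  linarith

theorem card_le_coverMincard_of_separated {F : ℂ → ℂ} {K : Set ℂ} {ε : ℝ} {n : ℕ}
    {S : Finset ℂ} (hSK : ∀ y ∈ S, y ∈ K)
    (hsep : ∀ u ∈ S, ∀ v ∈ S, u ≠ v → ∃ k < n, ε ≤ dist (F^[k] u) (F^[k] v)) :
    (S.card : ℕ∞) ≤ coverMincard F K {q : ℂ × ℂ | dist q.1 q.2 < ε / 2} n := by
  refine le_trans ?_ (netMaxcard_le_coverMincard F K n)
  refine IsDynNetIn.card_le_netMaxcard ⟨fun y hy => hSK y hy, ?_⟩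
  intro u hu v hv huv
  rw [Function.onFun, Set.disjoint_left]
  intro w hw hw'
  obtain ⟨k, hk, hd⟩ := hsep u hu v hv huv
  have h1 : dist (F^[k] u) (F^[k] w) < ε / 2 := mem_ball_dynEntourage.1 hw k hk
  have h2 : dist (F^[k] v) (F^[k] w) < ε / 2 := mem_ball_dynEntourage.1 hw' k hk
  have := dist_triangle_right (F^[k] u) (F^[k] v) (F^[k] w)
  linarith

open Classical in
theorem coverEntropy_filledJulia_ge_aux (p : ℂ[X]) {d : ℕ} (hd : 2 ≤ d) (hdeg : p.natDegree = d)
    {T : ℕ} (hT : 0 < T) :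
    (Real.log ((d : ℝ) ^ (1 - (p.derivative.roots.toFinset.card : ℝ) / T)) : EReal) ≤
      coverEntropy (fun w => p.eval w) (filledJulia p) := by
  set F : ℂ → ℂ := fun w => p.eval w with hF
  set crit := p.derivative.roots.toFinset with hcrit
  have hp' : p.derivative ≠ 0 := by
    intro h
    have := natDegree_derivative p
    rw [h] at this
    simp at this
    omega
  have hmem : ∀ c, c ∈ crit ↔ p.derivative.eval c = 0 := by
    intro c; rw [hcrit, Multiset.mem_toFinset, mem_roots hp', IsRoot]
  obtain ⟨x, hx, hx'⟩ := exists_fixed_point_not_critical p (by omega)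
  set X : Set ℂ := {y | ∃ k, F^[k] y = x} with hX
  obtain ⟨β, hβ, hβ0⟩ := ((crit.eventually_all.2 fun c hc =>
    eventually_slow_return p hx hx' ((hmem c).1 hc) T).and self_mem_nhdsWithin).exists
  set B : Set ℂ := {z | ∃ c ∈ crit, dist z c < β} with hB
  have hBo : IsOpen B := by
    have : B = ⋃ c ∈ crit, Metric.ball c β := by
      ext z; simp [hB]
    rw [this]
    exact isOpen_biUnion fun c _ => Metric.isOpen_ball
  have hBd : ∀ z ∉ B, p.derivative.eval z ≠ 0 := fun z hz h0 =>
    hz ⟨z, (hmem z).2 h0, by simpa using hβ0⟩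
  obtain ⟨ε, hε, hinj⟩ := exists_uniform_injectivity p
    ((isCompact_filledJulia p (by omega)).diff hBo) fun z hz => hBd z hz.2
  have hXK : X ⊆ filledJulia p := by
    rintro y ⟨k, hk⟩
    induction k generalizing y with
    | zero =>
      have : y = x := hk
      exact this ▸ fixed_point_mem_filledJulia p hx
    | succ k ih => exact mem_filledJulia_of_eval_mem p (ih hk)
  have hXF : MapsTo F X X := by
    rintro y ⟨k, hk⟩
    refine ⟨k, ?_⟩
    rw [← Function.iterate_succ_apply, Function.iterate_succ_apply', hk]
    exact hx
  have hXpre : ∀ y, F y ∈ X → y ∈ X := fun y ⟨k, hk⟩ => ⟨k + 1, hk⟩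
  have htree := exists_separated_tree (F := F) (B := B) (X := X) (ε := ε) (d := d) (x := x)
    ⟨0, rfl⟩ hXpre fun y hy => by
      convert exists_separated_preimages p hd hdeg hBd (S := filledJulia p) (ε := ε)
        (fun z hz hzB => hinj z ⟨hz, hzB⟩) (y := y)
        (fun z hz => mem_filledJulia_of_eval_mem p (hXK (by rwa [hz])))
  refine le_trans ?_ (coverEntropyEntourage_le_coverEntropy F _
    (Metric.dist_mem_uniformity (half_pos hε)))
  have hd0 : (0 : ℝ) < d := by positivity
  have hd1 : (1 : ℝ) ≤ d := by exact_mod_cast (by omega : 1 ≤ d)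
  refine log_le_expGrowthSup_of_le (c := ((d : ℝ) ^ crit.card)⁻¹) (by positivity) (by positivity)
    fun n => ?_
  obtain ⟨S, hS, hsep, hsum⟩ := htree n
  have hbad : ∀ y ∈ S, ((Finset.range n).filter fun k => F^[k] y ∈ B).card ≤
      crit.card * (n / T + 1) := by
    intro y hy
    have : ((Finset.range n).filter fun k => F^[k] y ∈ B) ⊆
        crit.biUnion fun c => (Finset.range n).filter fun k => dist (F^[k] y) c < β := by
      intro k hk
      simp only [Finset.mem_filter, hB, mem_ofPred_eq] at hk
      obtain ⟨hk, c, hc, hd⟩ := hk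
      simp only [Finset.mem_biUnion, Finset.mem_filter]
      exact ⟨c, hc, hk, hd⟩
    refine (Finset.card_le_card this).trans (Finset.card_biUnion_le_card_mul _ _ _ fun c hc => ?_)
    exact card_visits_le hXF hT (fun y hy hyc => hβ c hc y hy hyc) (hS y hy).2 n
  have hcount : d ^ n ≤ S.card * d ^ (crit.card * (n / T + 1)) := by
    refine hsum.trans ?_
    rw [← smul_eq_mul]
    exact Finset.sum_le_card_nsmul _ _ _ fun y hy =>
      Nat.pow_le_pow_right (by omega) (by convert hbad y hy)
  have hreal : ((d : ℝ) ^ crit.card)⁻¹ * ((d : ℝ) ^ (1 - (crit.card : ℝ) / T)) ^ n ≤ S.card :=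
    rpow_bound_of_count (by omega) hcount
  have hcov := card_le_coverMincard_of_separated (K := filledJulia p)
    (fun y hy => hXK (hS y hy).2) hsep
  calc ENNReal.ofReal _ ≤ ENNReal.ofReal (S.card : ℝ) := ENNReal.ofReal_le_ofReal hreal
    _ = ((S.card : ℕ∞) : ENNReal) := by simp
    _ ≤ _ := ENat.toENNReal_mono hcov

theorem coverEntropy_filledJulia_ge (p : ℂ[X]) {d : ℕ} (hd : 2 ≤ d) (hdeg : p.natDegree = d) :
    (Real.log d : EReal) ≤ coverEntropy (fun w => p.eval w) (filledJulia p) := by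
  have hlim : Tendsto (fun T : ℕ =>
      Real.log ((d : ℝ) ^ (1 - (p.derivative.roots.toFinset.card : ℝ) / T))) atTop
      (𝓝 (Real.log d)) := by
    have h1 : Tendsto (fun T : ℕ => (1 - (p.derivative.roots.toFinset.card : ℝ) / T) * Real.log d)
        atTop (𝓝 ((1 - 0) * Real.log d)) :=
      (tendsto_const_nhds.sub (tendsto_const_div_atTop_nhds_zero_nat _)).mul_const _
    rw [sub_zero, one_mul] at h1
    refine h1.congr fun T => ?_
    rw [Real.log_rpow (by positivity)]
  refine le_of_tendsto ((continuous_coe_real_ereal.tendsto _).comp hlim) ?_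
  filter_upwards [eventually_gt_atTop 0] with T hT
  exact coverEntropy_filledJulia_ge_aux p hd hdeg hT

open MeasureTheory ENNReal in
theorem setLIntegral_deriv_sq_mul_comp_of_injOn (p : ℂ[X]) {s : Set ℂ} (hs : MeasurableSet s)
    (hinj : InjOn (fun w => p.eval w) s) (g : ℂ → ℝ≥0∞) :
    ∫⁻ z in s, ‖p.derivative.eval z‖ₑ ^ 2 * g (p.eval z) =
      ∫⁻ w in (fun w => p.eval w) '' s, g w := by
  rw [lintegral_image_eq_lintegral_abs_det_fderiv_mul volume hs
    (fun x _ => ((p.hasDerivAt x).hasFDerivAt.restrictScalars ℝ).hasFDerivWithinAt) hinj g]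
  refine lintegral_congr fun z => ?_
  congr 1
  set a := p.derivative.eval z
  have h1 : ((ContinuousLinearMap.toSpanSingleton ℂ a).restrictScalars ℝ).det = ‖a‖ ^ 2 := by
    rw [← Complex.normSq_eq_norm_sq, ← Algebra.norm_complex_apply, Algebra.norm_apply]
    rw [ContinuousLinearMap.det]
    congr 1
    ext x
    simp [mul_comm]
  rw [h1, abs_of_nonneg (by positivity), ENNReal.ofReal_pow (norm_nonneg _), ofReal_norm]

open MeasureTheory ENNReal in
/-- Change of variables for a polynomial map, counted with multiplicity at most the degree. -/
theorem lintegral_deriv_sq_mul_comp_le (p : ℂ[X]) (hp : 1 ≤ p.natDegree) {g : ℂ → ℝ≥0∞}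
    (hg : Measurable g) :
    ∫⁻ z, ‖p.derivative.eval z‖ₑ ^ 2 * g (p.eval z) ≤ p.natDegree * ∫⁻ w, g w := by
  classical
  have hd0 : p.derivative ≠ 0 := fun h => by
    have := Polynomial.derivative_eq_zero.1 h
    omega
  set Ω : Set ℂ := {z | p.derivative.eval z ≠ 0} with hΩ
  have hΩc : Ωᶜ.Finite := by
    have : Ωᶜ = {z | p.derivative.IsRoot z} := by ext z; simp [hΩ, IsRoot]
    rw [this]; exact finite_setOfPred_isRoot hd0
  have hloc : ∀ z ∈ Ω, ∃ U : Set ℂ, IsOpen U ∧ z ∈ U ∧ InjOn (fun w => p.eval w) U :=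
    fun z hz => exists_nhds_injOn p hz
  choose! U hUo hzU hinj using hloc
  obtain ⟨t, htΩ, htc, hcov⟩ := TopologicalSpace.countable_cover_nhdsWithin
    (fun z hz => mem_nhdsWithin_of_mem_nhds ((hUo z hz).mem_nhds (hzU z hz)))
  have hne : Ω.Nonempty := by
    rw [nonempty_iff_ne_empty]
    intro h
    rw [h, compl_empty] at hΩc
    exact infinite_univ hΩc
  have htne : t.Nonempty := by
    obtain ⟨z, hz⟩ := hne
    obtain ⟨i, hi, -⟩ := mem_iUnion₂.1 (hcov hz)
    exact ⟨i, hi⟩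
  obtain ⟨e, he⟩ := htc.exists_eq_range htne
  have het : ∀ i, e i ∈ Ω := fun i => htΩ (he ▸ mem_range_self i)
  set S : ℕ → Set ℂ := disjointed fun i => U (e i) with hS
  have hSm : ∀ i, MeasurableSet (S i) :=
    MeasurableSet.disjointed fun i => (hUo _ (het i)).measurableSet
  have hSd : Pairwise (Function.onFun Disjoint S) := disjoint_disjointed _
  have hSi : ∀ i, InjOn (fun w => p.eval w) (S i) := fun i =>
    (hinj _ (het i)).mono (disjointed_subset _ _)
  have hSf : ∀ i, MeasurableSet ((fun w => p.eval w) '' S i) := fun i =>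
    (hSm i).image_of_continuousOn_injOn p.continuous.continuousOn (hSi i)
  have hcover : (⋃ i, S i) =ᵐ[volume] (univ : Set ℂ) := by
    refine ae_eq_univ.2 (measure_mono_null (compl_subset_compl.2 ?_) (hΩc.measure_zero _))
    rw [hS, iUnion_disjointed]
    intro z hz
    obtain ⟨i, hi, hzi⟩ := mem_iUnion₂.1 (hcov hz)
    rw [he] at hi
    obtain ⟨j, rfl⟩ := hi
    exact mem_iUnion.2 ⟨j, hzi⟩
  have hcount : ∀ w,
      ∑' i, ((fun w => p.eval w) '' S i).indicator (1 : ℂ → ℝ≥0∞) w ≤ p.natDegree := by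
    intro w
    rw [ENNReal.tsum_eq_iSup_sum]
    refine iSup_le fun s => ?_
    have hnz : p - C w ≠ 0 := fun h => by
      have := natDegree_sub_C (p := p) (a := w)
      rw [h, natDegree_zero] at this
      omega
    simp only [indicator_apply, Pi.one_apply]
    rw [Finset.sum_ite, Finset.sum_const_zero, add_zero, Finset.sum_const, nsmul_eq_mul, mul_one]
    have : (s.filter fun i => w ∈ (fun w => p.eval w) '' S i).card ≤ p.natDegree := by
      have hx : ∀ i ∈ s.filter fun i => w ∈ (fun w => p.eval w) '' S i, ∃ z ∈ S i, p.eval z = w :=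
        fun i hi => (Finset.mem_filter.1 hi).2
      choose! x hxS hxw using hx
      calc _ ≤ (p - C w).roots.toFinset.card := by
            refine Finset.card_le_card_of_injOn x (fun i hi => ?_) (fun i hi j hj hij => ?_)
            · rw [Finset.mem_coe, Multiset.mem_toFinset, mem_roots hnz]
              simp [hxw i hi]
            · by_contra hne
              exact disjoint_left.1 (hSd hne) (hxS i hi) (hij ▸ hxS j hj)
        _ ≤ Multiset.card (p - C w).roots := Multiset.toFinset_card_le _
        _ ≤ (p - C w).natDegree := card_roots' _
        _ = p.natDegree := natDegree_sub_C
    exact_mod_cast this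
  calc ∫⁻ z, ‖p.derivative.eval z‖ₑ ^ 2 * g (p.eval z)
      = ∫⁻ z in ⋃ i, S i, ‖p.derivative.eval z‖ₑ ^ 2 * g (p.eval z) := by
        rw [setLIntegral_congr hcover, setLIntegral_univ]
    _ = ∑' i, ∫⁻ z in S i, ‖p.derivative.eval z‖ₑ ^ 2 * g (p.eval z) :=
        lintegral_iUnion hSm hSd _
    _ = ∑' i, ∫⁻ w, ((fun w => p.eval w) '' S i).indicator (1 : ℂ → ℝ≥0∞) w * g w := by
        refine tsum_congr fun i => ?_
        rw [setLIntegral_deriv_sq_mul_comp_of_injOn p (hSm i) (hSi i),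
          ← lintegral_indicator (hSf i)]
        refine lintegral_congr fun w => ?_
        by_cases hw : w ∈ (fun w => p.eval w) '' S i <;>
          simp only [hw, indicator_of_mem, indicator_of_notMem, not_false_eq_true, one_mul, zero_mul, Pi.one_apply]
    _ = ∫⁻ w, ∑' i, ((fun w => p.eval w) '' S i).indicator (1 : ℂ → ℝ≥0∞) w * g w := by
        rw [lintegral_tsum]
        exact fun i => ((measurable_one.indicator (hSf i)).mul hg).aemeasurable
    _ ≤ ∫⁻ w, p.natDegree * g w := by
        refine lintegral_mono fun w => ?_
        rw [ENNReal.tsum_mul_right]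
        gcongr
        exact hcount w
    _ = _ := lintegral_const_mul _ hg

/-- The integrable kernel `r⁻¹ (1 + r)⁻²` of the radial estimate. -/
theorem integrable_norm_inv_mul_one_add_norm_sq_inv :
    MeasureTheory.Integrable fun w : ℂ => ‖w‖⁻¹ * ((1 + ‖w‖) ^ 2)⁻¹ := by
  have h := MeasureTheory.integrable_fun_norm_addHaar
    (MeasureTheory.volume : MeasureTheory.Measure ℂ)
    (f := fun r : ℝ => r⁻¹ * ((1 + r) ^ 2)⁻¹)
  refine h.2 ?_
  simp only [Complex.finrank_real_complex]
  have h2 := (integrable_inv_one_add_sq).integrableOn (s := Ioi (0:ℝ))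
  refine MeasureTheory.Integrable.mono' h2 ?_ ?_
  · refine ContinuousOn.aestronglyMeasurable (fun x hx => ContinuousAt.continuousWithinAt ?_)
      measurableSet_Ioi
    have hx0 : x ≠ 0 := (mem_Ioi.1 hx).ne'
    have hx1 : (1 + x) ^ 2 ≠ 0 := by have := mem_Ioi.1 hx; positivity
    fun_prop (disch := assumption)
  · refine (MeasureTheory.ae_restrict_iff' measurableSet_Ioi).2 (.of_forall fun x hx => ?_)
    have hx0 : 0 < x := hx
    rw [Real.norm_of_nonneg (by positivity)]
    simp only [smul_eq_mul, Nat.add_one_sub_one, pow_one]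
    rw [← mul_assoc, mul_inv_cancel₀ hx0.ne', one_mul]
    gcongr
    nlinarith

theorem lintegral_enorm_X_cube_sub_X_inv_lt_top :
    ∫⁻ w : ℂ, ‖(X ^ 3 - X : ℂ[X]).eval w‖ₑ⁻¹ < ⊤ := by
  have hk := integrable_norm_inv_mul_one_add_norm_sq_inv
  have hI := (((hk.add (hk.comp_sub_right 1)).add (hk.comp_add_right 1)).const_mul 9)
  refine lt_of_le_of_lt (MeasureTheory.lintegral_mono_ae ?_) hI.2
  have key : ∀ x y z : ℝ, 0 ≤ x → 1 + x ≤ 3 * y → 1 + x ≤ 3 * z →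
      (x * y * z)⁻¹ ≤ 9 * (x⁻¹ * ((1 + x) ^ 2)⁻¹) := by
    intro x y z hx hy hz
    have h1 : ((1 + x) ^ 2) / 9 ≤ y * z := by nlinarith
    calc (x * y * z)⁻¹ = x⁻¹ * (y * z)⁻¹ := by rw [mul_assoc, mul_inv]
      _ ≤ x⁻¹ * ((1 + x) ^ 2 / 9)⁻¹ := by gcongr
      _ = _ := by rw [inv_div]; ring
  have hnull : ∀ᵐ w : ℂ, (X ^ 3 - X : ℂ[X]).eval w ≠ 0 := by
    have hne : (X ^ 3 - X : ℂ[X]) ≠ 0 := fun h => by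
      have := congrArg (fun q : ℂ[X] => q.coeff 3) h
      simp [coeff_X] at this
    have : {w : ℂ | ¬ (X ^ 3 - X : ℂ[X]).eval w ≠ 0} = {w | (X ^ 3 - X : ℂ[X]).IsRoot w} := by
      ext w; simp only [not_not]; rfl
    rw [MeasureTheory.ae_iff, this]
    exact (finite_setOfPred_isRoot hne).measure_zero _
  filter_upwards [hnull] with w hw
  rw [← enorm_inv hw]
  refine enorm_le_iff_norm_le.2 ?_
  have e : (X ^ 3 - X : ℂ[X]).eval w = w * (w - 1) * (w + 1) := by simp; ring
  rw [e, norm_inv, norm_mul, norm_mul]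
  have n1 : 1 ≤ ‖w‖ + ‖w - 1‖ := by
    have := norm_sub_le w (w - 1); simpa using this
  have n2 : 1 ≤ ‖w‖ + ‖w + 1‖ := by
    have := norm_sub_le (w + 1) w; simp at this; linarith
  have n3 : 2 ≤ ‖w + 1‖ + ‖w - 1‖ := by
    have := norm_sub_le (w + 1) (w - 1)
    have e : (w + 1) - (w - 1) = 2 := by ring
    rw [e] at this; simpa using this
  simp only [Pi.add_apply]
  refine le_trans ?_ (le_abs_self _)
  set x := ‖w‖
  set y := ‖w - 1‖
  set z := ‖w + 1‖
  have hx : 0 ≤ x := norm_nonneg _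
  have hy : 0 ≤ y := norm_nonneg _
  have hz : 0 ≤ z := norm_nonneg _
  have kx : 0 ≤ x⁻¹ * ((1 + x) ^ 2)⁻¹ := by positivity
  have ky : 0 ≤ y⁻¹ * ((1 + y) ^ 2)⁻¹ := by positivity
  have kz : 0 ≤ z⁻¹ * ((1 + z) ^ 2)⁻¹ := by positivity
  rcases le_total x y with hxy | hxy <;> rcases le_total y z with hyz | hyz <;>
    rcases le_total x z with hxz | hxz
  all_goals first
    | linarith [key x y z hx (by linarith) (by linarith)]
    | (rw [mul_comm x y]; linarith [key y x z hy (by linarith) (by linarith)])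
    | (rw [show x * y * z = z * x * y by ring]
       linarith [key z x y hz (by linarith) (by linarith)])

open MeasureTheory ENNReal in
theorem two_pi_mul_enorm_le_lintegral_circleMap {H : ℂ → ℂ} {z : ℂ} {r : ℝ} (hr : 0 < r)
    (hH : DiffContOnCl ℂ H (Metric.ball z r)) :
    ENNReal.ofReal (2 * Real.pi) * ‖H z‖ₑ ≤
      ∫⁻ θ in Ioo (-Real.pi) Real.pi, ‖H (circleMap z r θ)‖ₑ := by
  have h1 := (show DiffContOnCl ℂ H (Metric.ball z |r|) by rwa [abs_of_pos hr]).circleAverage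
  rw [Real.circleAverage] at h1
  have hper : Function.Periodic (fun θ => H (circleMap z r θ)) (2 * Real.pi) := fun θ => by
    simp only [periodic_circleMap z r θ]
  have h2 := hper.intervalIntegral_add_eq (-Real.pi) 0
  rw [zero_add, show -Real.pi + 2 * Real.pi = Real.pi by ring] at h2
  rw [← h2, intervalIntegral.integral_of_le (by linarith [Real.pi_pos]),
    integral_Ioc_eq_integral_Ioo] at h1
  have h3 : ∫ θ in Ioo (-Real.pi) Real.pi, H (circleMap z r θ) = ((2 * Real.pi : ℝ) : ℂ) * H z := by
    rw [← h1, Complex.real_smul, ← mul_assoc, ← Complex.ofReal_mul,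
      mul_inv_cancel₀ (by positivity), Complex.ofReal_one, one_mul]
  refine le_trans (le_of_eq ?_) (enorm_integral_le_lintegral_enorm _)
  rw [h3, enorm_mul, ← ofReal_norm (Complex.ofReal _), Complex.norm_of_nonneg (by positivity)]

open MeasureTheory ENNReal in
/-- The area form of the mean value inequality. -/
theorem pi_mul_sq_mul_enorm_le_setLIntegral_ball {H : ℂ → ℂ} (hHm : Measurable H) {z : ℂ} {r : ℝ}
    (hr : 0 < r) (hH : DifferentiableOn ℂ H (Metric.ball z r)) :
    ENNReal.ofReal (Real.pi * r ^ 2) * ‖H z‖ₑ ≤ ∫⁻ w in Metric.ball z r, ‖H w‖ₑ := by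
  set F : ℂ → ℝ≥0∞ := (Metric.ball z r).indicator fun w => ‖H w‖ₑ with hF
  have hFm : Measurable F := hHm.enorm.indicator measurableSet_ball
  have h0 : ∫⁻ w in Metric.ball z r, ‖H w‖ₑ = ∫⁻ w, F (z + w) := by
    rw [lintegral_add_left_eq_self F z, lintegral_indicator measurableSet_ball]
  have hm : Measurable fun q : ℝ × ℝ => ENNReal.ofReal q.1 * F (circleMap z q.1 q.2) := by
    refine (ENNReal.measurable_ofReal.comp measurable_fst).mul (hFm.comp ?_)
    simp only [circleMap]
    fun_prop
  have hpol : ∀ q : ℝ × ℝ, z + Complex.polarCoord.symm q = circleMap z q.1 q.2 := fun q => by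
    rw [Complex.polarCoord_symm_apply, circleMap, Complex.exp_mul_I, Complex.ofReal_cos,
      Complex.ofReal_sin]
  rw [h0, ← Complex.lintegral_comp_polarCoord_symm]
  simp only [hpol, smul_eq_mul, polarCoord_target]
  rw [Measure.volume_eq_prod, ← Measure.prod_restrict, lintegral_prod _ hm.aemeasurable]
  have hin : ∀ ρ ∈ Ioo (0:ℝ) r, ENNReal.ofReal (2 * Real.pi * ρ) * ‖H z‖ₑ ≤
      ∫⁻ θ in Ioo (-Real.pi) Real.pi, ENNReal.ofReal ρ * F (circleMap z ρ θ) := by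
    intro ρ hρ
    have hcl : DiffContOnCl ℂ H (Metric.ball z ρ) :=
      (hH.mono (Metric.closedBall_subset_ball hρ.2)).diffContOnCl_ball subset_rfl
    have h1 := two_pi_mul_enorm_le_lintegral_circleMap hρ.1 hcl
    have h2 : ∀ θ, F (circleMap z ρ θ) = ‖H (circleMap z ρ θ)‖ₑ := fun θ => by
      rw [hF, indicator_of_mem]
      rw [Metric.mem_ball, dist_eq_norm, circleMap_sub_center, norm_circleMap_zero, abs_of_pos hρ.1]
      exact hρ.2
    simp only [h2]
    rw [lintegral_const_mul', mul_comm (2 * Real.pi), ENNReal.ofReal_mul hρ.1.le, mul_assoc]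
    · gcongr
    · exact ENNReal.ofReal_ne_top
  calc ENNReal.ofReal (Real.pi * r ^ 2) * ‖H z‖ₑ
      = ∫⁻ ρ in Ioo (0:ℝ) r, ENNReal.ofReal (2 * Real.pi * ρ) * ‖H z‖ₑ := by
        rw [lintegral_mul_const' _ _ enorm_ne_top]
        congr 1
        rw [← ofReal_integral_eq_lintegral_ofReal]
        · congr 1
          rw [← integral_Ioc_eq_integral_Ioo, ← intervalIntegral.integral_of_le hr.le,
            intervalIntegral.integral_const_mul, integral_id]
          ring
        · exact ((continuous_const.mul continuous_id).integrableOn_Icc (a := 0) (b := r)).mono_set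
            Ioo_subset_Icc_self
        · refine (ae_restrict_iff' measurableSet_Ioo).2 (.of_forall fun x hx => ?_)
          have := Real.pi_pos
          have := hx.1
          simp only [Pi.zero_apply]; positivity
    _ ≤ ∫⁻ ρ in Ioo (0:ℝ) r, ∫⁻ θ in Ioo (-Real.pi) Real.pi,
          ENNReal.ofReal ρ * F (circleMap z ρ θ) :=
        setLIntegral_mono' measurableSet_Ioo hin
    _ ≤ _ := lintegral_mono_set fun x hx => hx.1

open MeasureTheory ENNReal in
/-- A disc on which `f` avoids the zeros of `Q` and has small weighted area is mapped with small
oscillation on the concentric disc of half the radius. -/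
theorem norm_eval_sub_le_of_setLIntegral_le (f Q : ℂ[X]) {z : ℂ} {r M A B η : ℝ} (hr : 0 < r)
    (hA : 0 < A) (hA1 : A ≤ 1) (hη : 0 ≤ η) (hB : ∀ w, ‖w‖ ≤ M → ‖Q.eval w‖ ≤ B)
    (hηB : 2 * η * B ≤ A ^ 2) (hz : ‖f.eval z‖ + 1 ≤ M)
    (hQ : ∀ w ∈ Metric.ball z r, Q.eval (f.eval w) ≠ 0)
    (hI : ∫⁻ w in Metric.ball z r, ‖f.derivative.eval w‖ₑ ^ 2 * ‖Q.eval (f.eval w)‖ₑ⁻¹ ≤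
      ENNReal.ofReal η) {w : ℂ} (hw : dist w z < r / 2) :
    ‖f.eval w - f.eval z‖ ≤ A := by
  set H : ℂ → ℂ := fun w => f.derivative.eval w ^ 2 / Q.eval (f.eval w) with hH
  have hHm : Measurable H := (f.derivative.continuous.measurable.pow_const 2).div
    (Q.continuous.measurable.comp f.continuous.measurable)
  have hHd : DifferentiableOn ℂ H (Metric.ball z r) := fun x hx => by
    refine DifferentiableAt.differentiableWithinAt ?_
    refine DifferentiableAt.div (f.derivative.differentiable.differentiableAt.pow 2) ?_ (hQ x hx)
    exact Q.differentiable.differentiableAt.comp x f.differentiable.differentiableAt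
  have hder : ∀ x, dist x z < r / 2 → ‖f.eval x‖ ≤ M → ‖f.derivative.eval x‖ ≤ A / r := by
    intro x hx hxM
    have hsub : Metric.ball x (r / 2) ⊆ Metric.ball z r := Metric.ball_subset_ball' (by linarith)
    have h1 := pi_mul_sq_mul_enorm_le_setLIntegral_ball hHm (half_pos hr) (hHd.mono hsub)
    have h2 : ENNReal.ofReal (Real.pi * (r / 2) ^ 2) * ‖H x‖ₑ ≤ ENNReal.ofReal η := by
      refine h1.trans (le_trans ?_ hI)
      refine (lintegral_mono_set hsub).trans (le_of_eq ?_)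
      refine setLIntegral_congr_fun measurableSet_ball fun y hy => ?_
      simp only [hH]
      rw [div_eq_mul_inv, enorm_mul, enorm_inv (hQ y hy), enorm_pow]
    rw [← ofReal_norm, ← ENNReal.ofReal_mul (by positivity), ENNReal.ofReal_le_ofReal_iff hη] at h2
    have hxb : x ∈ Metric.ball z r := by rw [Metric.mem_ball]; linarith
    have h3 : ‖f.derivative.eval x‖ ^ 2 = ‖H x‖ * ‖Q.eval (f.eval x)‖ := by
      simp only [hH]
      rw [norm_div, norm_pow, div_mul_cancel₀ _ (norm_ne_zero_iff.2 (hQ x hxb))]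
    have h4 : ‖H x‖ * r ^ 2 ≤ 2 * η := by
      have : 0 ≤ ‖H x‖ * r ^ 2 := by positivity
      nlinarith [Real.pi_gt_three]
    have h5 := hB _ hxM
    rw [le_div_iff₀ hr]
    refine abs_le_of_sq_le_sq' ?_ hA.le |>.2
    calc (‖f.derivative.eval x‖ * r) ^ 2 = (‖H x‖ * r ^ 2) * ‖Q.eval (f.eval x)‖ := by
          rw [mul_pow, h3]; ring
      _ ≤ 2 * η * B := by gcongr
      _ ≤ A ^ 2 := hηB
  set γ : ℝ → ℂ := fun t => f.eval (z + t * (w - z)) - f.eval z with hγ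
  have hγd : ∀ t : ℝ, HasDerivAt γ (f.derivative.eval (z + t * (w - z)) * (w - z)) t := by
    intro t
    have h1 : HasDerivAt (fun s : ℂ => z + s * (w - z)) (w - z) (t : ℂ) := by
      simpa using ((hasDerivAt_id (t : ℂ)).mul_const (w - z)).const_add z
    exact (((f.hasDerivAt _).comp (t : ℂ) h1).comp_ofReal).sub_const _
  have key := image_norm_le_of_norm_deriv_right_lt_deriv_boundary (f := γ) (a := 0) (b := 1)
    (f' := fun t => f.derivative.eval (z + t * (w - z)) * (w - z)) (B := fun t => A * t)
    (B' := fun _ => A) (fun t _ => (hγd t).continuousAt.continuousWithinAt)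
    (fun t _ => (hγd t).hasDerivWithinAt) (by simp [hγ])
    (fun t => by simpa using (hasDerivAt_id t).const_mul A) (fun t ht heq => ?_)
    (x := 1) (by simp)
  · simpa [hγ] using key
  · have hwz : ‖w - z‖ < r / 2 := by rwa [← dist_eq_norm]
    have hx : dist (z + t * (w - z)) z < r / 2 := by
      rw [dist_eq_norm, add_sub_cancel_left, norm_mul, Complex.norm_of_nonneg ht.1]
      nlinarith [ht.1, ht.2, norm_nonneg (w - z)]
    have hM : ‖f.eval (z + t * (w - z))‖ ≤ M := by
      have : f.eval (z + t * (w - z)) = γ t + f.eval z := by simp [hγ]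
      rw [this]
      refine (norm_add_le _ _).trans ?_
      rw [heq]
      nlinarith [ht.1, ht.2]
    rw [norm_mul]
    calc _ ≤ A / r * (r / 2) := by
          gcongr
          exact hder _ hx hM
      _ = A / 2 := by field_simp
      _ < A := half_lt_self hA

open MeasureTheory ENNReal in
/-- A measure controlling both the weighted area of `f` and the zeros of `Q ∘ f`. -/
theorem exists_measure_area_and_zeros (f Q : ℂ[X]) (hf : 1 ≤ f.natDegree) (hQ : 1 ≤ Q.natDegree)
    (η : ℝ≥0∞) :
    ∃ ν : Measure ℂ,
      ν univ ≤ f.natDegree * ((∫⁻ w, ‖Q.eval w‖ₑ⁻¹) + Q.natDegree * η) ∧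
      (∀ s, MeasurableSet s →
        ∫⁻ w in s, ‖f.derivative.eval w‖ₑ ^ 2 * ‖Q.eval (f.eval w)‖ₑ⁻¹ ≤ ν s) ∧
      ∀ x, Q.eval (f.eval x) = 0 → η ≤ ν {x} := by
  classical
  have hne : Q.comp f ≠ 0 := fun h => by
    have := natDegree_comp (p := Q) (q := f)
    rw [h, natDegree_zero] at this
    exact absurd this.symm (mul_pos hQ hf).ne'
  refine ⟨volume.withDensity (fun w => ‖f.derivative.eval w‖ₑ ^ 2 * ‖Q.eval (f.eval w)‖ₑ⁻¹) +
    η • ∑ x ∈ (Q.comp f).roots.toFinset, Measure.dirac x, ?_, fun s hs => ?_, fun x hx => ?_⟩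
  · rw [Measure.add_apply, withDensity_apply _ MeasurableSet.univ, setLIntegral_univ, mul_add]
    refine add_le_add (lintegral_deriv_sq_mul_comp_le f hf
      (Q.continuous.measurable.enorm.inv)) ?_
    rw [Measure.smul_apply, Measure.finsetSum_apply]
    simp only [measure_univ, Finset.sum_const, nsmul_eq_mul, mul_one, smul_eq_mul]
    have : (Q.comp f).roots.toFinset.card ≤ Q.natDegree * f.natDegree := by
      rw [← natDegree_comp]
      exact (Multiset.toFinset_card_le _).trans (card_roots' _)
    calc η * ((Q.comp f).roots.toFinset.card : ℝ≥0∞)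
        ≤ η * ((Q.natDegree * f.natDegree : ℕ) : ℝ≥0∞) := by
          gcongr
      _ = _ := by push_cast; ring
  · rw [Measure.add_apply, withDensity_apply _ hs]
    exact le_self_add
  · rw [Measure.add_apply, Measure.smul_apply, Measure.finsetSum_apply, smul_eq_mul]
    refine le_trans ?_ le_add_self
    refine le_mul_of_one_le_right' ?_
    have hmem : x ∈ (Q.comp f).roots.toFinset := by
      rw [Multiset.mem_toFinset, mem_roots hne]
      simpa using hx
    refine le_trans ?_ (Finset.single_le_sum (fun _ _ => zero_le) hmem)
    simp

open MeasureTheory ENNReal in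
theorem exists_measure_iterates {p : ℂ[X]} {d : ℕ} (hd : 1 ≤ d) (hdeg : p.natDegree = d) (Q : ℂ[X])
    (hQ : 1 ≤ Q.natDegree) (η : ℝ≥0∞) (n : ℕ) :
    ∃ ν : Measure ℂ,
      ν univ ≤ n * d ^ n * ((∫⁻ w, ‖Q.eval w‖ₑ⁻¹) + Q.natDegree * η) + η ∧
      η ≤ ν {0} ∧ ∀ k < n,
      (∀ s, MeasurableSet s → ∫⁻ w in s, ‖(p.comp^[k] X).derivative.eval w‖ₑ ^ 2 *
        ‖Q.eval ((p.comp^[k] X).eval w)‖ₑ⁻¹ ≤ ν s) ∧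
      ∀ x, Q.eval ((p.comp^[k] X).eval x) = 0 → η ≤ ν {x} := by
  have hdk : ∀ k, (p.comp^[k] X).natDegree = d ^ k := fun k => by
    rw [natDegree_iterate_comp, hdeg, natDegree_X, mul_one]
  choose ν h1 h2 h3 using fun k => exists_measure_area_and_zeros (p.comp^[k] X) Q
    (by rw [hdk]; exact Nat.one_le_pow _ _ hd) hQ η
  have hle : ∀ k < n, ∀ s,
      ν k s ≤ ((∑ k ∈ Finset.range n, ν k) + η • Measure.dirac 0 : Measure ℂ) s := by
    intro k hk s
    rw [Measure.add_apply, Measure.finsetSum_apply]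
    exact (Finset.single_le_sum (f := fun k => ν k s) (fun _ _ => zero_le)
      (Finset.mem_range.2 hk)).trans le_self_add
  refine ⟨(∑ k ∈ Finset.range n, ν k) + η • Measure.dirac 0, ?_, ?_, fun k hk =>
    ⟨fun s hs => (h2 k s hs).trans (hle k hk s), fun x hx => (h3 k x hx).trans (hle k hk _)⟩⟩
  · rw [Measure.add_apply, Measure.finsetSum_apply, Measure.smul_apply]
    simp only [measure_univ, smul_eq_mul, mul_one]
    gcongr
    calc _ ≤ ∑ k ∈ Finset.range n, (d : ℝ≥0∞) ^ n * ((∫⁻ w, ‖Q.eval w‖ₑ⁻¹) + Q.natDegree * η) := by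
          refine Finset.sum_le_sum fun k hk => (h1 k).trans ?_
          rw [hdk]
          push_cast
          gcongr
          · exact_mod_cast hd
          · exact (Finset.mem_range.1 hk).le
      _ = _ := by rw [Finset.sum_const, Finset.card_range, nsmul_eq_mul, mul_assoc]
  · rw [Measure.add_apply, Measure.smul_apply]
    simp

open MeasureTheory ENNReal in
/-- A Vitali-type counting lemma: if every disc of radius `r` centred on `E` has mass at least `η`,
then `E` is covered by at most `289 ν(ℂ) / η` discs of radius `r / 4`. -/
theorem exists_finset_cover_of_le_measure_ball (ν : Measure ℂ) (hν : ν univ ≠ ⊤) (E : Set ℂ) {r : ℝ}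
    (hr : 0 < r) {η : ℝ≥0∞} (hη : η ≠ 0) (hE : ∀ z ∈ E, η ≤ ν (Metric.ball z r)) :
    ∃ S : Finset ℂ, (∀ c ∈ S, c ∈ E) ∧ (∀ z ∈ E, ∃ c ∈ S, dist z c < r / 4) ∧
      S.card * η ≤ 289 * ν univ := by
  classical
  set s := r / 8 with hs
  have hs0 : 0 < s := by positivity
  set κ : ℂ → ℤ × ℤ := fun z => (⌊z.re / s⌋, ⌊z.im / s⌋) with hκ
  have hx : ∀ t ∈ κ '' E, ∃ c ∈ E, κ c = t := fun t ht => ht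
  choose! c hcE hcκ using hx
  have hfl : ∀ a b : ℝ, |a - b| < r → ⌊a / s⌋ ≤ ⌊b / s⌋ + 8 := by
    intro a b hab
    rw [← Int.floor_add_ofNat]
    refine Int.floor_mono ?_
    rw [div_le_iff₀ hs0, add_mul, div_mul_cancel₀ _ hs0.ne']
    have : (OfNat.ofNat 8 : ℝ) * s = r := by rw [hs]; norm_num; ring
    linarith [(abs_lt.1 hab).2]
  have hnear : ∀ z w : ℂ, dist z w < r → κ z ∈ Finset.Icc (κ w - 8) (κ w + 8) := by
    intro z w h
    rw [dist_eq_norm] at h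
    have hre : |z.re - w.re| < r := (Complex.abs_re_le_norm (z - w)).trans_lt h
    have him : |z.im - w.im| < r := (Complex.abs_im_le_norm (z - w)).trans_lt h
    have e8 : (8 : ℤ × ℤ) = (8, 8) := rfl
    rw [Finset.mem_Icc, e8, Prod.le_def, Prod.le_def]
    refine ⟨⟨?_, ?_⟩, hfl _ _ hre, hfl _ _ him⟩
    · exact sub_le_iff_le_add.2 (hfl _ _ (by rwa [abs_sub_comm]))
    · exact sub_le_iff_le_add.2 (hfl _ _ (by rwa [abs_sub_comm]))
  have hcount : ∀ T : Finset (ℤ × ℤ), (∀ t ∈ T, t ∈ κ '' E) → T.card * η ≤ 289 * ν univ := by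
    intro T hT
    calc (T.card : ℝ≥0∞) * η = ∑ t ∈ T, η := by rw [Finset.sum_const, nsmul_eq_mul]
      _ ≤ ∑ t ∈ T, ν (Metric.ball (c t) r) := Finset.sum_le_sum fun t ht => hE _ (hcE t (hT t ht))
      _ = ∑ t ∈ T, ∫⁻ w, (Metric.ball (c t) r).indicator 1 w ∂ν := by
          simp_rw [lintegral_indicator_one measurableSet_ball]
      _ = ∫⁻ w, ∑ t ∈ T, (Metric.ball (c t) r).indicator 1 w ∂ν := by
          rw [lintegral_finsetSum]
          exact fun t _ => measurable_one.indicator measurableSet_ball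
      _ ≤ ∫⁻ _, 289 ∂ν := by
          refine lintegral_mono fun w => ?_
          simp only [indicator_apply, Pi.one_apply]
          rw [Finset.sum_ite, Finset.sum_const_zero, add_zero, Finset.sum_const, nsmul_eq_mul,
            mul_one]
          have : (T.filter fun t => w ∈ Metric.ball (c t) r).card ≤ 289 := by
            calc _ ≤ (Finset.Icc (κ w - 8) (κ w + 8)).card := by
                  refine Finset.card_le_card fun t ht => ?_
                  obtain ⟨ht1, ht2⟩ := Finset.mem_filter.1 ht
                  rw [← hcκ t (hT t ht1)]
                  exact hnear _ _ (by rwa [dist_comm])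
              _ = 289 := by
                  have e8 : (8 : ℤ × ℤ) = (8, 8) := rfl
                  rw [Finset.card_Icc_prod, e8]
                  simp only [Prod.fst_sub, Prod.fst_add, Prod.snd_sub, Prod.snd_add, Int.card_Icc]
                  rw [show ∀ a : ℤ, a + 8 + 1 - (a - 8) = 17 from fun a => by ring,
                    show ∀ a : ℤ, a + 8 + 1 - (a - 8) = 17 from fun a => by ring]
                  rfl
          exact_mod_cast this
      _ = _ := by rw [lintegral_const]
  have hfin : (κ '' E).Finite := by
    by_contra hinf
    have htop : 289 * ν univ / η ≠ ⊤ := ENNReal.div_ne_top (ENNReal.mul_ne_top (by simp) hν) hη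
    obtain ⟨n, hn⟩ := ENNReal.exists_nat_gt htop
    obtain ⟨T, hT, hTc⟩ := Set.Infinite.exists_subset_card_eq hinf n
    have h1 := hcount T (fun t ht => hT ht)
    rw [hTc] at h1
    have hη' : η ≠ ⊤ := by
      obtain ⟨_, z, hz, -⟩ := Set.Infinite.nonempty hinf
      exact ((hE z hz).trans_lt ((measure_mono (subset_univ _)).trans_lt hν.lt_top)).ne
    exact absurd h1 (not_le.2 ((ENNReal.div_lt_iff (.inl hη) (.inl hη')).1 hn))
  refine ⟨hfin.toFinset.image c, ?_, fun z hz => ⟨c (κ z), ?_, ?_⟩, ?_⟩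
  · intro x hx
    obtain ⟨t, ht, rfl⟩ := Finset.mem_image.1 hx
    exact hcE t (hfin.mem_toFinset.1 ht)
  · exact Finset.mem_image_of_mem _ (hfin.mem_toFinset.2 ⟨z, hz, rfl⟩)
  · have h := hcκ (κ z) ⟨z, hz, rfl⟩
    simp only [hκ, Prod.mk.injEq] at h
    have hcl : ∀ a b : ℝ, ⌊a / s⌋ = ⌊b / s⌋ → |b - a| < s := fun a b hab => by
      have := Int.abs_sub_lt_one_of_floor_eq_floor hab.symm
      rw [← sub_div, abs_div, abs_of_pos hs0, div_lt_one hs0] at this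
      exact this
    have h1 := hcl _ _ h.1
    have h2 := hcl _ _ h.2
    rw [dist_eq_norm]
    calc _ ≤ |(z - c (κ z)).re| + |(z - c (κ z)).im| := Complex.norm_le_abs_re_add_abs_im _
      _ < s + s := add_lt_add h1 h2
      _ = r / 4 := by rw [hs]; ring
  · refine le_trans ?_ (hcount hfin.toFinset fun t ht => hfin.mem_toFinset.1 ht)
    gcongr
    exact Finset.card_image_le

theorem eval_iterate_comp_X (p : ℂ[X]) (k : ℕ) (z : ℂ) :
    (p.comp^[k] X).eval z = (fun w => p.eval w)^[k] z := by
  rw [iterate_comp_eval, eval_X]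

theorem exists_dist_iterate_le {p : ℂ[X]} {R : ℝ} {K : Set ℂ} (hK : K ⊆ Metric.closedBall 0 R)
    (hmaps : MapsTo (fun w => p.eval w) K K) :
    ∃ l : ℕ, ∀ ε ≤ (1 : ℝ), ∀ n, ∀ c ∈ K, ∀ z, dist z c * (2 ^ l) ^ n ≤ ε → ∀ k ≤ n,
      dist ((fun w => p.eval w)^[k] z) ((fun w => p.eval w)^[k] c) ≤ ε := by
  obtain ⟨L, hL⟩ := (isCompact_closedBall (0 : ℂ) (R + 1)).exists_bound_of_continuousOn
    p.derivative.continuous.continuousOn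
  obtain ⟨l, hl⟩ := pow_unbounded_of_one_lt L (one_lt_two)
  have hlip : ∀ x ∈ Metric.closedBall (0 : ℂ) (R + 1), ∀ y ∈ Metric.closedBall (0 : ℂ) (R + 1),
      dist (p.eval x) (p.eval y) ≤ 2 ^ l * dist x y := by
    intro x hx y hy
    rw [dist_eq_norm, dist_eq_norm]
    exact (convex_closedBall _ _).norm_image_sub_le_of_norm_hasDerivWithin_le
      (fun w _ => (p.hasDerivAt w).hasDerivWithinAt) (fun w hw => (hL w hw).trans hl.le) hy hx
  refine ⟨l, fun ε hε n c hc z hz k hk => ?_⟩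
  have h2 : (1:ℝ) ≤ 2 ^ l := one_le_pow₀ one_le_two
  have hbound : ∀ k ≤ n, dist z c * (2 ^ l) ^ k ≤ ε := fun k hk => le_trans (by gcongr) hz
  have key : ∀ k ≤ n, dist ((fun w => p.eval w)^[k] z) ((fun w => p.eval w)^[k] c) ≤
      dist z c * (2 ^ l) ^ k := by
    intro k
    induction k with
    | zero => intro _; simp
    | succ k ih =>
      intro hk
      have ih := ih (by omega)
      have hcK := hK (hmaps.iterate k hc)
      have hc' := Metric.mem_closedBall.1 hcK
      have h1 := hbound k (by omega)
      rw [Function.iterate_succ_apply', Function.iterate_succ_apply']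
      refine (hlip _ ?_ _ ?_).trans ?_
      · rw [Metric.mem_closedBall]
        have := dist_triangle ((fun w => p.eval w)^[k] z) ((fun w => p.eval w)^[k] c) 0
        linarith
      · exact Metric.closedBall_subset_closedBall (by linarith) hcK
      · rw [pow_succ]
        nlinarith
  exact (key k hk).trans (hbound k hk)

open MeasureTheory ENNReal in
theorem exists_isDynCoverOf_filledJulia {p : ℂ[X]} {d : ℕ} (hd : 2 ≤ d) (hdeg : p.natDegree = d)
    {ε : ℝ} (hε : 0 < ε) :
    ∃ C : ℝ≥0∞, C ≠ ⊤ ∧ ∀ n : ℕ, ∃ S : Finset ℂ,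
      IsDynCoverOf (fun w => p.eval w) (filledJulia p) {q : ℂ × ℂ | dist q.1 q.2 < ε} n S ∧
      (S.card : ℝ≥0∞) ≤ C * ((n + 1) ^ 2 * d ^ n) := by
  classical
  set F : ℂ → ℂ := fun w => p.eval w with hF
  set K := filledJulia p with hKdef
  have hmaps : MapsTo F K K := mapsTo_filledJulia p
  obtain ⟨R, hR0, hKR⟩ : ∃ R : ℝ, 0 < R ∧ K ⊆ Metric.closedBall 0 R := by
    obtain ⟨R, hR⟩ := (isCompact_filledJulia p (hdeg ▸ hd)).isBounded.subset_closedBall 0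
    exact ⟨max R 1, by positivity, hR.trans (Metric.closedBall_subset_closedBall (le_max_left _ _))⟩
  obtain ⟨l, hl⟩ := exists_dist_iterate_le hKR hmaps
  set Q : ℂ[X] := X ^ 3 - X with hQdef
  have hQ1 : 1 ≤ Q.natDegree := by
    have : Q.natDegree = 3 := by rw [hQdef]; compute_degree!
    omega
  set A : ℝ := min 1 (ε / 2) with hA
  have hA0 : 0 < A := by positivity
  have hA1 : A ≤ 1 := min_le_left _ _
  have hAε : A < ε := (min_le_right _ _).trans_lt (half_lt_self hε)
  obtain ⟨B, hB⟩ := (isCompact_closedBall (0 : ℂ) (R + 1)).exists_bound_of_continuousOn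
    Q.continuous.continuousOn
  have hB' : ∀ w : ℂ, ‖w‖ ≤ R + 1 → ‖Q.eval w‖ ≤ |B| := fun w hw =>
    (hB w (by simpa using hw)).trans (le_abs_self B)
  set η : ℝ := A ^ 2 / (2 * (|B| + 1)) with hη
  have hη0 : 0 < η := by positivity
  have hηB : 2 * η * |B| ≤ A ^ 2 := by
    rw [hη]
    have : 2 * (A ^ 2 / (2 * (|B| + 1))) * |B| = A ^ 2 * (|B| / (|B| + 1)) := by field_simp
    rw [this]
    refine mul_le_of_le_one_right (by positivity) ?_
    rw [div_le_one (by positivity)]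
    linarith
  set η' : ℝ≥0∞ := ENNReal.ofReal η with hη'
  have hη'0 : η' ≠ 0 := (ENNReal.ofReal_pos.2 hη0).ne'
  have hη't : η' ≠ ⊤ := ENNReal.ofReal_ne_top
  set V : ℝ≥0∞ := (∫⁻ w, ‖Q.eval w‖ₑ⁻¹) + Q.natDegree * η' with hV
  have hVt : V ≠ ⊤ := ENNReal.add_ne_top.2 ⟨lintegral_enorm_X_cube_sub_X_inv_lt_top.ne,
    ENNReal.mul_ne_top (by simp) hη't⟩
  obtain ⟨m, hm⟩ := pow_unbounded_of_one_lt ((R + 1) / A) (one_lt_two)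
  refine ⟨((l + m + 1 : ℕ) * 289 * (V + η')) / η', ENNReal.div_ne_top
    (ENNReal.mul_ne_top (ENNReal.mul_ne_top (by simp) (by simp)) (ENNReal.add_ne_top.2 ⟨hVt, hη't⟩))
    hη'0, fun n => ?_⟩
  obtain ⟨ν, hν1, hν0, hν⟩ := exists_measure_iterates (by omega) hdeg Q hQ1 η' n
  rw [← hV] at hν1
  have hνt : ν univ ≠ ⊤ := (hν1.trans_lt (ENNReal.add_lt_top.2 ⟨ENNReal.mul_lt_top
    (ENNReal.mul_lt_top (by simp) (by simp)) hVt.lt_top, hη't.lt_top⟩)).ne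
  set J := l * n + m with hJ
  set r : ℕ → ℝ := fun j => (R + 1) / 2 ^ j with hr
  have hrpos : ∀ j, 0 < r j := fun j => by positivity
  have hrs : ∀ j, r j / 4 = r (j + 1) / 2 := fun j => by
    simp only [hr, pow_succ]; field_simp; norm_num
  set E : ℕ → Set ℂ := fun j => {z | z ∈ K ∧ η' ≤ ν (Metric.ball z (r j)) ∧
    (j < J → ¬ η' ≤ ν (Metric.ball z (r (j + 1))))} with hE
  choose S hSE hScov hScard using fun j => exists_finset_cover_of_le_measure_ball ν hνt (E j)
    (hrpos j) hη'0 (fun z hz => hz.2.1)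
  have hgood : ∀ c ∈ K, ∀ ρ > 0, ¬ η' ≤ ν (Metric.ball c ρ) → ∀ k < n, ∀ w, dist w c < ρ / 2 →
      dist (F^[k] w) (F^[k] c) ≤ A := by
    intro c hc ρ hρ hbad k hk w hw
    have hcK := hKR (hmaps.iterate k hc)
    rw [mem_closedBall_zero_iff] at hcK
    rw [dist_eq_norm, hF, ← eval_iterate_comp_X, ← eval_iterate_comp_X]
    refine norm_eval_sub_le_of_setLIntegral_le _ Q hρ hA0 hA1 hη0.le hB' hηB ?_ ?_
      (((hν k hk).1 _ measurableSet_ball).trans (not_le.1 hbad).le) hw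
    · rw [eval_iterate_comp_X]
      linarith
    · intro x hx h0
      exact hbad (((hν k hk).2 x h0).trans (measure_mono (singleton_subset_iff.2 hx)))
  refine ⟨(Finset.range (J + 1)).biUnion S, ?_, ?_⟩
  · intro z hz
    have hzE : ∃ j ≤ J, z ∈ E j := by
      have h0 : η' ≤ ν (Metric.ball z (r 0)) := by
        refine hν0.trans (measure_mono (singleton_subset_iff.2 ?_))
        have := Metric.mem_closedBall.1 (hKR hz)
        rw [Metric.mem_ball, dist_comm]
        simp only [hr, pow_zero, div_one]
        linarith
      by_cases hall : ∀ j ≤ J, η' ≤ ν (Metric.ball z (r j))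
      · exact ⟨J, le_rfl, hz, hall J le_rfl, fun h => absurd h (lt_irrefl _)⟩
      · push Not at hall
        have hex : ∃ j, ν (Metric.ball z (r j)) < η' := let ⟨j, _, h⟩ := hall; ⟨j, h⟩
        obtain ⟨i, hi⟩ : ∃ i, Nat.find hex = i + 1 := Nat.exists_eq_succ_of_ne_zero fun h => by
          have := Nat.find_spec hex
          rw [h] at this
          exact absurd h0 (not_le.2 this)
        obtain ⟨j, hjJ, hj⟩ := hall
        have h1 : i + 1 ≤ j := hi ▸ Nat.find_min' hex hj
        refine ⟨i, by omega, hz, not_lt.1 (Nat.find_min hex (by omega)), fun _ => not_le.2 ?_⟩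
        rw [← hi]
        exact Nat.find_spec hex
    obtain ⟨j, hjJ, hzj⟩ := hzE
    obtain ⟨c, hcS, hzc⟩ := hScov j z hzj
    have hcE := hSE j c hcS
    refine ⟨c, Finset.mem_coe.2 (Finset.mem_biUnion.2 ⟨j, Finset.mem_range.2 (by omega), hcS⟩), ?_⟩
    refine mem_dynEntourage.2 fun k hk => lt_of_le_of_lt ?_ hAε
    rcases hjJ.lt_or_eq with hlt | rfl
    · exact hgood c hcE.1 _ (hrpos _) (hcE.2.2 hlt) k hk z (hrs j ▸ hzc)
    · refine hl A hA1 n c hcE.1 z ?_ k hk.le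
      have hRm : (R + 1) / 2 ^ m ≤ A := by
        rw [div_lt_iff₀ hA0] at hm
        rw [div_le_iff₀ (by positivity)]
        linarith
      calc dist z c * (2 ^ l) ^ n ≤ r J * (2 ^ l) ^ n := by
            gcongr
            linarith [hrpos J]
        _ = (R + 1) / 2 ^ m := by
            simp only [hr, hJ]
            rw [← pow_mul, pow_add]
            field_simp
        _ ≤ A := hRm
  · have hcard : (((Finset.range (J + 1)).biUnion S).card : ℝ≥0∞) * η' ≤
        (J + 1 : ℕ) * (289 * ν univ) := by
      calc _ ≤ ((∑ j ∈ Finset.range (J + 1), (S j).card : ℕ) : ℝ≥0∞) * η' := by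
            gcongr
            exact Finset.card_biUnion_le
        _ = ∑ j ∈ Finset.range (J + 1), ((S j).card : ℝ≥0∞) * η' := by
            rw [Nat.cast_sum, Finset.sum_mul]
        _ ≤ ∑ j ∈ Finset.range (J + 1), 289 * ν univ := Finset.sum_le_sum fun j _ => hScard j
        _ = _ := by rw [Finset.sum_const, Finset.card_range, nsmul_eq_mul]
    have h1 : ((J + 1 : ℕ) : ℝ≥0∞) ≤ (l + m + 1 : ℕ) * (n + 1) := by
      have : J + 1 ≤ (l + m + 1) * (n + 1) := by rw [hJ]; nlinarith
      exact_mod_cast this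
    have h2 : ν univ ≤ (V + η') * ((n + 1) * d ^ n) := by
      refine hν1.trans ?_
      rw [add_mul]
      refine add_le_add ?_ ?_
      · rw [mul_comm]
        gcongr
        exact le_self_add
      · refine le_mul_of_one_le_right' ?_
        have : 1 ≤ (n + 1) * d ^ n := Nat.one_le_iff_ne_zero.2 (by positivity)
        exact_mod_cast this
    rw [div_eq_mul_inv, mul_right_comm, ← div_eq_mul_inv, ENNReal.le_div_iff_mul_le (.inl hη'0)
      (.inl hη't)]
    refine hcard.trans ?_
    calc _ ≤ ((l + m + 1 : ℕ) * (n + 1) : ℝ≥0∞) * (289 * ((V + η') * ((n + 1) * d ^ n))) := by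
          gcongr
      _ = _ := by ring

theorem exists_sq_mul_pow_le {a b : ℝ} (ha : 0 < a) (hab : a < b) :
    ∃ C > 0, ∀ n : ℕ, ((n : ℝ) + 1) ^ 2 * a ^ n ≤ C * b ^ n := by
  have hq : 1 < b / a := (one_lt_div ha).2 hab
  obtain ⟨C, hC⟩ := (tendsto_pow_const_div_const_pow_of_one_lt 2 hq).bddAbove_range
  have hq0 : 0 < b / a := by positivity
  refine ⟨max C 1 * (b / a), by positivity, fun n => ?_⟩
  have h := hC ⟨n + 1, rfl⟩
  simp only [Nat.cast_add, Nat.cast_one] at h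
  rw [div_le_iff₀ (by positivity), pow_succ (b / a)] at h
  have h' : ((n : ℝ) + 1) ^ 2 ≤ max C 1 * ((b / a) ^ n * (b / a)) :=
    h.trans (by gcongr; exact le_max_left _ _)
  calc _ ≤ max C 1 * ((b / a) ^ n * (b / a)) * a ^ n := by gcongr
    _ = _ := by rw [div_pow]; field_simp

theorem coverEntropy_filledJulia_le {p : ℂ[X]} {d : ℕ} (hd : 2 ≤ d) (hdeg : p.natDegree = d) :
    coverEntropy (fun w => p.eval w) (filledJulia p) ≤ (Real.log d : EReal) := by
  have hd0 : (0 : ℝ) < d := by positivity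
  rw [coverEntropy_eq_iSup_basis Metric.uniformity_basis_dist]
  refine iSup₂_le fun ε hε => ?_
  obtain ⟨C, hC, hcov⟩ := exists_isDynCoverOf_filledJulia hd hdeg hε
  have hb : ∀ b : ℝ, d < b → coverEntropyEntourage (fun w => p.eval w) (filledJulia p)
      {q : ℂ × ℂ | dist q.1 q.2 < ε} ≤ (Real.log b : EReal) := by
    intro b hdb
    obtain ⟨C₁, hC₁, h⟩ := exists_sq_mul_pow_le hd0 hdb
    refine expGrowthSup_le_log_of_le (c := (C.toReal + 1) * C₁) (hd0.trans hdb)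
      (by have := C.toReal_nonneg; positivity) fun n => ?_
    obtain ⟨S, hS, hcard⟩ := hcov n
    have h1 : ((coverMincard (fun w => p.eval w) (filledJulia p) {q : ℂ × ℂ | dist q.1 q.2 < ε} n :
        ℕ∞) : ENNReal) ≤ (S.card : ENNReal) := by
      exact_mod_cast ENat.toENNReal_le.2 hS.coverMincard_le_card
    refine h1.trans (hcard.trans ?_)
    have h2 : ((n + 1) ^ 2 * d ^ n : ENNReal) = ENNReal.ofReal (((n : ℝ) + 1) ^ 2 * d ^ n) := by
      rw [show ((n : ℝ) + 1) ^ 2 * d ^ n = (((n + 1) ^ 2 * d ^ n : ℕ) : ℝ) by push_cast; rfl,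
        ENNReal.ofReal_natCast]
      push_cast; rfl
    rw [h2]
    nth_rw 1 [← ENNReal.ofReal_toReal hC]
    rw [← ENNReal.ofReal_mul C.toReal_nonneg]
    refine ENNReal.ofReal_le_ofReal ?_
    rw [mul_assoc]
    exact mul_le_mul (le_add_of_nonneg_right zero_le_one) (h n) (by positivity)
      (add_nonneg C.toReal_nonneg zero_le_one)
  refine ge_of_tendsto (x := 𝓝[>] (d : ℝ)) (f := fun b => (Real.log b : EReal)) ?_ ?_
  · exact (continuous_coe_real_ereal.tendsto _).comp
      ((Real.continuousAt_log hd0.ne').tendsto.mono_left nhdsWithin_le_nhds)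
  · filter_upwards [self_mem_nhdsWithin] with b hdb using hb b hdb

end

/-- Straightening and entropy of polynomial-like maps: if `f` is conjugate on `U` via a
homeomorphism `φ` of `ℂ` to a polynomial `P` of degree `d ≥ 2`, and the filled Julia set
`K(P)` is contained in `φ(U)`, then `A := φ⁻¹(K(P))` is a nonempty compact subset of `U`
invariant under `f`, and the Bowen topological entropy of `f` on `A` is `log d`. -/
theorem entropy_of_polynomial_like (p : Polynomial ℂ) (d : ℕ) (hd : 2 ≤ d)
    (hdeg : p.natDegree = d) (U : Set ℂ) (hU : IsOpen U) (f : ℂ → ℂ) (φ : ℂ ≃ₜ ℂ)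
    (hconj : ∀ z ∈ U, φ (f z) = p.eval (φ z))
    (hKP : filledJulia p ⊆ φ '' U) :
    (φ ⁻¹' filledJulia p).Nonempty ∧ IsCompact (φ ⁻¹' filledJulia p) ∧
      φ ⁻¹' filledJulia p ⊆ U ∧ Set.MapsTo f (φ ⁻¹' filledJulia p) (φ ⁻¹' filledJulia p) ∧
      coverEntropy f (φ ⁻¹' filledJulia p) = Real.log d := by
  have hsub : φ ⁻¹' filledJulia p ⊆ U := fun z hz => by
    obtain ⟨u, hu, h⟩ := hKP hz
    exact φ.injective h ▸ hu
  have hcompact := isCompact_filledJulia p (hdeg ▸ hd)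
  refine ⟨?_, φ.isCompact_preimage.2 hcompact, hsub, fun z hz => ?_, ?_⟩
  · obtain ⟨x, hx, -⟩ := exists_fixed_point_not_critical p (hdeg ▸ hd)
    exact ⟨φ.symm x, by simpa using fixed_point_mem_filledJulia p hx⟩
  · rw [Set.mem_preimage, hconj z (hsub hz)]
    exact mapsTo_filledJulia p hz
  · rw [coverEntropy_preimage_homeomorph φ hcompact (mapsTo_filledJulia p)
      fun z hz => hconj z (hsub hz)]
    exact le_antisymm (coverEntropy_filledJulia_le hd hdeg) (coverEntropy_filledJulia_ge p hd hdeg)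
end

section
/- Let f : ℂ → ℂ be an entire transcendental function, i.e. f is differentiable on all of ℂ and f is not a polynomial. Then the topological entropy of f is infinite: for every real number C there exists a nonempty compact set K ⊆ ℂ with f(K) ⊆ K such that h(f, K) ≥ C. Equivalently, the supremum of h(f, K) over all nonempty compact sets K ⊆ ℂ with f(K) ⊆ K equals +∞. -/
open Dynamics

open Set Metric Filter Topology

/-- Pulling back a point through a map that, over every point of `U \ P`, has either one preimage in
`B` or `N` preimages at mutual distance at least `ε`, yields large dynamically separated sets. -/
lemma exists_separated_preimages_s13 {X : Type*} [PseudoMetricSpace X] {f : X → X} {U P B : Set X}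
    {ε : ℝ} {N : ℕ}
    (step : ∀ w ∈ U, w ∉ P → (∃ y ∈ U, y ∉ P ∧ y ∈ B ∧ f y = w) ∨
      ∃ T : Finset X, N ≤ T.card ∧ (∀ y ∈ T, y ∈ U ∧ y ∉ P ∧ f y = w) ∧
        ∀ y ∈ T, ∀ y' ∈ T, y ≠ y' → ε ≤ dist y y') (n : ℕ) :
    ∀ w ∈ U, w ∉ P → ∃ S : Finset X, (∀ z ∈ S, f^[n] z = w ∧ ∀ k ≤ n, f^[k] z ∈ U) ∧
      (∀ z ∈ S, ∀ z' ∈ S, z ≠ z' → ∃ k < n, ε ≤ dist (f^[k] z) (f^[k] z')) ∧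
      N ^ n ≤ ∑ z ∈ S, N ^ {k | k < n ∧ f^[k] z ∈ B}.ncard := by
  classical
  induction n with
  | zero =>
    intro w hw _
    refine ⟨{w}, ?_, ?_, ?_⟩ <;> simp [hw]
  | succ n ih =>
    have fin : ∀ (n : ℕ) (z : X), {k | k < n ∧ f^[k] z ∈ B}.Finite := fun n z =>
      (Set.finite_lt_nat n).subset fun k hk => hk.1
    have ext : ∀ {z w y : X}, f y = w → y ∈ U → w ∈ U →
        (f^[n] z = y ∧ ∀ k ≤ n, f^[k] z ∈ U) →
        f^[n + 1] z = w ∧ ∀ k ≤ n + 1, f^[k] z ∈ U := by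
      rintro z w y rfl hy hw ⟨hz, hk⟩
      have h1 : f^[n + 1] z = f y := by rw [Function.iterate_succ_apply', hz]
      refine ⟨h1, fun k hk' => ?_⟩
      rcases Nat.lt_or_ge n k with h | h
      · obtain rfl : k = n + 1 := by omega
        rwa [h1]
      · exact hk k h
    intro w hw hwP
    rcases step w hw hwP with ⟨y, hyU, hyP, hyB, hy⟩ | ⟨T, hT, hTU, hTd⟩
    · obtain ⟨S, hS, hsep, hcard⟩ := ih y hyU hyP
      refine ⟨S, fun z hz => ext hy hyU hw (hS z hz), fun z hz z' hz' hne => ?_, ?_⟩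
      · obtain ⟨k, hk, h⟩ := hsep z hz z' hz' hne
        exact ⟨k, by omega, h⟩
      · rw [pow_succ]
        calc N ^ n * N ≤ (∑ z ∈ S, N ^ {k | k < n ∧ f^[k] z ∈ B}.ncard) * N := by gcongr
          _ = ∑ z ∈ S, N ^ {k | k < n + 1 ∧ f^[k] z ∈ B}.ncard := by
            rw [Finset.sum_mul]
            refine Finset.sum_congr rfl fun z hz => ?_
            have : {k | k < n + 1 ∧ f^[k] z ∈ B} = insert n {k | k < n ∧ f^[k] z ∈ B} := by
              ext k
              simp only [Set.mem_ofPred_eq, Set.mem_insert_iff]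
              constructor
              · rintro ⟨h1, h2⟩
                by_cases h : k = n
                · exact Or.inl h
                · exact Or.inr ⟨by omega, h2⟩
              · rintro (rfl | ⟨h1, h2⟩)
                · exact ⟨by omega, by rw [(hS z hz).1]; exact hyB⟩
                · exact ⟨by omega, h2⟩
            rw [this, Set.ncard_insert_of_notMem (by simp) (fin n z), pow_succ]
    · choose! S hS using fun y (hy : y ∈ T) => ih y (hTU y hy).1 (hTU y hy).2.1
      have hlast : ∀ y ∈ T, ∀ z ∈ S y, f^[n] z = y := fun y hy z hz => ((hS y hy).1 z hz).1
      refine ⟨T.biUnion S, fun z hz => ?_, fun z hz z' hz' hne => ?_, ?_⟩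
      · obtain ⟨y, hy, hz⟩ := Finset.mem_biUnion.1 hz
        exact ext (hTU y hy).2.2 (hTU y hy).1 hw ((hS y hy).1 z hz)
      · obtain ⟨y, hy, hz⟩ := Finset.mem_biUnion.1 hz
        obtain ⟨y', hy', hz'⟩ := Finset.mem_biUnion.1 hz'
        by_cases hyy : y = y'
        · subst hyy
          obtain ⟨k, hk, h⟩ := (hS y hy).2.1 z hz z' hz' hne
          exact ⟨k, by omega, h⟩
        · refine ⟨n, by omega, ?_⟩
          rw [hlast y hy z hz, hlast y' hy' z' hz']
          exact hTd y hy y' hy' hyy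
      · rcases Nat.eq_zero_or_pos N with rfl | hN
        · simp
        rw [Finset.sum_biUnion]
        · calc N ^ (n + 1) = N * N ^ n := by ring
            _ ≤ T.card * N ^ n := by gcongr
            _ = ∑ y ∈ T, N ^ n := by simp
            _ ≤ ∑ y ∈ T, ∑ z ∈ S y, N ^ {k | k < n ∧ f^[k] z ∈ B}.ncard :=
              Finset.sum_le_sum fun y hy => (hS y hy).2.2
            _ ≤ _ := by
              refine Finset.sum_le_sum fun y hy => Finset.sum_le_sum fun z hz => ?_
              refine Nat.pow_le_pow_right hN (Set.ncard_le_ncard ?_ (fin _ _))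
              exact fun k hk => ⟨by have := hk.1; omega, hk.2⟩
        · intro y hy y' hy' hne
          refine Finset.disjoint_left.2 fun z hz hz' => hne ?_
          rw [← hlast y hy z hz, ← hlast y' hy' z hz']

lemma le_of_forall_pow_le_mul_pow {a b C : ℕ} (h : ∀ J : ℕ, a ^ J ≤ b ^ J * C) : a ≤ b := by
  by_contra! hab
  rcases Nat.eq_zero_or_pos b with rfl | hb
  · have := h 1
    simp at this
    omega
  have hb' : (0 : ℝ) < b := by exact_mod_cast hb
  have h1 : (1 : ℝ) < a / b := by
    rw [one_lt_div hb']
    exact_mod_cast hab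
  obtain ⟨J, hJ⟩ := pow_unbounded_of_one_lt (C : ℝ) h1
  rw [div_pow, lt_div_iff₀ (by positivity)] at hJ
  have := h J
  have h2 : (a : ℝ) ^ J ≤ b ^ J * C := by exact_mod_cast this
  linarith

/-- Exponentially many separated orbit segments of every length inside a compact set `X` force
entropy on the set of points whose whole orbit stays in `X`. -/
lemma le_coverEntropy_of_separated {f : ℂ → ℂ} (hf : Continuous f) {X : Set ℂ} (hX : IsCompact X)
    {c : ℕ} (hc : 1 ≤ c) {ε : ℝ} (hε : 0 < ε)
    (hS : ∀ n : ℕ, ∃ S : Finset ℂ, (∀ z ∈ S, ∀ k ≤ n, f^[k] z ∈ X) ∧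
      (∀ z ∈ S, ∀ z' ∈ S, z ≠ z' → ∃ k < n, ε ≤ dist (f^[k] z) (f^[k] z')) ∧
      c ^ n ≤ S.card ^ 2) :
    ∃ K : Set ℂ, K.Nonempty ∧ IsCompact K ∧ MapsTo f K K ∧
      ((Real.log c / 2 : ℝ) : EReal) ≤ coverEntropy f K := by
  set Y : ℕ → Set ℂ := fun n => {z | ∀ k ≤ n, f^[k] z ∈ X} with hY
  have hYanti : ∀ m n, m ≤ n → Y n ⊆ Y m := fun m n h z hz k hk => hz k (hk.trans h)
  have hYclosed : ∀ n, IsClosed (Y n) := by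
    intro n
    have : Y n = ⋂ k ≤ n, f^[k] ⁻¹' X := by ext; simp [hY]
    rw [this]
    exact isClosed_biInter fun k _ => hX.isClosed.preimage (hf.iterate k)
  have hYcomp : ∀ n, IsCompact (Y n) := fun n =>
    hX.of_isClosed_subset (hYclosed n) fun z hz => hz 0 (Nat.zero_le _)
  have hYne : ∀ n, (Y n).Nonempty := by
    intro n
    obtain ⟨S, h1, -, h3⟩ := hS n
    have : S.Nonempty := by
      rw [← Finset.card_pos]
      by_contra h
      have h0 : S.card = 0 := by omega
      rw [h0] at h3
      have : 0 < c ^ n := by positivity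
      omega
    obtain ⟨z, hz⟩ := this
    exact ⟨z, h1 z hz⟩
  set K : Set ℂ := ⋂ n, Y n with hK
  have hdir : Directed (· ⊇ ·) Y := (antitone_nat_of_succ_le fun n => hYanti n (n+1) (by omega)).directed_ge
  have hKne : K.Nonempty :=
    IsCompact.nonempty_iInter_of_directed_nonempty_isCompact_isClosed Y hdir hYne hYcomp hYclosed
  have hKclosed : IsClosed K := isClosed_iInter hYclosed
  have hKcomp : IsCompact K := (hYcomp 0).of_isClosed_subset hKclosed (iInter_subset _ 0)
  have hKmaps : MapsTo f K K := by
    intro z hz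
    refine mem_iInter.2 fun n k hk => ?_
    rw [← Function.iterate_succ_apply]
    exact mem_iInter.1 hz (k + 1) (k + 1) le_rfl
  refine ⟨K, hKne, hKcomp, hKmaps, ?_⟩
  set V : SetRel ℂ ℂ := {p | dist p.1 p.2 < ε / 2} with hV
  have hVu : V ∈ uniformity ℂ := Metric.dist_mem_uniformity (half_pos hε)
  refine le_trans ?_ (coverEntropyEntourage_le_coverEntropy f K hVu)
  have ball_open : ∀ (m : ℕ) (x : ℂ), IsOpen {y | ∀ k < m, dist (f^[k] y) (f^[k] x) < ε / 2} := by
    intro m x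
    have : {y | ∀ k < m, dist (f^[k] y) (f^[k] x) < ε / 2} =
        ⋂ k ∈ Finset.range m, {y | dist (f^[k] y) (f^[k] x) < ε / 2} := by ext; simp
    rw [this]
    refine isOpen_biInter_finset fun k _ => isOpen_lt ?_ continuous_const
    exact (hf.iterate k).dist continuous_const
  have key : ∀ (m : ℕ) (t : Finset ℂ), IsDynCoverOf f K V m t → c ^ m ≤ t.card ^ 2 := by
    intro m t ht
    set O : Set ℂ := ⋃ x ∈ t, {y | ∀ k < m, dist (f^[k] y) (f^[k] x) < ε / 2} with hO
    have hOo : IsOpen O := isOpen_biUnion fun x _ => ball_open m x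
    have hKO : K ⊆ O := by
      intro z hz
      obtain ⟨x, hx, h⟩ := ht hz
      exact mem_biUnion hx fun k hk => by simpa [hV] using (mem_dynEntourage.1 h) k hk
    obtain ⟨q, hq⟩ := exists_subset_nhds_of_isCompact hdir hYcomp
      (fun x hx => hOo.mem_nhds (hKO hx))
    obtain ⟨t', -, ht'⟩ := hX.elim_nhds_subcover
      (fun x => {y | ∀ k < q, dist (f^[k] y) (f^[k] x) < ε / 2})
      (fun x _ => (ball_open q x).mem_nhds fun k _ => by simpa using half_pos hε)
    have hle : ∀ J : ℕ, (c ^ m) ^ J ≤ (t.card ^ 2) ^ J * t'.card ^ 2 := by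
      intro J
      obtain ⟨S, h1, h2, h3⟩ := hS (J * m + q)
      have e1 : ∀ z ∈ S, ∀ j : Fin J, ∃ x : t, ∀ k < m,
          dist (f^[k] (f^[j * m] z)) (f^[k] x) < ε / 2 := by
        intro z hz j
        have : f^[j * m] z ∈ O := hq fun k hk => by
          rw [← Function.iterate_add_apply]
          refine h1 z hz _ ?_
          have : (j : ℕ) * m ≤ J * m := Nat.mul_le_mul_right _ j.2.le
          omega
        obtain ⟨x, hx, h⟩ := mem_iUnion₂.1 this
        exact ⟨⟨x, hx⟩, h⟩
      have e2 : ∀ z ∈ S, ∃ x : t', ∀ k < q, dist (f^[k] (f^[J * m] z)) (f^[k] x) < ε / 2 := by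
        intro z hz
        obtain ⟨x, hx, h⟩ := mem_iUnion₂.1 (ht' (h1 z hz (J * m) (by omega)))
        exact ⟨⟨x, hx⟩, h⟩
      choose a ha using fun z : S => e1 z z.2
      choose b hb using fun z : S => e2 z z.2
      have hinj : Function.Injective fun z : S => (a z, b z) := by
        intro z z' hzz
        simp only [Prod.mk.injEq] at hzz
        by_contra hne
        obtain ⟨k, hk, hd⟩ := h2 z z.2 z' z'.2 (fun h => hne (Subtype.ext h))
        have tri : ∀ x u v : ℂ, dist u x < ε / 2 → dist v x < ε / 2 → dist u v < ε := by
          intro x u v h h'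
          linarith [dist_triangle_right u v x]
        refine absurd hd (not_le.2 ?_)
        rcases Nat.lt_or_ge k (J * m) with h | h
        · have hm : 0 < m := Nat.pos_of_ne_zero (by rintro rfl; simp at h)
          have hj : k / m < J := Nat.div_lt_of_lt_mul (by rwa [mul_comm])
          have A := ha z ⟨k / m, hj⟩ (k % m) (Nat.mod_lt _ hm)
          have A' := ha z' ⟨k / m, hj⟩ (k % m) (Nat.mod_lt _ hm)
          rw [← hzz.1] at A'
          simp only [← Function.iterate_add_apply, mul_comm _ m, Nat.mod_add_div] at A A'
          exact tri _ _ _ A A'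
        · have B := hb z (k - J * m) (by omega)
          have B' := hb z' (k - J * m) (by omega)
          rw [← hzz.2] at B'
          simp only [← Function.iterate_add_apply, Nat.sub_add_cancel h] at B B'
          exact tri _ _ _ B B'
      have hcard := Fintype.card_le_of_injective _ hinj
      simp only [Fintype.card_coe, Fintype.card_prod, Fintype.card_pi, Finset.prod_const,
        Finset.card_univ, Fintype.card_fin] at hcard
      calc (c ^ m) ^ J = c ^ (J * m) := by rw [← pow_mul, mul_comm]
        _ ≤ c ^ (J * m + q) := Nat.pow_le_pow_right hc (by omega)
        _ ≤ S.card ^ 2 := h3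
        _ ≤ (t.card ^ J * t'.card) ^ 2 := Nat.pow_le_pow_left hcard 2
        _ = _ := by rw [mul_pow, ← pow_mul, ← pow_mul, mul_comm J 2]
    exact le_of_forall_pow_le_mul_pow hle
  refine _root_.Frequently.le_expGrowthSup (Filter.Frequently.of_forall fun m => ?_)
  have hc0 : (0 : ℝ) < c := by exact_mod_cast hc
  have hexp : EReal.exp (((Real.log c / 2 : ℝ) : EReal) * (m : EReal)) =
      ENNReal.ofReal (Real.exp (Real.log c / 2 * m)) := by
    rw [← EReal.exp_coe]
    push_cast
    rfl
  rw [hexp]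
  by_cases hfin : coverMincard f K V m = ⊤
  · simp [hfin]
  obtain ⟨t, ht, htc⟩ := (coverMincard_finite_iff f K V m).1 (lt_top_iff_ne_top.2 hfin)
  rw [← htc]
  have := key m t ht
  have h2 : (c : ℝ) ^ m ≤ (t.card : ℝ) ^ 2 := by exact_mod_cast this
  have h3 : Real.exp (Real.log c / 2 * m) ≤ t.card := by
    refine le_of_sq_le_sq ?_ (by positivity)
    refine le_trans (le_of_eq ?_) h2
    rw [← Real.exp_nat_mul]
    conv_rhs => rw [← Real.exp_log hc0, ← Real.exp_nat_mul]
    congr 1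
    push_cast
    ring
  refine le_trans (ENNReal.ofReal_le_ofReal h3) ?_
  simp

/-- A Bloch-type theorem: the image of a unit disc contains a disc of radius proportional to the
derivative at the centre. -/
lemma exists_ball_subset_image {h : ℂ → ℂ} {z : ℂ} (hh : DifferentiableOn ℂ h (ball z 1)) :
    ∃ w, ball w (‖deriv h z‖ / 96) ⊆ h '' ball z 1 := by
  rcases eq_or_ne (deriv h z) 0 with h0 | h0
  · exact ⟨0, by simp [h0]⟩
  have hd : DifferentiableOn ℂ (deriv h) (ball z 1) := hh.deriv isOpen_ball
  have hsub : closedBall z (1 / 2) ⊆ ball z 1 := closedBall_subset_ball (by norm_num)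
  obtain ⟨a, ha, hmax⟩ := (isCompact_closedBall z (1 / 2)).exists_isMaxOn
    ⟨z, mem_closedBall_self (by norm_num)⟩
    (f := fun ζ ↦ (1 / 2 - dist ζ z) * ‖deriv h ζ‖)
    (((continuous_const.sub (continuous_id.dist continuous_const)).continuousOn).mul
      (hd.continuousOn.mono hsub).norm)
  have hz : ‖deriv h z‖ / 2 ≤ (1 / 2 - dist a z) * ‖deriv h a‖ := by
    have := hmax (mem_closedBall_self (by norm_num : (0 : ℝ) ≤ 1 / 2))
    simp only [dist_self, mem_ofPred_eq] at this
    linarith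
  set A := ‖deriv h a‖ with hA
  have hpos : 0 < ‖deriv h z‖ := norm_pos_iff.2 h0
  have hA0 : 0 < A := by
    rcases (norm_nonneg (deriv h a)).eq_or_lt with h' | h'
    · rw [← hA] at h'
      rw [← h'] at hz; linarith
    · exact h'
  obtain ⟨t, ht⟩ : ∃ t, t = (1 / 2 - dist a z) / 2 := ⟨_, rfl⟩
  have ht0 : 0 < t := by
    by_contra! hc
    have : (1 / 2 - dist a z) * A ≤ 0 := mul_nonpos_of_nonpos_of_nonneg (by linarith) hA0.le
    linarith
  have hball : ball a t ⊆ closedBall z (1 / 2) := fun x hx ↦ by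
    rw [mem_ball] at hx
    rw [mem_closedBall]
    linarith [dist_triangle x a z]
  have hbd : ∀ x ∈ ball a t, ‖deriv h x‖ ≤ 2 * A := fun x hx ↦ by
    have h1 := hmax (hball hx)
    simp only [mem_ofPred_eq] at h1
    rw [mem_ball] at hx
    have h2 : t ≤ 1 / 2 - dist x z := by linarith [dist_triangle x a z]
    have h3 : t * ‖deriv h x‖ ≤ t * (2 * A) :=
      calc t * ‖deriv h x‖ ≤ (1 / 2 - dist x z) * ‖deriv h x‖ := by gcongr
        _ ≤ (1 / 2 - dist a z) * A := h1
        _ = t * (2 * A) := by rw [ht]; ring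
    exact le_of_mul_le_mul_left h3 ht0
  have hlip : ∀ x ∈ ball a t, ‖deriv h x - deriv h a‖ ≤ 3 * A / t * dist x a := fun x hx ↦ by
    rw [← dist_eq_norm]
    refine Complex.dist_le_div_mul_dist_of_mapsTo_ball (hd.mono (hball.trans hsub)) ?_ hx
    intro y hy
    rw [mem_closedBall, dist_eq_norm]
    linarith [norm_sub_le (deriv h y) (deriv h a), hbd y hy]
  have hcb : closedBall a (t / 6) ⊆ ball a t := closedBall_subset_ball (by linarith)
  have hda : ∀ x ∈ closedBall a (t / 6), HasDerivAt h (deriv h x) x := fun x hx ↦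
    (hh.differentiableAt (isOpen_ball.mem_nhds (hsub (hball (hcb hx))))).hasDerivAt
  have hsph : ∀ ζ ∈ sphere a (t / 6), A * t / 12 ≤ ‖h ζ - h a‖ := fun ζ hζ ↦ by
    have hζ' := sphere_subset_closedBall hζ
    have haa : a ∈ closedBall a (t / 6) := mem_closedBall_self (by linarith)
    have hder : ∀ x ∈ closedBall a (t / 6),
        HasDerivAt (fun x ↦ h x - deriv h a * x) (deriv h x - deriv h a) x := fun x hx ↦ by
      simpa using (hda x hx).fun_sub ((hasDerivAt_id x).const_mul (deriv h a))
    have := Convex.norm_image_sub_le_of_norm_deriv_le (C := A / 2)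
      (fun x hx ↦ (hder x hx).differentiableAt)
      (fun x hx ↦ by
        rw [(hder x hx).deriv]
        refine (hlip x (hcb hx)).trans ?_
        calc 3 * A / t * dist x a ≤ 3 * A / t * (t / 6) := by
              gcongr; exact hx
          _ = A / 2 := by field_simp; norm_num)
      (convex_closedBall a (t / 6)) haa hζ'
    rw [mem_sphere_iff_norm] at hζ
    have h2 : h ζ - deriv h a * ζ - (h a - deriv h a * a)
      = (h ζ - h a) - deriv h a * (ζ - a) := by ring
    rw [h2, hζ] at this
    have h3 := norm_sub_norm_le (deriv h a * (ζ - a)) (h ζ - h a)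
    rw [norm_mul, hζ, norm_sub_rev (deriv h a * (ζ - a))] at h3
    rw [← hA] at h3
    linarith
  refine ⟨h a, ?_⟩
  have hne : ∃ᶠ x in 𝓝 a, h x ≠ h a :=
    (((hda a (mem_closedBall_self (by linarith))).eventually_ne
      (norm_pos_iff.1 hA0)).frequently).filter_mono nhdsWithin_le_nhds
  have hmain := DiffContOnCl.ball_subset_image_closedBall (f := h) (z₀ := a) (r := t / 6)
    (DifferentiableOn.diffContOnCl (by
      rw [closure_ball a (by positivity)]
      exact hh.mono ((hcb.trans hball).trans hsub))) (by linarith) hsph hne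
  calc ball (h a) (‖deriv h z‖ / 96) ⊆ ball (h a) (A * t / 12 / 2) := by
        apply ball_subset_ball
        have : (1 / 2 - dist a z) * A = 2 * (A * t) := by rw [ht]; ring
        linarith
    _ ⊆ h '' closedBall a (t / 6) := hmain
    _ ⊆ h '' ball z 1 := image_mono ((hcb.trans hball).trans hsub)

/-- Every complex number is at distance less than `2` from a point where `cosh ^ 2` is an
integer. -/
lemma exists_cosh_sq_eq_intCast (w : ℂ) :
    ∃ p : ℂ, dist p w < 2 ∧ ∃ k : ℤ, Complex.cosh p ^ 2 = k := by
  wlog hre : 0 ≤ w.re generalizing w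
  · obtain ⟨p, hp, k, hk⟩ := this (-w) (by rw [Complex.neg_re]; linarith)
    refine ⟨-p, ?_, k, by rw [Complex.cosh_neg, hk]⟩
    rwa [dist_eq_norm, ← norm_neg, neg_sub, sub_neg_eq_add, add_comm, ← sub_neg_eq_add,
      ← dist_eq_norm]
  obtain ⟨a, ha1, k, hk⟩ : ∃ a : ℝ, |a - w.re| ≤ 1 ∧ ∃ k : ℤ, Real.cosh a ^ 2 = k := by
    rcases lt_or_ge w.re 1 with h1 | h1
    · exact ⟨0, by rw [abs_le]; constructor <;> linarith, 1, by simp⟩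
    · have hx : Real.cosh (w.re - 1) ^ 2 + 1 ≤ Real.cosh w.re ^ 2 := by
        have e1 : Real.cosh w.re ^ 2 - Real.cosh (w.re - 1) ^ 2
            = Real.sinh (2 * w.re - 1) * Real.sinh 1 := by
          have h2 : ∀ x y : ℝ, Real.cosh x ^ 2 - Real.cosh y ^ 2
              = Real.sinh (x + y) * Real.sinh (x - y) := fun x y ↦ by
            rw [Real.sinh_add, Real.sinh_sub]
            linear_combination (Real.cosh y ^ 2) * Real.cosh_sq x
              - (Real.cosh x ^ 2) * Real.cosh_sq y
          rw [h2]
          congr 2 <;> ring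
        have h4 : 1 ≤ Real.sinh 1 := Real.self_le_sinh_iff.2 zero_le_one
        have h5 : 1 ≤ Real.sinh (2 * w.re - 1) :=
          le_trans (by linarith) (Real.self_le_sinh_iff.2 (by linarith : 0 ≤ 2 * w.re - 1))
        nlinarith
      have hc : ContinuousOn (fun x ↦ Real.cosh x ^ 2) (Icc (w.re - 1) w.re) :=
        (Real.continuous_cosh.pow 2).continuousOn
      obtain ⟨a, ha, hak⟩ := intermediate_value_Icc (by linarith) hc
        (show ((⌊Real.cosh w.re ^ 2⌋ : ℤ) : ℝ) ∈ _ from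
          ⟨by linarith [Int.lt_floor_add_one (Real.cosh w.re ^ 2)], Int.floor_le _⟩)
      exact ⟨a, by rw [abs_le]; constructor <;> linarith [ha.1, ha.2], _, hak⟩
  set m : ℤ := round (w.im / Real.pi) with hm
  refine ⟨a + m * (Real.pi * Complex.I), ?_, k, ?_⟩
  · have hi : |Real.pi * m - w.im| ≤ 1.6 := by
      have h1 := abs_sub_round (w.im / Real.pi)
      have h2 : Real.pi * m - w.im = Real.pi * (-(w.im / Real.pi - m)) := by
        field_simp; ring
      rw [h2, abs_mul, abs_neg, abs_of_pos Real.pi_pos]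
      have := Real.pi_lt_d2
      nlinarith [abs_nonneg (w.im / Real.pi - m), Real.pi_pos]
    rw [dist_eq_norm, ← sq_lt_sq₀ (norm_nonneg _) (by norm_num), Complex.sq_norm,
      Complex.normSq_apply]
    simp
    have := sq_le_sq' (abs_le.1 ha1).1 (abs_le.1 ha1).2
    have := sq_le_sq' (abs_le.1 hi).1 (abs_le.1 hi).2
    nlinarith
  · have hs : Complex.cosh (a + m * (Real.pi * Complex.I)) ^ 2 = Complex.cosh a ^ 2 := by
      have h1 : ∀ z : ℂ, Complex.cosh z ^ 2 = (Complex.cosh (2 * z) + 1) / 2 := fun z ↦ by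
        rw [Complex.cosh_two_mul, Complex.cosh_sq]; ring
      rw [h1, h1]
      have h2 : 2 * (a + m * (Real.pi * Complex.I)) = 2 * a + m * (2 * Real.pi * Complex.I) := by
        ring
      rw [h2, ← Complex.cos_mul_I, ← Complex.cos_mul_I]
      have h3 : (2 * (a : ℂ) + m * (2 * Real.pi * Complex.I)) * Complex.I
          = 2 * a * Complex.I - m * (2 * Real.pi) := by
        linear_combination (m * (2 * Real.pi) : ℂ) * Complex.I_mul_I
      rw [h3, Complex.cos_sub_int_mul_two_pi]
    rw [hs]
    exact_mod_cast congrArg (fun x : ℝ ↦ (x : ℂ)) hk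

/-- A zero-free holomorphic function on a disc has a holomorphic logarithm. -/
lemma exists_exp_eq_on_ball {g : ℂ → ℂ} {c : ℂ} {r : ℝ} (hr : 0 < r)
    (hg : DifferentiableOn ℂ g (ball c r)) (h0 : ∀ z ∈ ball c r, g z ≠ 0) :
    ∃ l : ℂ → ℂ, DifferentiableOn ℂ l (ball c r) ∧ l c = Complex.log (g c) ∧
      ∀ z ∈ ball c r, Complex.exp (l z) = g z := by
  have hq : DifferentiableOn ℂ (fun z ↦ deriv g z / g z) (ball c r) :=
    (hg.deriv isOpen_ball).div hg h0
  obtain ⟨l, hlc, hl⟩ := hq.isExactOn_ball.with_val_at c (Complex.log (g c))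
  have hd : ∀ z ∈ ball c r, HasDerivAt g (deriv g z) z := fun z hz ↦
    (hg.differentiableAt (isOpen_ball.mem_nhds hz)).hasDerivAt
  have hc : c ∈ ball c r := mem_ball_self hr
  have hder : ∀ z ∈ ball c r, HasDerivAt (fun z ↦ g z * Complex.exp (-l z)) 0 z := fun z hz ↦ by
    refine ((hd z hz).fun_mul ((hl z hz).fun_neg.cexp)).congr_deriv ?_
    have h1 : g z * (deriv g z / g z) = deriv g z := mul_div_cancel₀ _ (h0 z hz)
    linear_combination -Complex.exp (-l z) * h1
  refine ⟨l, fun z hz ↦ (hl z hz).differentiableAt.differentiableWithinAt, hlc, fun z hz ↦ ?_⟩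
  have h1 := isOpen_ball.is_const_of_deriv_eq_zero (convex_ball c r).isPreconnected
    (fun z hz ↦ (hder z hz).differentiableAt.differentiableWithinAt)
    (fun z hz ↦ (hder z hz).deriv) hz hc
  simp only [hlc, Complex.exp_neg, Complex.exp_log (h0 c hc), mul_inv_cancel₀ (h0 c hc)] at h1
  rw [mul_inv_eq_one₀ (Complex.exp_ne_zero _)] at h1
  exact h1.symm

/-- Schottky's theorem. -/
lemma exists_schottky_bound (C₀ : ℝ) :
    ∃ C₁ : ℝ, ∀ (c : ℂ) (g : ℂ → ℂ), DifferentiableOn ℂ g (ball c 5) →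
      (∀ z ∈ ball c 5, g z ≠ 0 ∧ g z ≠ 1) → ‖g c‖ = C₀ → ∀ z ∈ ball c 4, ‖g z‖ ≤ C₁ := by
  set D : ℝ := 2 + |Real.log C₀| with hD
  have hD2 : 2 ≤ D := by simp [hD]
  set C : ℝ := Real.log (2 * D) + 768 with hC
  refine ⟨Real.exp (2 * Real.pi * (Real.exp C) ^ 2), fun c g hg h01 hgc z hz ↦ ?_⟩
  have hcm : c ∈ ball c 5 := mem_ball_self (by norm_num)
  have h5 : (0 : ℝ) < 5 := by norm_num
  have hpi : (2 * Real.pi * Complex.I : ℂ) ≠ 0 := Complex.two_pi_I_ne_zero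
  obtain ⟨l, hl, hlc, hle⟩ := exists_exp_eq_on_ball h5 hg fun z hz ↦ (h01 z hz).1
  set F : ℂ → ℂ := fun z ↦ l z / (2 * Real.pi * Complex.I) with hF
  have hFd : DifferentiableOn ℂ F (ball c 5) := hl.div_const _
  have hFg : ∀ z ∈ ball c 5, g z = Complex.exp (2 * Real.pi * Complex.I * F z) := fun z hz ↦ by
    rw [hF, ← hle z hz]
    simp only
    rw [mul_div_cancel₀ _ hpi]
  have hFint : ∀ z ∈ ball c 5, ∀ k : ℤ, F z ≠ k := fun z hz k hk ↦ by
    apply (h01 z hz).2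
    rw [hFg z hz, hk, mul_comm, Complex.exp_int_mul_two_pi_mul_I]
  have hlnorm : ‖l c‖ ≤ |Real.log C₀| + Real.pi := by
    rw [hlc]
    refine (Complex.norm_le_abs_re_add_abs_im _).trans ?_
    rw [Complex.log_re, hgc, Complex.log_im]
    gcongr
    exact Complex.abs_arg_le_pi _
  have hFc : ‖F c‖ ≤ D - 1 := by
    simp only [hF, norm_div, norm_mul, Complex.norm_I, mul_one, Complex.norm_real,
      Complex.norm_ofNat, Real.norm_eq_abs, abs_of_pos Real.pi_pos]
    rw [div_le_iff₀ (by positivity)]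
    have := Real.pi_gt_three
    nlinarith [abs_nonneg (Real.log C₀)]
  obtain ⟨l₁, hl₁, -, hle₁⟩ := exists_exp_eq_on_ball h5 hFd fun z hz ↦ by
    simpa using hFint z hz 0
  obtain ⟨l₂, hl₂, -, hle₂⟩ := exists_exp_eq_on_ball h5 (hFd.sub_const 1) fun z hz ↦ by
    have := hFint z hz 1
    rw [Int.cast_one] at this
    exact sub_ne_zero.2 this
  set u : ℂ → ℂ := fun z ↦ Complex.exp (l₁ z / 2) with hu
  set v : ℂ → ℂ := fun z ↦ Complex.exp (l₂ z / 2) with hv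
  have hu2 : ∀ z ∈ ball c 5, u z ^ 2 = F z := fun z hz ↦ by
    rw [← hle₁ z hz, hu, ← Complex.exp_nat_mul]
    congr 1; push_cast; ring
  have hv2 : ∀ z ∈ ball c 5, v z ^ 2 = F z - 1 := fun z hz ↦ by
    rw [← hle₂ z hz, hv, ← Complex.exp_nat_mul]
    congr 1; push_cast; ring
  have huv : ∀ z ∈ ball c 5, (u z - v z) * (u z + v z) = 1 := fun z hz ↦ by
    linear_combination hu2 z hz - hv2 z hz
  have hud : DifferentiableOn ℂ u (ball c 5) := (hl₁.div_const 2).cexp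
  have hvd : DifferentiableOn ℂ v (ball c 5) := (hl₂.div_const 2).cexp
  obtain ⟨h, hh, hhc, hhe⟩ := exists_exp_eq_on_ball h5 (hud.sub hvd) fun z hz ↦
    left_ne_zero_of_mul_eq_one (huv z hz)
  have hhe' : ∀ z ∈ ball c 5, Complex.exp (h z) = u z - v z := hhe
  have hcosh : ∀ z ∈ ball c 5, Complex.cosh (h z) ^ 2 = F z := fun z hz ↦ by
    rw [Complex.cosh, Complex.exp_neg, hhe' z hz, inv_eq_of_mul_eq_one_right (huv z hz),
      ← hu2 z hz]
    ring
  have hsq : ∀ x : ℝ, 0 ≤ x → x ^ 2 ≤ D → x ≤ D := fun x hx hxD ↦ by nlinarith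
  have huc : ‖u c‖ ≤ D := hsq _ (norm_nonneg _) (by
    rw [← norm_pow, hu2 c hcm]; linarith)
  have hvc : ‖v c‖ ≤ D := hsq _ (norm_nonneg _) (by
    rw [← norm_pow, hv2 c hcm]
    refine (norm_sub_le _ _).trans ?_
    rw [norm_one]; linarith)
  have hre : |(h c).re| ≤ Real.log (2 * D) := by
    have e1 : Real.exp (h c).re ≤ 2 * D := by
      rw [← Complex.norm_exp, hhe' c hcm]
      linarith [norm_sub_le (u c) (v c)]
    have e2 : Real.exp (-(h c).re) ≤ 2 * D := by
      rw [← Complex.neg_re, ← Complex.norm_exp, Complex.exp_neg, hhe' c hcm,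
        inv_eq_of_mul_eq_one_right (huv c hcm)]
      linarith [norm_add_le (u c) (v c)]
    rw [abs_le']
    exact ⟨(Real.le_log_iff_exp_le (by linarith)).2 e1,
      (Real.le_log_iff_exp_le (by linarith)).2 e2⟩
  have hder : ∀ z ∈ ball c 4, ‖deriv h z‖ ≤ 192 := fun z hz ↦ by
    by_contra! hlt
    have hsub : ball z 1 ⊆ ball c 5 := ball_subset_ball' (by
      rw [mem_ball] at hz; linarith)
    obtain ⟨w, hw⟩ := exists_ball_subset_image (hh.mono hsub)
    obtain ⟨p, hp, k, hk⟩ := exists_cosh_sq_eq_intCast w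
    obtain ⟨y, hy, rfl⟩ := hw (show p ∈ ball w _ by rw [mem_ball]; linarith)
    exact hFint y (hsub hy) k (by rw [← hcosh y (hsub hy), hk])
  have h45 : ball c 4 ⊆ ball c 5 := ball_subset_ball (by norm_num)
  have hdist : ‖h z - h c‖ ≤ 768 := by
    refine (Convex.norm_image_sub_le_of_norm_deriv_le
      (fun x hx ↦ hh.differentiableAt (isOpen_ball.mem_nhds (h45 hx))) hder (convex_ball c 4)
      (mem_ball_self (by norm_num)) hz).trans ?_
    rw [mem_ball_iff_norm] at hz
    linarith
  have hrez : |(h z).re| ≤ C := by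
    have := (Complex.abs_re_le_norm (h z - h c)).trans hdist
    rw [Complex.sub_re] at this
    have h3 := abs_add_le ((h z).re - (h c).re) (h c).re
    rw [sub_add_cancel] at h3
    linarith
  have hcz : ‖Complex.cosh (h z)‖ ≤ Real.exp C := by
    rw [Complex.cosh, norm_div, Complex.norm_ofNat, div_le_iff₀ two_pos]
    refine (norm_add_le _ _).trans ?_
    rw [Complex.norm_exp, Complex.norm_exp, Complex.neg_re]
    have := Real.exp_le_exp.2 (abs_le'.1 hrez).1
    have := Real.exp_le_exp.2 (abs_le'.1 hrez).2
    linarith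
  rw [hFg z (h45 hz), ← hcosh z (h45 hz)]
  refine (Complex.norm_exp_le_exp_norm _).trans ?_
  rw [norm_mul, norm_mul, norm_mul, Complex.norm_I, mul_one, Complex.norm_real,
      Complex.norm_ofNat, Real.norm_eq_abs, abs_of_pos Real.pi_pos, norm_pow]
  gcongr

/-- Division of an entire function by the full power of `z - a` it contains. -/
lemma exists_eq_pow_mul {g : ℂ → ℂ} (hg : Differentiable ℂ g) (hne : ∃ z, g z ≠ 0) (a : ℂ) :
    ∃ (n : ℕ) (G : ℂ → ℂ), Differentiable ℂ G ∧ G a ≠ 0 ∧ ∀ z, g z = (z - a) ^ n * G z := by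
  classical
  have hna : ¬ ∀ᶠ z in 𝓝 a, g z = 0 := fun h ↦ by
    obtain ⟨z, hz⟩ := hne
    have : g = fun _ ↦ 0 := AnalyticOnNhd.eq_of_frequently_eq (z₀ := a)
      (fun z _ ↦ hg.analyticAt z) (fun z _ ↦ analyticAt_const)
      ((h.filter_mono nhdsWithin_le_nhds).frequently)
    exact hz (congrFun this z)
  obtain ⟨n, k, hk, hka, hgk⟩ :=
    (hg.analyticAt a).exists_eventuallyEq_pow_smul_nonzero_iff.2 hna
  set G : ℂ → ℂ := Function.update (fun z ↦ g z / (z - a) ^ n) a (k a) with hG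
  have hGne : ∀ z, z ≠ a → G z = g z / (z - a) ^ n := fun z hz ↦ by
    rw [hG, Function.update_of_ne hz]
  have hGa : G a = k a := by rw [hG, Function.update_self]
  have hGk : G =ᶠ[𝓝 a] k := by
    filter_upwards [hgk] with z hz
    rcases eq_or_ne z a with rfl | hza
    · exact hGa
    · rw [hGne z hza, hz, smul_eq_mul, mul_div_cancel_left₀ _ (pow_ne_zero _ (sub_ne_zero.2 hza))]
  refine ⟨n, G, fun z ↦ ?_, by rwa [hGa], fun z ↦ ?_⟩
  · rcases eq_or_ne z a with rfl | hza
    · exact hk.differentiableAt.congr_of_eventuallyEq hGk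
    · have h1 : DifferentiableAt ℂ (fun z ↦ g z / (z - a) ^ n) z :=
        (hg z).div (by fun_prop) (pow_ne_zero _ (sub_ne_zero.2 hza))
      refine h1.congr_of_eventuallyEq ?_
      filter_upwards [isOpen_ne.mem_nhds hza] with y hy using hGne y hy
  · rcases eq_or_ne z a with rfl | hza
    · rw [hGa]; simpa using hgk.self_of_nhds
    · rw [hGne z hza, mul_div_cancel₀ _ (pow_ne_zero _ (sub_ne_zero.2 hza))]

/-- Division of an entire function by its zeros in a finite set. -/
lemma exists_eq_prod_mul {g : ℂ → ℂ} (hg : Differentiable ℂ g) (hne : ∃ z, g z ≠ 0)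
    (Z : Finset ℂ) :
    ∃ (s : Multiset ℂ) (G : ℂ → ℂ), (∀ a ∈ s, a ∈ Z) ∧ Differentiable ℂ G ∧ (∀ a ∈ Z, G a ≠ 0) ∧
      ∀ z, g z = (s.map (fun a ↦ z - a)).prod * G z := by
  classical
  induction Z using Finset.induction_on with
  | empty => exact ⟨0, g, by simp, hg, by simp, by simp⟩
  | insert a Z ha ih =>
    obtain ⟨s, G, hs, hG, hGZ, hgG⟩ := ih
    obtain ⟨n, H, hH, hHa, hGH⟩ := exists_eq_pow_mul hG (by
      obtain ⟨z, hz⟩ := hne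
      exact ⟨z, right_ne_zero_of_mul (hgG z ▸ hz)⟩) a
    refine ⟨s + Multiset.replicate n a, H, fun b hb ↦ ?_, hH, fun b hb ↦ ?_, fun z ↦ ?_⟩
    · rcases Multiset.mem_add.1 hb with hb | hb
      · exact Finset.mem_insert_of_mem (hs b hb)
      · rw [Multiset.eq_of_mem_replicate hb]; exact Finset.mem_insert_self _ _
    · rcases Finset.mem_insert.1 hb with rfl | hb
      · exact hHa
      · exact right_ne_zero_of_mul (hGH b ▸ hGZ b hb)
    · rw [hgG, hGH, Multiset.map_add, Multiset.prod_add, Multiset.map_replicate,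
        Multiset.prod_replicate, mul_assoc]

/-- The zeros of an entire function in a compact set are finite in number. -/
lemma finite_zeros_of_isCompact {g : ℂ → ℂ} (hg : Differentiable ℂ g) (hne : ∃ z, g z ≠ 0)
    {K : Set ℂ} (hK : IsCompact K) : (K ∩ {z | g z = 0}).Finite := by
  by_contra hinf
  obtain ⟨x, -, hx⟩ := Set.Infinite.exists_accPt_of_subset_isCompact hinf hK inter_subset_left
  obtain ⟨z, hz⟩ := hne
  have : g = fun _ ↦ 0 := AnalyticOnNhd.eq_of_frequently_eq (z₀ := x)
    (fun z _ ↦ hg.analyticAt z) (fun z _ ↦ analyticAt_const)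
    ((accPt_iff_frequently_nhdsNE.1 hx).mono fun y hy ↦ hy.2)
  exact hz (congrFun this z)

/-- The argument principle for an explicitly factored function. -/
lemma circleIntegral_logDeriv_prod_mul {R : ℝ} (hR : 0 < R) {G : ℂ → ℂ} (hG : Differentiable ℂ G)
    (hG0 : ∀ z ∈ closedBall 0 R, G z ≠ 0) (s : Multiset ℂ) (hs : ∀ a ∈ s, a ∈ ball 0 R) :
    (∮ z in C(0, R), logDeriv (fun z ↦ (s.map (fun a ↦ z - a)).prod * G z) z)
      = 2 * Real.pi * Complex.I * s.card := by
  have hcont : ∀ H : ℂ → ℂ, Differentiable ℂ H → ContinuousOn (deriv H) univ := fun H hH ↦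
    (hH.differentiableOn.deriv isOpen_univ).continuousOn
  induction s using Multiset.induction_on with
  | empty =>
    simp only [Multiset.map_zero, Multiset.prod_zero, one_mul, Multiset.card_zero, Nat.cast_zero,
      mul_zero]
    refine Complex.circleIntegral_eq_zero_of_differentiable_on_off_countable hR.le
      countable_empty ?_ fun z hz ↦ ?_
    · exact ((hcont G hG).mono (subset_univ _)).div hG.continuous.continuousOn hG0
    · exact ((hG.differentiableOn.deriv isOpen_univ).differentiableAt univ_mem).div (hG z)
        (hG0 z (ball_subset_closedBall hz.1))
  | cons a s ih =>
    set H : ℂ → ℂ := fun z ↦ (s.map (fun a ↦ z - a)).prod * G z with hH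
    have hHd : Differentiable ℂ H := by
      refine Differentiable.mul ?_ hG
      clear_value H
      clear ih hs hH H
      induction s using Multiset.induction_on with
      | empty => simp
      | cons b s ih =>
        simp only [Multiset.map_cons, Multiset.prod_cons]
        exact (differentiable_id.sub_const b).mul ih
    have hne : ∀ z ∈ sphere (0 : ℂ) R, ∀ b ∈ a ::ₘ s, z - b ≠ 0 := fun z hz b hb h ↦ by
      have := hs b hb
      rw [← sub_eq_zero.1 h, mem_ball] at this
      rw [mem_sphere] at hz
      linarith
    have hH0 : ∀ z ∈ sphere (0 : ℂ) R, H z ≠ 0 := fun z hz ↦ by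
      refine mul_ne_zero ?_ (hG0 z (sphere_subset_closedBall hz))
      rw [Ne, Multiset.prod_eq_zero_iff, Multiset.mem_map]
      rintro ⟨b, hb, h⟩
      exact hne z hz b (Multiset.mem_cons_of_mem hb) h
    have haR := hs a (Multiset.mem_cons_self _ _)
    have key : ∀ z ∈ sphere (0 : ℂ) R,
        logDeriv (fun z ↦ ((a ::ₘ s).map (fun a ↦ z - a)).prod * G z) z
          = (z - a)⁻¹ + logDeriv H z := fun z hz ↦ by
      simp only [Multiset.map_cons, Multiset.prod_cons, mul_assoc]
      rw [logDeriv_mul (f := fun z ↦ z - a) (g := H) z (hne z hz a (Multiset.mem_cons_self _ _))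
        (hH0 z hz) (by fun_prop) (hHd z)]
      congr 1
      rw [logDeriv_apply]
      simp
    rw [circleIntegral.integral_congr hR.le key, circleIntegral.integral_add,
      circleIntegral.integral_sub_inv_of_mem_ball haR,
      ih fun b hb ↦ hs b (Multiset.mem_cons_of_mem hb), Multiset.card_cons]
    · push_cast; ring
    · refine ContinuousOn.circleIntegrable hR.le ?_
      exact (continuousOn_id.sub continuousOn_const).inv₀ fun z hz ↦
        hne z hz a (Multiset.mem_cons_self _ _)
    · exact (((hcont H hHd).mono (subset_univ _)).div hHd.continuous.continuousOn
        hH0).circleIntegrable hR.le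

/-- If `‖f‖ > R` on the circle of radius `R`, then every `w` in the disc that is not a critical
value has at least as many preimages in the disc as `0` has. -/
lemma exists_finset_preimages {f : ℂ → ℂ} (hf : Differentiable ℂ f) {R : ℝ} (hR : 0 < R)
    (hbig : ∀ z ∈ sphere 0 R, R < ‖f z‖) {Z : Finset ℂ} (hZ : ∀ a ∈ Z, a ∈ ball 0 R ∧ f a = 0)
    {w : ℂ} (hw : w ∈ ball 0 R) (hcrit : ∀ y ∈ ball 0 R, f y = w → deriv f y ≠ 0) :
    ∃ T : Finset ℂ, Z.card ≤ T.card ∧ ∀ y ∈ T, y ∈ ball 0 R ∧ f y = w := by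
  classical
  have hne : ∀ w ∈ ball (0 : ℂ) R, ∀ z ∈ sphere 0 R, f z - w ≠ 0 := fun w hw z hz h ↦ by
    rw [mem_ball_zero_iff, ← sub_eq_zero.1 h] at hw
    exact (hbig z hz).not_gt hw
  obtain ⟨z₀, hz₀⟩ : (sphere (0 : ℂ) R).Nonempty := NormedSpace.sphere_nonempty.2 hR.le
  have hfac : ∀ w : ball (0 : ℂ) R, ∃ (s : Multiset ℂ) (G : ℂ → ℂ),
      (∀ a ∈ s, a ∈ ball 0 R) ∧ Differentiable ℂ G ∧ (∀ z ∈ closedBall 0 R, G z ≠ 0) ∧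
      (∀ z, f z - w = (s.map (fun a ↦ z - a)).prod * G z) := by
    rintro ⟨w, hw⟩
    have hd : Differentiable ℂ fun z ↦ f z - w := hf.sub_const w
    have hfin := finite_zeros_of_isCompact hd ⟨z₀, hne w hw z₀ hz₀⟩ (isCompact_closedBall 0 R)
    obtain ⟨s, G, hs, hG, hG0, hfG⟩ := exists_eq_prod_mul hd ⟨z₀, hne w hw z₀ hz₀⟩ hfin.toFinset
    refine ⟨s, G, fun a ha ↦ ?_, hG, fun z hz ↦ ?_, hfG⟩
    · have h1 := hs a ha
      rw [Finite.mem_toFinset] at h1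
      refine (ball_union_sphere (x := (0 : ℂ)) (ε := R) ▸ h1.1).resolve_right fun h2 ↦ ?_
      exact hne w hw a h2 h1.2
    · by_cases hz0 : f z - w = 0
      · exact hG0 z (by rw [Finite.mem_toFinset]; exact ⟨hz, hz0⟩)
      · exact right_ne_zero_of_mul (hfG z ▸ hz0)
  choose s G hs hG hG0 hfG using hfac
  have hpreim : ∀ w : ball (0 : ℂ) R, (∮ z in C(0, R), deriv f z / (f z - w))
      = 2 * Real.pi * Complex.I * (s w).card := fun w ↦ by
    rw [← circleIntegral_logDeriv_prod_mul hR (hG w) (hG0 w) (s w) (hs w)]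
    congr 1
    ext z
    rw [← funext (hfG w), logDeriv_apply, deriv_sub_const]
  have hcont : Continuous fun w : ball (0 : ℂ) R ↦ ∮ z in C(0, R), deriv f z / (f z - w) := by
    unfold circleIntegral
    refine intervalIntegral.continuous_parametric_intervalIntegral_of_continuous' ?_ _ _
    have hd : Continuous (deriv f) := by
      rw [← continuousOn_univ]
      exact (hf.differentiableOn.deriv isOpen_univ).continuousOn
    refine Continuous.smul (f := fun p : ball (0 : ℂ) R × ℝ ↦ deriv (circleMap 0 R) p.2)
      (g := fun p : ball (0 : ℂ) R × ℝ ↦ deriv f (circleMap 0 R p.2) / (f (circleMap 0 R p.2) - p.1))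
      ?_ (Continuous.div ?_ ?_ ?_)
    · simp only [deriv_circleMap]
      exact ((continuous_circleMap 0 R).comp continuous_snd).mul continuous_const
    · exact hd.comp ((continuous_circleMap 0 R).comp continuous_snd)
    · exact (hf.continuous.comp ((continuous_circleMap 0 R).comp continuous_snd)).sub
        (continuous_subtype_val.comp continuous_fst)
    · rintro ⟨w, θ⟩
      exact hne w w.2 _ (circleMap_mem_sphere 0 hR.le θ)
  have hcard : Continuous fun w : ball (0 : ℂ) R ↦ (s w).card := by
    rw [Nat.isClosedEmbedding_coe_real.continuous_iff]
    convert hcont.norm.div_const (2 * Real.pi) using 2 with w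
    simp [hpreim, abs_of_pos Real.pi_pos]
  have : PreconnectedSpace (ball (0 : ℂ) R) :=
    Subtype.preconnectedSpace (convex_ball 0 R).isPreconnected
  have hconst : (s ⟨w, hw⟩).card = (s ⟨0, mem_ball_self hR⟩).card :=
    PreconnectedSpace.constant inferInstance hcard
  have hroot : ∀ (w : ball (0 : ℂ) R), ∀ z ∈ closedBall 0 R, f z = w ↔ z ∈ s w := fun w z hz ↦ by
    rw [← sub_eq_zero, hfG w, mul_eq_zero, or_iff_left (hG0 w z hz), Multiset.prod_eq_zero_iff,
      Multiset.mem_map]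
    exact ⟨fun ⟨a, ha, h⟩ ↦ by rwa [sub_eq_zero.1 h], fun h ↦ ⟨z, h, sub_self z⟩⟩
  have hnodup : (s ⟨w, hw⟩).Nodup := by
    rw [Multiset.nodup_iff_ne_cons_cons]
    intro a t ht
    have ha : a ∈ s ⟨w, hw⟩ := by rw [ht]; exact Multiset.mem_cons_self _ _
    have haR := hs _ a ha
    refine hcrit a haR ((hroot _ a (ball_subset_closedBall haR)).2 ha) ?_
    obtain ⟨k, hk⟩ : ∃ k : ℂ → ℂ, k = fun z ↦ (t.map (fun a ↦ z - a)).prod * G ⟨w, hw⟩ z := ⟨_, rfl⟩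
    have hkd : Differentiable ℂ k := by
      rw [hk]
      refine Differentiable.mul ?_ (hG _)
      clear hk ht
      induction t using Multiset.induction_on with
      | empty => simp
      | cons b s ih =>
        simp only [Multiset.map_cons, Multiset.prod_cons]
        exact (differentiable_id.sub_const b).mul ih
    have hfk : f = fun z ↦ (z - a) ^ 2 * k z + w := by
      ext z
      rw [← sub_eq_iff_eq_add, hfG ⟨w, hw⟩ z, ht, hk]
      simp only [Multiset.map_cons, Multiset.prod_cons]
      ring
    have h1 : HasDerivAt (fun z ↦ (z - a) ^ 2 * k z + w)
        ((2 * (a - a) ^ 1 * 1) * k a + (a - a) ^ 2 * deriv k a) a := by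
      have := ((((hasDerivAt_id a).sub_const a).fun_pow 2).fun_mul (hkd a).hasDerivAt).add_const w
      simpa using this
    rw [hfk, h1.deriv]
    simp
  refine ⟨(s ⟨w, hw⟩).toFinset, ?_, fun y hy ↦ ?_⟩
  · rw [Multiset.toFinset_card_of_nodup hnodup, hconst]
    refine (Finset.card_le_card fun a ha ↦ ?_).trans (Multiset.toFinset_card_le _)
    rw [Multiset.mem_toFinset]
    exact (hroot ⟨0, mem_ball_self hR⟩ a (ball_subset_closedBall (hZ a ha).1)).1 (hZ a ha).2
  · rw [Multiset.mem_toFinset] at hy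
    have := hs _ y hy
    exact ⟨this, (hroot _ y (ball_subset_closedBall this)).2 hy⟩

/-- An entire function of polynomial growth along a sequence of circles is a polynomial. -/
lemma exists_polynomial_of_frequently_norm_le {f : ℂ → ℂ} (hf : Differentiable ℂ f) {C : ℝ} {D : ℕ}
    (h : ∀ R₀ : ℝ, ∃ R ≥ R₀, ∀ z ∈ sphere 0 R, ‖f z‖ ≤ C * R ^ D) :
    ∃ p : Polynomial ℂ, ∀ z, f z = p.eval z := by
  have hzero : ∀ n, D < n → iteratedDeriv n f 0 = 0 := fun n hn ↦ by
    by_contra hne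
    have hpos : 0 < ‖iteratedDeriv n f 0‖ := norm_pos_iff.2 hne
    obtain ⟨R, hR, hfR⟩ := h (max 1 (n.factorial * |C| / ‖iteratedDeriv n f 0‖ + 1))
    have hR1 : 1 ≤ R := (le_max_left _ _).trans hR
    have hR2 := (le_max_right _ _).trans hR
    have h1 := Complex.norm_iteratedDeriv_le_of_forall_mem_sphere_norm_le n
      (zero_lt_one.trans_le hR1) hf.diffContOnCl hfR
    have h2 : (n.factorial : ℝ) * (C * R ^ D) / R ^ n ≤ n.factorial * |C| / R := by
      rw [div_le_div_iff₀ (by positivity) (by positivity)]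
      calc (n.factorial : ℝ) * (C * R ^ D) * R = n.factorial * C * R ^ (D + 1) := by ring
        _ ≤ n.factorial * |C| * R ^ n := by
            gcongr
            · exact le_abs_self C
            · exact hn
    have h3 := h1.trans h2
    rw [le_div_iff₀ (by linarith)] at h3
    have h4 : n.factorial * |C| / ‖iteratedDeriv n f 0‖ < R := by linarith
    rw [div_lt_iff₀ hpos] at h4
    linarith
  refine ⟨∑ n ∈ Finset.range (D + 1),
    Polynomial.C ((n.factorial : ℂ)⁻¹ * iteratedDeriv n f 0) * Polynomial.X ^ n, fun z ↦ ?_⟩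
  rw [← Complex.taylorSeries_eq_of_entire' 0 z hf, tsum_eq_sum (s := Finset.range (D + 1)),
    Polynomial.eval_finsetSum]
  · simp
  · intro n hn
    rw [Finset.mem_range, not_lt] at hn
    rw [hzero n hn, mul_zero, zero_mul]

/-- A transcendental entire function that is large on arbitrarily large circles has infinitely many
zeros. -/
lemma infinite_zeros_of_frequently_le_norm {f : ℂ → ℂ} (hf : Differentiable ℂ f)
    (htrans : ¬ ∃ p : Polynomial ℂ, ∀ z, f z = p.eval z)
    (h : ∀ R₀ : ℝ, ∃ R ≥ R₀, ∀ z ∈ sphere 0 R, 1 ≤ ‖f z‖) : {z | f z = 0}.Infinite := by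
  intro hfin
  apply htrans
  obtain ⟨s, G, -, hG, hGZ, hfG⟩ := exists_eq_prod_mul hf (by
    by_contra! h0
    exact htrans ⟨0, by simpa using h0⟩) hfin.toFinset
  have hG0 : ∀ z, G z ≠ 0 := fun z ↦ by
    by_cases hz : f z = 0
    · exact hGZ z (by simpa using hz)
    · exact right_ne_zero_of_mul (hfG z ▸ hz)
  have hprod : ∀ R : ℝ, 1 ≤ R → ∀ z ∈ sphere (0 : ℂ) R, ‖(s.map (fun a ↦ z - a)).prod‖
      ≤ (s.map (fun a ↦ 1 + ‖a‖)).prod * R ^ s.card := fun R hR z hz ↦ by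
    clear hfG
    induction s using Multiset.induction_on with
    | empty => simp
    | cons a s ih =>
      rw [mem_sphere_zero_iff_norm] at hz
      simp only [Multiset.map_cons, Multiset.prod_cons, norm_mul, Multiset.card_cons]
      have h1 : ‖z - a‖ ≤ (1 + ‖a‖) * R := by
        have := norm_sub_le z a
        nlinarith [norm_nonneg a]
      calc _ ≤ ((1 + ‖a‖) * R) * ((s.map (fun a ↦ 1 + ‖a‖)).prod * R ^ s.card) := by gcongr
        _ = _ := by ring
  obtain ⟨q, hq⟩ := exists_polynomial_of_frequently_norm_le (f := fun z ↦ (G z)⁻¹) (hG.inv hG0)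
    (C := (s.map (fun a ↦ 1 + ‖a‖)).prod) (D := s.card) fun R₀ ↦ by
      obtain ⟨R, hR, hfR⟩ := h (max R₀ 1)
      refine ⟨R, (le_max_left _ _).trans hR, fun z hz ↦ ?_⟩
      refine le_trans ?_ (hprod R ((le_max_right _ _).trans hR) z hz)
      have := hfR z hz
      rw [hfG, norm_mul] at this
      rw [norm_inv, inv_le_iff_one_le_mul₀ (norm_pos_iff.2 (hG0 z))]
      exact this
  have hdeg : q.degree = 0 := by
    by_contra hdeg
    obtain ⟨z, hz⟩ := IsAlgClosed.exists_root q hdeg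
    exact inv_ne_zero (hG0 z) ((hq z).trans hz)
  rw [Polynomial.eq_C_of_degree_eq_zero hdeg] at hq
  refine ⟨(s.map (fun a ↦ Polynomial.X - Polynomial.C a)).prod * Polynomial.C (q.coeff 0)⁻¹,
    fun z ↦ ?_⟩
  have hz := hq z
  rw [Polynomial.eval_C] at hz
  rw [hfG, Polynomial.eval_mul, Polynomial.eval_C, ← hz, inv_inv, Polynomial.eval_multiset_prod,
    Multiset.map_map]
  simp

/-- The maximum modulus of a transcendental entire function grows faster than linearly. -/
lemma exists_mul_le_norm {f : ℂ → ℂ} (hf : Differentiable ℂ f)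
    (htrans : ¬ ∃ p : Polynomial ℂ, ∀ z, f z = p.eval z) (c : ℝ) :
    ∃ R₀ : ℝ, ∀ R ≥ R₀, ∃ z ∈ sphere (0 : ℂ) R, c * R ≤ ‖f z‖ := by
  by_contra! h
  refine htrans (exists_polynomial_of_frequently_norm_le hf (C := c) (D := 1) fun R₀ ↦ ?_)
  obtain ⟨R, hR, hfR⟩ := h R₀
  exact ⟨R, hR, fun z hz ↦ by rw [pow_one]; exact (hfR z hz).le⟩

lemma hasDerivAt_iterate_prod {f : ℂ → ℂ} (hf : Differentiable ℂ f) (n : ℕ) (z : ℂ) :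
    HasDerivAt f^[n] (∏ k ∈ Finset.range n, deriv f (f^[k] z)) z := by
  induction n with
  | zero => simpa using hasDerivAt_id z
  | succ n ih =>
    rw [Function.iterate_succ', Finset.prod_range_succ, mul_comm]
    exact (hf _).hasDerivAt.comp z ih

/-- If at least half of an orbit segment lies where `f` contracts strongly, the iterate
contracts. -/
lemma norm_deriv_iterate_le_half {f : ℂ → ℂ} (hf : Differentiable ℂ f) {L δ : ℝ} (hL : 1 ≤ L)
    (hδ : 0 ≤ δ) (hδL : δ * L ≤ 1 / 2) {n : ℕ} (hn : n ≠ 0) {z : ℂ}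
    (hz : ∀ k < n, ‖deriv f (f^[k] z)‖ ≤ L)
    (hb : n ≤ 2 * {k | k < n ∧ f^[k] z ∈ {y | ‖deriv f y‖ < δ}}.ncard) :
    ‖deriv f^[n] z‖ ≤ 1 / 2 := by
  classical
  rw [(hasDerivAt_iterate_prod hf n z).deriv, norm_prod]
  set s : Finset ℕ := (Finset.range n).filter (fun k ↦ ‖deriv f (f^[k] z)‖ < δ) with hs
  have hset : {k | k < n ∧ f^[k] z ∈ {y | ‖deriv f y‖ < δ}} = s := by
    ext k; simp [hs]
  rw [hset, ncard_coe_finset] at hb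
  have hsplit : s.card + ((Finset.range n).filter (fun k ↦ ¬ ‖deriv f (f^[k] z)‖ < δ)).card
      = n := by
    rw [hs, Finset.card_filter_add_card_filter_not, Finset.card_range]
  calc ∏ k ∈ Finset.range n, ‖deriv f (f^[k] z)‖
      ≤ ∏ k ∈ Finset.range n, (if ‖deriv f (f^[k] z)‖ < δ then δ else L) := by
        refine Finset.prod_le_prod (fun _ _ ↦ norm_nonneg _) fun k hk ↦ ?_
        split_ifs with h
        · exact h.le
        · exact hz k (Finset.mem_range.1 hk)
    _ = δ ^ s.card * L ^ ((Finset.range n).filter (fun k ↦ ¬ ‖deriv f (f^[k] z)‖ < δ)).card := by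
        rw [Finset.prod_ite, Finset.prod_const, Finset.prod_const]
    _ ≤ δ ^ s.card * L ^ s.card :=
        mul_le_mul_of_nonneg_left (pow_le_pow_right₀ hL (by omega)) (by positivity)
    _ = (δ * L) ^ s.card := (mul_pow _ _ _).symm
    _ ≤ (1 / 2) ^ s.card := by gcongr
    _ ≤ (1 / 2) ^ 1 := pow_le_pow_of_le_one (by norm_num) (by norm_num) (by omega)
    _ = 1 / 2 := pow_one _

/-- The image of a contracted part of an open set has at most half the area of that set. -/
lemma volume_image_le {g : ℂ → ℂ} (hg : Differentiable ℂ g) {U : Set ℂ} (hU : IsOpen U) :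
    MeasureTheory.volume (g '' {z | z ∈ U ∧ ‖deriv g z‖ ≤ 1 / 2})
      ≤ 2⁻¹ * MeasureTheory.volume U := by
  have hmeas : MeasurableSet {z | z ∈ U ∧ ‖deriv g z‖ ≤ 1 / 2} := by
    have hd : Continuous (deriv g) := by
      rw [← continuousOn_univ]
      exact (hg.differentiableOn.deriv isOpen_univ).continuousOn
    exact hU.measurableSet.inter (isClosed_le hd.norm continuous_const).measurableSet
  refine (MeasureTheory.addHaar_image_le_lintegral_abs_det_fderiv MeasureTheory.volume hmeas
    fun z _ ↦ (hg z).hasDerivAt.complexToReal_fderiv.hasFDerivWithinAt).trans ?_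
  have hdet : ∀ c : ℂ, (c • (1 : ℂ →L[ℝ] ℂ)).det = ‖c‖ ^ 2 := fun c ↦ by
    rw [Complex.sq_norm, ← Algebra.norm_complex_apply, Algebra.norm_apply, ContinuousLinearMap.det]
    congr 1
  calc _ ≤ ∫⁻ _ in {z | z ∈ U ∧ ‖deriv g z‖ ≤ 1 / 2}, 2⁻¹ ∂MeasureTheory.volume := by
        refine MeasureTheory.setLIntegral_mono measurable_const fun z hz ↦ ?_
        rw [hdet, abs_of_nonneg (by positivity), ← ENNReal.ofReal_ofNat,
          ← ENNReal.ofReal_inv_of_pos two_pos]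
        refine ENNReal.ofReal_le_ofReal ?_
        have := hz.2
        nlinarith [norm_nonneg (deriv g z)]
    _ ≤ 2⁻¹ * MeasureTheory.volume U := by
        rw [MeasureTheory.setLIntegral_const]
        gcongr
        exact fun z hz ↦ hz.1

/-- Distinct points with the same image are far apart when the derivative at one of them is not
small. -/
lemma exists_le_dist_of_eq {f : ℂ → ℂ} (hf : Differentiable ℂ f) (R : ℝ) {δ : ℝ} (hδ : 0 < δ) :
    ∃ ε > 0, ∀ z ∈ closedBall 0 R, ∀ z' ∈ closedBall 0 R, f z = f z' → z ≠ z' →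
      δ ≤ ‖deriv f z‖ → ε ≤ dist z z' := by
  have hd : Differentiable ℂ (deriv f) := fun z ↦
    (hf.differentiableOn.deriv isOpen_univ).differentiableAt univ_mem
  have hdd : Continuous (deriv (deriv f)) := by
    rw [← continuousOn_univ]
    exact (hd.differentiableOn.deriv isOpen_univ).continuousOn
  obtain ⟨M, hM⟩ := (isCompact_closedBall (0 : ℂ) R).exists_bound_of_continuousOn hdd.continuousOn
  refine ⟨δ / (|M| + 1), by positivity, fun z hz z' hz' hzz hne hδz ↦ ?_⟩
  have hlip : ∀ x ∈ closedBall (0 : ℂ) R, ‖deriv f x - deriv f z‖ ≤ (|M| + 1) * ‖x - z‖ :=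
    fun x hx ↦ Convex.norm_image_sub_le_of_norm_deriv_le (fun y _ ↦ hd y)
      (fun y hy ↦ (hM y hy).trans (by linarith [le_abs_self M])) (convex_closedBall 0 R) hz hx
  have hder : ∀ x, HasDerivAt (fun x ↦ f x - deriv f z * x) (deriv f x - deriv f z) x := fun x ↦ by
    simpa using (hf x).hasDerivAt.fun_sub ((hasDerivAt_id x).const_mul (deriv f z))
  have h1 := Convex.norm_image_sub_le_of_norm_deriv_le
    (s := closedBall 0 R ∩ closedBall z ‖z' - z‖) (x := z) (y := z')
    (C := (|M| + 1) * ‖z' - z‖) (fun x _ ↦ (hder x).differentiableAt)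
    (fun x hx ↦ by
      rw [(hder x).deriv]
      refine (hlip x hx.1).trans ?_
      gcongr
      exact mem_closedBall_iff_norm.1 hx.2)
    ((convex_closedBall 0 R).inter (convex_closedBall z _))
    ⟨hz, mem_closedBall_self (norm_nonneg _)⟩ ⟨hz', mem_closedBall_iff_norm.2 le_rfl⟩
  have h2 : f z' - deriv f z * z' - (f z - deriv f z * z) = -(deriv f z * (z' - z)) := by
    rw [hzz]; ring
  have hpos : 0 < ‖z' - z‖ := norm_pos_iff.2 (sub_ne_zero.2 hne.symm)
  rw [h2, norm_neg, norm_mul] at h1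
  rw [div_le_iff₀ (by positivity), dist_comm, dist_eq_norm, mul_comm]
  exact hδz.trans (le_of_mul_le_mul_right h1 hpos)

/-- The entropy bound of Misiurewicz and Przytycki for a map that is large on a circle. -/
lemma exists_entropy_of_large_on_circle {f : ℂ → ℂ} (hf : Differentiable ℂ f) {R : ℝ} (hR : 0 < R)
    (hbig : ∀ z ∈ sphere 0 R, R < ‖f z‖) {Z : Finset ℂ} (hZ : ∀ a ∈ Z, a ∈ ball 0 R ∧ f a = 0)
    (hZne : Z.Nonempty) :
    ∃ K : Set ℂ, K.Nonempty ∧ IsCompact K ∧ MapsTo f K K ∧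
      ((Real.log Z.card / 2 : ℝ) : EReal) ≤ coverEntropy f K := by
  classical
  have hN : 1 ≤ Z.card := hZne.card_pos
  have hd : Differentiable ℂ (deriv f) := fun z ↦
    (hf.differentiableOn.deriv isOpen_univ).differentiableAt univ_mem
  have hdne : ∃ z, deriv f z ≠ 0 := by
    by_contra! h
    obtain ⟨a, ha⟩ := hZne
    obtain ⟨z, hz⟩ : (sphere (0 : ℂ) R).Nonempty := NormedSpace.sphere_nonempty.2 hR.le
    have h1 := hbig z hz
    rw [is_const_of_deriv_eq_zero hf h z a, (hZ a ha).2, norm_zero] at h1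
    linarith
  obtain ⟨L', hL'⟩ := (isCompact_closedBall (0 : ℂ) R).exists_bound_of_continuousOn
    hd.continuous.continuousOn
  obtain ⟨L, hL1, hL⟩ : ∃ L : ℝ, 1 ≤ L ∧ ∀ z ∈ closedBall (0 : ℂ) R, ‖deriv f z‖ ≤ L :=
    ⟨max 1 L', le_max_left _ _, fun z hz ↦ (hL' z hz).trans (le_max_right _ _)⟩
  obtain ⟨δ, hδ0, hδL⟩ : ∃ δ : ℝ, 0 < δ ∧ δ * L ≤ 1 / 2 :=
    ⟨1 / 2 / L, by positivity, by rw [div_mul_cancel₀]; positivity⟩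
  obtain ⟨ε, hε, hsep⟩ := exists_le_dist_of_eq hf R hδ0
  set crit : Set ℂ := closedBall 0 R ∩ {z | deriv f z = 0} with hcrit
  have hcritfin : crit.Finite := finite_zeros_of_isCompact hd hdne (isCompact_closedBall 0 R)
  set P : Set ℂ := ⋃ n : ℕ, f^[n + 1] '' crit with hP
  have hPc : P.Countable := countable_iUnion fun n ↦ (hcritfin.image _).countable
  have hPpre : ∀ y, f y ∉ P → y ∉ P := fun y hy hyP ↦ by
    obtain ⟨n, c, hc, rfl⟩ := mem_iUnion.1 hyP
    refine hy (mem_iUnion.2 ⟨n + 1, c, hc, ?_⟩)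
    rw [Function.iterate_succ_apply']
  have hPcrit : ∀ y ∈ ball (0 : ℂ) R, f y ∉ P → deriv f y ≠ 0 := fun y hyR hy h0 ↦
    hy (mem_iUnion.2 ⟨0, y, ⟨ball_subset_closedBall hyR, h0⟩, rfl⟩)
  refine le_coverEntropy_of_separated hf.continuous (isCompact_closedBall 0 R) hN hε fun n ↦ ?_
  rcases eq_or_ne n 0 with rfl | hn
  · exact ⟨{0}, by simp [hR.le]⟩
  have hstep := exists_separated_preimages_s13 (f := f) (U := ball 0 R) (P := P)
    (B := {y | ‖deriv f y‖ < δ}) (ε := ε) (N := Z.card) (fun w hw hwP ↦ by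
      obtain ⟨T, hTc, hT⟩ := exists_finset_preimages hf hR hbig hZ hw
        fun y hy hyw ↦ hPcrit y hy (hyw ▸ hwP)
      by_cases hB : ∃ y ∈ ball (0 : ℂ) R, y ∈ {y | ‖deriv f y‖ < δ} ∧ f y = w
      · obtain ⟨y, hy, hyB, rfl⟩ := hB
        exact Or.inl ⟨y, hy, hPpre y hwP, hyB, rfl⟩
      · refine Or.inr ⟨T, hTc, fun y hy ↦ ⟨(hT y hy).1, hPpre y ((hT y hy).2 ▸ hwP), (hT y hy).2⟩,
          fun y hy y' hy' hne ↦ ?_⟩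
        refine hsep y (ball_subset_closedBall (hT y hy).1) y' (ball_subset_closedBall (hT y' hy').1)
          ((hT y hy).2.trans (hT y' hy').2.symm) hne ?_
        by_contra! hlt
        exact hB ⟨y, (hT y hy).1, hlt, (hT y hy).2⟩) n
  have hfn : Differentiable ℂ f^[n] := hf.iterate n
  obtain ⟨w, hwU, hwP, hwE⟩ : ∃ w ∈ ball (0 : ℂ) R, w ∉ P ∧
      w ∉ f^[n] '' {z | z ∈ ball (0 : ℂ) R ∧ ‖deriv f^[n] z‖ ≤ 1 / 2} := by
    by_contra! h
    have hsub : ball (0 : ℂ) R ⊆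
        P ∪ f^[n] '' {z | z ∈ ball (0 : ℂ) R ∧ ‖deriv f^[n] z‖ ≤ 1 / 2} := fun w hw ↦
      or_iff_not_imp_left.2 (h w hw)
    have h1 := (MeasureTheory.measure_mono (μ := MeasureTheory.volume) hsub).trans
      ((MeasureTheory.measure_union_le _ _).trans (add_le_add (hPc.measure_zero _).le
        (volume_image_le hfn isOpen_ball)))
    have hpos : MeasureTheory.volume (ball (0 : ℂ) R) ≠ 0 :=
      (measure_ball_pos MeasureTheory.volume (0 : ℂ) hR).ne'
    have hfin : MeasureTheory.volume (ball (0 : ℂ) R) ≠ ⊤ := MeasureTheory.measure_ball_lt_top.ne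
    rw [zero_add, mul_comm, ← div_eq_mul_inv] at h1
    exact (ENNReal.half_lt_self hpos hfin).not_ge h1
  obtain ⟨S, hSorb, hSsep, hScard⟩ := hstep w hwU hwP
  refine ⟨S, fun z hz k hk ↦ ball_subset_closedBall ((hSorb z hz).2 k hk), hSsep, ?_⟩
  have hbad : ∀ z ∈ S, 2 * {k | k < n ∧ f^[k] z ∈ {y | ‖deriv f y‖ < δ}}.ncard ≤ n := fun z hz ↦ by
    by_contra! hlt
    refine hwE ⟨z, ⟨(hSorb z hz).2 0 (Nat.zero_le n), ?_⟩, (hSorb z hz).1⟩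
    exact norm_deriv_iterate_le_half hf hL1 hδ0.le hδL hn
      (fun k hk ↦ hL _ (ball_subset_closedBall ((hSorb z hz).2 k hk.le))) hlt.le
  have h1 : Z.card ^ n ≤ S.card * Z.card ^ (n / 2) :=
    hScard.trans ((Finset.sum_le_card_nsmul S _ _ fun z hz ↦
      Nat.pow_le_pow_right hN (by have := hbad z hz; omega)))
  have h2 : Z.card ^ n * Z.card ^ n ≤ S.card ^ 2 * Z.card ^ n :=
    calc Z.card ^ n * Z.card ^ n
        ≤ (S.card * Z.card ^ (n / 2)) * (S.card * Z.card ^ (n / 2)) := Nat.mul_le_mul h1 h1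
      _ = S.card ^ 2 * Z.card ^ (2 * (n / 2)) := by ring
      _ ≤ S.card ^ 2 * Z.card ^ n :=
        Nat.mul_le_mul_left _ (Nat.pow_le_pow_right hN (by omega))
  exact Nat.le_of_mul_le_mul_right h2 (Nat.pow_pos hN)

/-- An entire function with both small and very large values on a circle does not omit two well
separated values on an annulus around that circle. -/
lemma exists_mem_annulus_eq_or_eq {E : ℝ} (hE : 1 ≤ E) :
    ∃ Λ : ℝ, ∀ f : ℂ → ℂ, Differentiable ℂ f → ∀ ρ r : ℝ, 0 < ρ → ρ ≤ r → r ≤ E * ρ →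
      ∀ w₁ w₂ : ℂ, ‖w₁‖ ≤ E * ρ → ‖w₂‖ ≤ E * ρ → ρ ≤ ‖w₂ - w₁‖ →
      (∃ z ∈ sphere (0 : ℂ) r, ‖f z‖ ≤ r) → (∃ z ∈ sphere (0 : ℂ) r, Λ * r ≤ ‖f z‖) →
      ∃ z : ℂ, r * Real.exp (-5) ≤ ‖z‖ ∧ ‖z‖ ≤ r * Real.exp 5 ∧ (f z = w₁ ∨ f z = w₂) := by
  obtain ⟨C₁, hC₁⟩ := exists_schottky_bound (2 * E)
  set C : ℝ := max (2 * E) C₁ + 1 with hC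
  refine ⟨2 * E * C + E, fun f hf ρ r hρ hρr hrE w₁ w₂ hw₁ hw₂ hw hsmall hlarge ↦ ?_⟩
  by_contra! hcon
  have hr : 0 < r := hρ.trans_le hρr
  obtain ⟨a, ha, hfa⟩ := hsmall
  obtain ⟨b, hb, hfb⟩ := hlarge
  rw [mem_sphere_zero_iff_norm] at ha hb
  have hw0 : 0 < ‖w₂ - w₁‖ := hρ.trans_le hw
  have hw0' : w₂ - w₁ ≠ 0 := norm_pos_iff.1 hw0
  have hwle : ‖w₂ - w₁‖ ≤ 2 * E * ρ := by linarith [norm_sub_le w₂ w₁]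
  set g : ℂ → ℂ := fun τ ↦ (f (Complex.exp τ) - w₁) / (w₂ - w₁) with hg
  have hgd : Differentiable ℂ g :=
    ((hf.comp Complex.differentiable_exp).sub_const w₁).div_const _
  have hnorm : ∀ θ : ℝ, ‖Complex.exp (Real.log r + θ * Complex.I)‖ = r := fun θ ↦ by
    rw [Complex.norm_exp]
    simp [Real.exp_log hr]
  have hpolar : ∀ z : ℂ, ‖z‖ = r → ∀ θ : ℝ, ∃ φ : ℝ, |φ| ≤ Real.pi ∧
      Complex.exp (Real.log r + (θ + φ : ℝ) * Complex.I) = z := fun z hz θ ↦ by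
    refine ⟨Complex.arg (z / Complex.exp (Real.log r + θ * Complex.I)),
      Complex.abs_arg_le_pi _, ?_⟩
    have h1 := Complex.norm_mul_exp_arg_mul_I (z / Complex.exp (Real.log r + θ * Complex.I))
    rw [norm_div, hnorm, hz, div_self hr.ne', Complex.ofReal_one, one_mul,
      eq_div_iff (Complex.exp_ne_zero _), ← Complex.exp_add] at h1
    refine (congrArg Complex.exp ?_).trans h1
    push_cast
    ring
  have hga : ∀ θ : ℝ, Complex.exp (Real.log r + θ * Complex.I) = a →
      ‖g (Real.log r + θ * Complex.I)‖ ≤ 2 * E := fun θ hθ ↦ by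
    simp only [hg, hθ, norm_div]
    rw [div_le_iff₀ hw0]
    have := norm_sub_le (f a) w₁
    nlinarith
  have hgb : ∀ θ : ℝ, Complex.exp (Real.log r + θ * Complex.I) = b →
      C ≤ ‖g (Real.log r + θ * Complex.I)‖ := fun θ hθ ↦ by
    simp only [hg, hθ, norm_div]
    rw [le_div_iff₀ hw0]
    have h1 := norm_sub_norm_le (f b) w₁
    have hC0 : 0 ≤ C := by
      have := le_max_left (2 * E) C₁
      linarith
    have h2 : C * ‖w₂ - w₁‖ ≤ C * (2 * E * ρ) := by gcongr
    have h3 : (2 * E * C + E) * ρ ≤ (2 * E * C + E) * r := by gcongr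
    linarith
  obtain ⟨θa, -, hθa⟩ := hpolar a ha 0
  obtain ⟨θb, -, hθb⟩ := hpolar b hb 0
  have hcont : Continuous fun θ : ℝ ↦ ‖g (Real.log r + θ * Complex.I)‖ :=
    (hgd.continuous.comp (by fun_prop)).norm
  obtain ⟨θ₀, hθ₀⟩ := intermediate_value_univ (0 + θa) (0 + θb) hcont
    (show 2 * E ∈ Icc _ _ from ⟨hga _ hθa, le_trans (by
      have := le_max_left (2 * E) C₁
      linarith) (hgb _ hθb)⟩)
  obtain ⟨φ, hφ, hφb⟩ := hpolar b hb θ₀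
  have homit : ∀ τ ∈ ball (Real.log r + θ₀ * Complex.I : ℂ) 5, g τ ≠ 0 ∧ g τ ≠ 1 := fun τ hτ ↦ by
    rw [mem_ball_iff_norm] at hτ
    have h1 := abs_le.1 ((Complex.abs_re_le_norm _).trans hτ.le)
    simp only [Complex.sub_re, Complex.add_re, Complex.ofReal_re, Complex.mul_re, Complex.I_re,
      Complex.I_im, Complex.ofReal_im, mul_zero, mul_one, sub_zero, add_zero] at h1
    have h2 := hcon (Complex.exp τ) (by
      rw [Complex.norm_exp]
      nth_rewrite 1 [← Real.exp_log hr]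
      rw [← Real.exp_add]
      exact Real.exp_le_exp.2 (by linarith)) (by
      rw [Complex.norm_exp]
      nth_rewrite 1 [← Real.exp_log hr]
      rw [← Real.exp_add]
      exact Real.exp_le_exp.2 (by linarith))
    refine ⟨div_ne_zero (sub_ne_zero.2 h2.1) hw0', fun h ↦ h2.2 ?_⟩
    rw [hg] at h
    simpa using (div_eq_one_iff_eq hw0').1 h
  have h1 := hC₁ _ g hgd.differentiableOn homit hθ₀ (Real.log r + (θ₀ + φ : ℝ) * Complex.I) (by
    rw [mem_ball_iff_norm]
    have : (Real.log r + (θ₀ + φ : ℝ) * Complex.I : ℂ) - (Real.log r + θ₀ * Complex.I)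
        = φ * Complex.I := by push_cast; ring
    rw [this, norm_mul, Complex.norm_I, mul_one, Complex.norm_real, Real.norm_eq_abs]
    linarith [Real.pi_lt_four])
  have h2 := hgb _ hφb
  have := le_max_right (2 * E) C₁
  linarith

/-- Among pairwise disjoint subsets of `range (2 * N + 2)`, all but one have at most `N + 1`
elements. -/
lemma exists_forall_ne_card_le {N : ℕ} {bad : ℕ → Finset ℕ}
    (hsub : ∀ k, bad k ⊆ Finset.range (2 * N + 2))
    (hdisj : ∀ k < 2 * N + 2, ∀ l < 2 * N + 2, k ≠ l → Disjoint (bad k) (bad l)) :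
    ∃ m, ∀ k < 2 * N + 2, k ≠ m → (bad k).card ≤ N + 1 := by
  by_cases h : ∃ m < 2 * N + 2, N + 1 < (bad m).card
  · obtain ⟨m, hm, hcm⟩ := h
    refine ⟨m, fun k hk hkm ↦ ?_⟩
    have h1 := Finset.card_le_card (Finset.union_subset (hsub k) (hsub m))
    rw [Finset.card_union_of_disjoint (hdisj k hk m hm hkm), Finset.card_range] at h1
    omega
  · push Not at h
    exact ⟨0, fun k hk _ ↦ h k hk⟩

/-- The entropy bound for a map covering most of a family of annuli by each of them. -/
lemma exists_entropy_of_annuli {f : ℂ → ℂ} (hf : Differentiable ℂ f)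
    (hlarge : ∀ c : ℝ, ∃ R₀ : ℝ, ∀ R ≥ R₀, ∃ z ∈ sphere (0 : ℂ) R, c * R ≤ ‖f z‖)
    (hsmall : ∃ R₀ : ℝ, ∀ R ≥ R₀, ∃ z ∈ sphere (0 : ℂ) R, ‖f z‖ ≤ R) {N : ℕ} (hN : 1 ≤ N) :
    ∃ K : Set ℂ, K.Nonempty ∧ IsCompact K ∧ MapsTo f K K ∧
      ((Real.log N / 2 : ℝ) : EReal) ≤ coverEntropy f K := by
  classical
  set M : ℕ := 2 * N + 2 with hM
  set E : ℝ := Real.exp (12 * M + 5) with hE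
  obtain ⟨Λ, hΛ⟩ := exists_mem_annulus_eq_or_eq (E := E) (Real.one_le_exp (by positivity))
  obtain ⟨R₁, hR₁⟩ := hlarge Λ
  obtain ⟨R₂, hR₂⟩ := hsmall
  obtain ⟨ρ, hρ0, hρ1, hρ2⟩ : ∃ ρ : ℝ, 0 < ρ ∧ R₁ ≤ ρ ∧ R₂ ≤ ρ :=
    ⟨max 1 (max R₁ R₂), by positivity, (le_max_left _ _).trans (le_max_right _ _),
      (le_max_right _ _).trans (le_max_right _ _)⟩
  set A : ℕ → Set ℂ := fun k ↦ {z | ρ * Real.exp (12 * k - 5) ≤ ‖z‖ ∧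
    ‖z‖ ≤ ρ * Real.exp (12 * k + 5)} with hA
  have hAc : ∀ k, IsCompact (A k) := fun k ↦ by
    refine (isCompact_closedBall (0 : ℂ) (ρ * Real.exp (12 * k + 5))).of_isClosed_subset
      ((isClosed_le continuous_const continuous_norm).inter
        (isClosed_le continuous_norm continuous_const)) fun z hz ↦ ?_
    rw [mem_closedBall_zero_iff]
    exact hz.2
  have hgap' : ∀ k l : ℕ, k < l → ∀ w₁ ∈ A k, ∀ w₂ ∈ A l, ρ ≤ ‖w₂ - w₁‖ := by
    intro k l hkl w₁ hw₁ w₂ hw₂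
    have h1 := norm_sub_norm_le w₂ w₁
    have h2 : (k : ℝ) + 1 ≤ l := by exact_mod_cast hkl
    have h3 : Real.exp (12 * k + 5) + 1 ≤ Real.exp (12 * l - 5) := by
      have h4 : 1 ≤ Real.exp (12 * k + 5) := Real.one_le_exp (by positivity)
      have h5 : Real.exp (12 * k + 5) * Real.exp 2 ≤ Real.exp (12 * l - 5) := by
        rw [← Real.exp_add]
        exact Real.exp_le_exp.2 (by linarith)
      have h6 := Real.add_one_le_exp (2 : ℝ)
      nlinarith
    have h7 := mul_le_mul_of_nonneg_left h3 hρ0.le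
    linarith [hw₁.2, hw₂.1]
  have hgap : ∀ k l : ℕ, k ≠ l → ∀ w₁ ∈ A k, ∀ w₂ ∈ A l, ρ ≤ dist w₁ w₂ := by
    intro k l hkl w₁ hw₁ w₂ hw₂
    rcases hkl.lt_or_gt with h | h
    · rw [dist_comm, dist_eq_norm]; exact hgap' k l h w₁ hw₁ w₂ hw₂
    · rw [dist_eq_norm]; exact hgap' l k h w₂ hw₂ w₁ hw₁
  have hAE : ∀ k < M, ∀ w ∈ A k, ‖w‖ ≤ E * ρ := fun k hk w hw ↦ by
    rw [mul_comm]
    have : (k : ℝ) ≤ M := by exact_mod_cast hk.le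
    exact hw.2.trans (mul_le_mul_of_nonneg_left (Real.exp_le_exp.2 (by linarith)) hρ0.le)
  have hcover : ∀ j < M, ∀ k < M, ∀ l < M, k ≠ l → A k ⊆ f '' A j ∨ A l ⊆ f '' A j := by
    intro j hj k hk l hl hkl
    by_contra! h
    obtain ⟨w₁, hw₁, hw₁f⟩ := not_subset.1 h.1
    obtain ⟨w₂, hw₂, hw₂f⟩ := not_subset.1 h.2
    have hj' : (j : ℝ) ≤ M := by exact_mod_cast hj.le
    have hρr : ρ ≤ ρ * Real.exp (12 * j) :=
      le_mul_of_one_le_right hρ0.le (Real.one_le_exp (by positivity))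
    obtain ⟨z, hz1, hz2, hz⟩ := hΛ f hf ρ (ρ * Real.exp (12 * j)) hρ0 hρr
      (by
        rw [mul_comm]
        exact mul_le_mul_of_nonneg_right (Real.exp_le_exp.2 (by linarith)) hρ0.le) w₁ w₂
          (hAE k hk w₁ hw₁) (hAE l hl w₂ hw₂)
      (by rw [← dist_eq_norm, dist_comm]; exact hgap k l hkl w₁ hw₁ w₂ hw₂)
      (hR₂ _ (hρ2.trans hρr)) (hR₁ _ (hρ1.trans hρr))
    rw [mul_assoc, ← Real.exp_add] at hz1 hz2
    have hzA : z ∈ A j := ⟨hz1, hz2⟩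
    rcases hz with hz | hz
    · exact hw₁f ⟨z, hzA, hz⟩
    · exact hw₂f ⟨z, hzA, hz⟩
  obtain ⟨m, hm⟩ := exists_forall_ne_card_le (N := N)
    (bad := fun k ↦ (Finset.range M).filter fun j ↦ ¬ A k ⊆ f '' A j)
    (fun k ↦ Finset.filter_subset _ _) (fun k hk l hl hkl ↦ by
      rw [Finset.disjoint_left]
      intro j hjk hjl
      rw [Finset.mem_filter, Finset.mem_range] at hjk hjl
      exact (hcover j hjk.1 k hk l hl hkl).elim hjk.2 hjl.2)
  set I : Finset ℕ := (Finset.range M).erase m with hI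
  have hIcard : 2 * N + 1 ≤ I.card := by
    have := Finset.pred_card_le_card_erase (s := Finset.range M) (a := m)
    rw [Finset.card_range, ← hI] at this
    omega
  obtain ⟨i₀, hi₀⟩ : I.Nonempty := Finset.card_pos.1 (by omega)
  set U : Set ℂ := ⋃ i ∈ I, A i with hU
  have hw₀ : ((ρ * Real.exp (12 * i₀) : ℝ) : ℂ) ∈ U := by
    refine mem_biUnion hi₀ ?_
    have hnn : ‖((ρ * Real.exp (12 * i₀) : ℝ) : ℂ)‖ = ρ * Real.exp (12 * i₀) := by
      rw [Complex.norm_real, Real.norm_eq_abs, abs_of_pos (by positivity)]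
    refine ⟨?_, ?_⟩ <;> rw [hnn] <;> gcongr <;> linarith
  refine le_coverEntropy_of_separated hf.continuous (X := U)
    (I.finite_toSet.isCompact_biUnion fun i _ ↦ hAc i) hN hρ0 fun n ↦ ?_
  obtain ⟨S, hSorb, hSsep, hScard⟩ := exists_separated_preimages_s13 (f := f) (U := U) (P := ∅)
    (B := ∅) (ε := ρ) (N := N) (fun w hw _ ↦ by
      obtain ⟨k, hk, hwk⟩ := mem_iUnion₂.1 hw
      set J : Finset ℕ := I.filter fun j ↦ A k ⊆ f '' A j with hJ
      have hJcard : N ≤ J.card := by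
        have hkM := Finset.mem_range.1 (Finset.mem_of_mem_erase hk)
        have h1 := hm k hkM (Finset.ne_of_mem_erase hk)
        have h2 : (I.filter fun j ↦ ¬ A k ⊆ f '' A j).card ≤ N + 1 :=
          (Finset.card_le_card (Finset.filter_subset_filter _ (Finset.erase_subset _ _))).trans h1
        have h3 := Finset.card_filter_add_card_filter_not (s := I) (fun j ↦ A k ⊆ f '' A j)
        rw [← hJ] at h3
        omega
      have hy : ∀ j ∈ J, ∃ y ∈ A j, f y = w := fun j hj ↦ (Finset.mem_filter.1 hj).2 hwk
      choose! y hyA hyf using hy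
      have hJI : ∀ j ∈ J, j ∈ I := fun j hj ↦ (Finset.mem_filter.1 hj).1
      refine Or.inr ⟨J.image y, ?_, ?_, ?_⟩
      · rw [Finset.card_image_of_injOn]
        · exact hJcard
        · intro j hj j' hj' hjj
          by_contra hne
          have := hgap j j' hne _ (hyA j hj) _ (hyA j' hj')
          rw [hjj, dist_self] at this
          linarith
      · intro z hz
        obtain ⟨j, hj, rfl⟩ := Finset.mem_image.1 hz
        exact ⟨mem_biUnion (hJI j hj) (hyA j hj), notMem_empty _, hyf j hj⟩
      · intro z hz z' hz' hne
        obtain ⟨j, hj, rfl⟩ := Finset.mem_image.1 hz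
        obtain ⟨j', hj', rfl⟩ := Finset.mem_image.1 hz'
        exact hgap j j' (fun h ↦ hne (by rw [h])) _ (hyA j hj) _ (hyA j' hj')) n _ hw₀
      (notMem_empty _)
  refine ⟨S, fun z hz k hk ↦ (hSorb z hz).2 k hk, hSsep, ?_⟩
  simp only [mem_empty_iff_false, and_false, ofPred_false, ncard_empty, pow_zero,
    Finset.sum_const, smul_eq_mul, mul_one] at hScard
  exact hScard.trans (Nat.le_self_pow two_ne_zero _)

/-- The topological entropy of an entire transcendental function is infinite: for every
`C : ℝ` there is a nonempty compact invariant set on which the Bowen topological entropy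
of `f` is at least `C`; equivalently, the supremum of the entropies over all nonempty
compact invariant sets is `+∞`. -/
theorem entropy_of_entire_transcendental_eq_top (f : ℂ → ℂ)
    (hf : Differentiable ℂ f)
    (htrans : ¬ ∃ p : Polynomial ℂ, ∀ z : ℂ, f z = p.eval z) :
    (∀ C : ℝ, ∃ K : Set ℂ, K.Nonempty ∧ IsCompact K ∧ Set.MapsTo f K K ∧
      (C : EReal) ≤ coverEntropy f K) ∧
    (⨆ (K : Set ℂ) (_ : K.Nonempty ∧ IsCompact K ∧ Set.MapsTo f K K),
      coverEntropy f K) = ⊤ := by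
  have hlog : ∀ N : ℕ, 1 ≤ N → ∃ K : Set ℂ, K.Nonempty ∧ IsCompact K ∧ MapsTo f K K ∧
      ((Real.log N / 2 : ℝ) : EReal) ≤ coverEntropy f K := fun N hN ↦ by
    by_cases hcase : ∀ R₀ : ℝ, ∃ R ≥ R₀, ∀ z ∈ sphere (0 : ℂ) R, R < ‖f z‖
    · have hinf := infinite_zeros_of_frequently_le_norm hf htrans fun R₀ ↦ by
        obtain ⟨R, hR, hfR⟩ := hcase (max R₀ 1)
        exact ⟨R, (le_max_left _ _).trans hR, fun z hz ↦
          ((le_max_right _ _).trans hR).trans (hfR z hz).le⟩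
      obtain ⟨Z, hZ, hZN⟩ := hinf.exists_subset_card_eq N
      obtain ⟨r, hr⟩ := Z.finite_toSet.isBounded.subset_ball (0 : ℂ)
      obtain ⟨R, hR, hfR⟩ := hcase (max r 1)
      rw [← hZN]
      exact exists_entropy_of_large_on_circle hf
        (zero_lt_one.trans_le ((le_max_right _ _).trans hR)) hfR
        (fun a ha ↦ ⟨ball_subset_ball ((le_max_left _ _).trans hR) (hr ha), hZ ha⟩)
        (Finset.card_pos.1 (by omega))
    · push Not at hcase
      exact exists_entropy_of_annuli hf (exists_mul_le_norm hf htrans) hcase hN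
  have hC : ∀ C : ℝ, ∃ K : Set ℂ, K.Nonempty ∧ IsCompact K ∧ Set.MapsTo f K K ∧
      (C : EReal) ≤ coverEntropy f K := fun C ↦ by
    obtain ⟨N, hN⟩ := exists_nat_ge (Real.exp (2 * C))
    have hN0 : (0 : ℝ) < N := (Real.exp_pos _).trans_le hN
    obtain ⟨K, hK, hKc, hKf, hKe⟩ := hlog N (by exact_mod_cast hN0)
    refine ⟨K, hK, hKc, hKf, le_trans ?_ hKe⟩
    have := (Real.le_log_iff_exp_le hN0).2 hN
    exact EReal.coe_le_coe_iff.2 (by linarith)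
  refine ⟨hC, EReal.eq_top_iff_forall_lt _ |>.2 fun C ↦ ?_⟩
  obtain ⟨K, hK, hKc, hKf, hKe⟩ := hC (C + 1)
  have h1 : (C : EReal) < ((C + 1 : ℝ) : EReal) := EReal.coe_lt_coe_iff.2 (by linarith)
  exact (h1.trans_le hKe).trans_le (le_iSup₂_of_le K ⟨hK, hKc, hKf⟩ le_rfl)
end
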